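/- arXiv:0706.1405 — 4 statements merged into one kernel-verified Lean document; each statement's English description precedes it below -/
import Mathlib

section
/- Every constructible simplicial complex of dimension d is (d−1)-connected. -/
open scoped BigOperators

/-- A (finite, abstract) simplicial complex on vertex set `V`:
a collection of finite subsets of `V` closed under taking subsets. -/
structure SC (V : Type*) where
  faces : Set (Finset V)
  down : ∀ ⦃s t : Finset V⦄, s ∈ faces → t ⊆ s → t ∈ faces

namespace SC

variable {V : Type*}

/-- The union of two simplicial complexes. -/
def union (Δ₁ Δ₂ : SC V) : SC V :=
  ⟨Δ₁.faces ∪ Δ₂.faces, by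
    rintro s t (h | h) hts
    · exact Or.inl (Δ₁.down h hts)
    · exact Or.inr (Δ₂.down h hts)⟩

/-- The intersection of two simplicial complexes. -/
def inter (Δ₁ Δ₂ : SC V) : SC V :=
  ⟨Δ₁.faces ∩ Δ₂.faces, fun _ _ h hts => ⟨Δ₁.down h.1 hts, Δ₂.down h.2 hts⟩⟩

/-- The simplex on a finite vertex set `s`: all subsets of `s`. -/
def simplex (s : Finset V) : SC V :=
  ⟨{t | t ⊆ s}, fun _ _ h h' => h'.trans h⟩

/-- The link of a face `F`: `{G \ F : G ∈ Δ, F ⊆ G}`. -/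
def link [DecidableEq V] (Δ : SC V) (F : Finset V) : SC V :=
  ⟨{G | Disjoint G F ∧ G ∪ F ∈ Δ.faces}, by
    rintro s t ⟨hd, hm⟩ hts
    exact ⟨hd.mono_left hts, Δ.down hm (Finset.union_subset_union hts le_rfl)⟩⟩

/-- The dimension of a simplicial complex, as an integer
(the complex `{∅}` has dimension `-1`). -/
noncomputable def dim (Δ : SC V) : ℤ :=
  sSup ((fun s : Finset V => (s.card : ℤ) - 1) '' Δ.faces)

/-- The geometric realization of a simplicial complex on a finite vertex set,
as a subspace of `V → ℝ`. -/
def realization [Fintype V] (Δ : SC V) : Set (V → ℝ) :=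
  {f | (∀ v, 0 ≤ f v) ∧ (∑ v, f v) = 1 ∧ ∃ s ∈ Δ.faces, ∀ v, f v ≠ 0 → v ∈ s}

end SC

/-- Constructibility (generalized): a `d`-dimensional complex is constructible
if it is a simplex, or the union of two `d`-dimensional constructible complexes
whose intersection is constructible of dimension at least `d - 1`. -/
inductive Constructible {V : Type*} : SC V → ℤ → Prop
  | simplex (s : Finset V) : Constructible (SC.simplex s) ((s.card : ℤ) - 1)
  | union {Δ₁ Δ₂ : SC V} {d e : ℤ} : Constructible Δ₁ d → Constructible Δ₂ d →
      d - 1 ≤ e → Constructible (SC.inter Δ₁ Δ₂) e →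
      Constructible (SC.union Δ₁ Δ₂) d

/-- A topological space is `k`-connected if it is nonempty (for `k ≥ -1`) and
all its homotopy groups `π_i` vanish for `0 ≤ i ≤ k`, at every basepoint. -/
def KConnected (k : ℤ) (X : Type*) [TopologicalSpace X] : Prop :=
  (-1 ≤ k → Nonempty X) ∧
    ∀ (x : X) (i : ℕ), (i : ℤ) ≤ k → Subsingleton (HomotopyGroup (Fin i) X x)

open Set Metric

/-- Every continuous map from the boundary of the `n`-cube (the unit ball of the sup norm) to `X`
extends to the whole cube. -/
def CubeExtends {Y : Type*} [TopologicalSpace Y] (n : ℕ) (X : Set Y) : Prop :=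
  ∀ f : (Fin n → ℝ) → Y, ContinuousOn f (sphere 0 1) → MapsTo f (sphere 0 1) X →
    ∃ g : (Fin n → ℝ) → Y, ContinuousOn g (closedBall 0 1) ∧ MapsTo g (closedBall 0 1) X ∧
      EqOn g f (sphere 0 1)

namespace GridCell

variable {ι : Type*}

/-- The cell of the integer grid with lowest corner `a` and directions `D`. -/
def cell (a : ι → ℤ) (D : Finset ι) : Set (ι → ℝ) :=
  {x | ∀ i, (a i : ℝ) ≤ x i ∧ x i ≤ a i + 1 ∧ (i ∉ D → x i = a i)}

lemma isClosed_cell (a : ι → ℤ) (D : Finset ι) : IsClosed (cell a D) := by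
  simp only [cell, ofPred_forall, ofPred_and]
  refine isClosed_iInter fun i => ?_
  refine (isClosed_le (by fun_prop) (by fun_prop)).inter
    ((isClosed_le (by fun_prop) (by fun_prop)).inter ?_)
  exact isClosed_iInter fun _ => isClosed_eq (by fun_prop) (by fun_prop)

/-- The lowest corner of the smallest grid cell containing `x`. -/
noncomputable def corner (x : ι → ℝ) : ι → ℤ := fun i => ⌊x i⌋

open Classical in
/-- The directions of the smallest grid cell containing `x`. -/
noncomputable def dirs [Fintype ι] (x : ι → ℝ) : Finset ι :=
  Finset.univ.filter fun i => x i ≠ ⌊x i⌋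

variable [Fintype ι]

lemma mem_dirs {x : ι → ℝ} {i : ι} : i ∈ dirs x ↔ x i ≠ ⌊x i⌋ := by
  simp [dirs]

lemma mem_cell_self (x : ι → ℝ) : x ∈ cell (corner x) (dirs x) := by
  intro i
  refine ⟨Int.floor_le _, (Int.lt_floor_add_one _).le, fun h => ?_⟩
  rw [mem_dirs, not_not] at h
  exact h

/-- In each coordinate of a cell, a point is either integral or lies strictly inside an edge. -/
lemma coord_cases {a : ι → ℤ} {D : Finset ι} {x : ι → ℝ} (hx : x ∈ cell a D) (i : ι) :
    (i ∉ dirs x ∧ corner x i = a i ∧ x i = a i) ∨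
    (i ∈ D ∧ i ∉ dirs x ∧ corner x i = a i + 1 ∧ x i = a i + 1) ∨
    (i ∈ D ∧ i ∈ dirs x ∧ corner x i = a i ∧ (a i : ℝ) < x i ∧ x i < a i + 1) := by
  obtain ⟨h1, h2, h3⟩ := hx i
  simp only [mem_dirs, corner]
  rcases h1.eq_or_lt with h | h
  · left
    simp [← h]
  · have hD : i ∈ D := by
      by_contra hD
      exact h.ne' (h3 hD)
    right
    rcases h2.eq_or_lt with h' | h'
    · left
      simp [h', hD]
    · right
      have hf : ⌊x i⌋ = a i := Int.floor_eq_iff.2 ⟨h1, h'⟩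
      rw [hf]
      exact ⟨hD, h.ne', rfl, h, h'⟩

lemma dirs_subset {a : ι → ℤ} {D : Finset ι} {x : ι → ℝ} (hx : x ∈ cell a D) : dirs x ⊆ D := by
  intro i hi
  rcases coord_cases hx i with h | h | h
  · exact absurd hi h.1
  · exact h.1
  · exact h.1

lemma cell_self_subset {a : ι → ℤ} {D : Finset ι} {x : ι → ℝ} (hx : x ∈ cell a D) :
    cell (corner x) (dirs x) ⊆ cell a D := by
  intro y hy i
  obtain ⟨h1, h2, h3⟩ := hy i
  rcases coord_cases hx i with ⟨h, h', -⟩ | ⟨hD, h, h', -⟩ | ⟨hD, h, h', -⟩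
  · have := h3 h
    rw [h'] at this
    exact ⟨this.ge, by linarith, fun _ => this⟩
  · have := h3 h
    rw [h'] at this
    push_cast at this
    exact ⟨by linarith, by linarith, fun hD' => absurd hD hD'⟩
  · rw [h'] at h1 h2
    exact ⟨h1, h2, fun hD' => absurd hD hD'⟩

lemma corner_eq_of_dirs_eq {a : ι → ℤ} {D : Finset ι} {x : ι → ℝ} (hx : x ∈ cell a D)
    (h : dirs x = D) : corner x = a := by
  funext i
  rcases coord_cases hx i with hc | hc | hc
  · exact hc.2.1
  · exact absurd (h ▸ hc.1) hc.2.1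
  · exact hc.2.2.1

/-- A function continuous on all cells of smaller dimension is continuous on the boundary. -/
lemma continuousOn_boundary {Y : Type*} [TopologicalSpace Y] {a : ι → ℤ} {D : Finset ι}
    {F : (ι → ℝ) → Y} (hF : ∀ b D', D'.card < D.card → ContinuousOn F (cell b D')) :
    ContinuousOn F {x ∈ cell a D | dirs x ≠ D} := by
  classical
  let T : D × Bool → Set (ι → ℝ) := fun p =>
    cell (if p.2 then Function.update a p.1 (a p.1 + 1) else a) (D.erase p.1)
  have hT : ContinuousOn F (⋃ p, T p) := by
    refine LocallyFinite.continuousOn_iUnion (locallyFinite_of_finite _)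
      (fun p => isClosed_cell _ _) fun p => hF _ _ (Finset.card_erase_lt_of_mem p.1.2)
  refine hT.mono ?_
  rintro x ⟨hx, hne⟩
  obtain ⟨i, hiD, hi⟩ : ∃ i ∈ D, i ∉ dirs x := by
    by_contra! h
    exact hne ((dirs_subset hx).antisymm h)
  rw [mem_iUnion]
  rcases coord_cases hx i with h | h | h
  · refine ⟨(⟨i, hiD⟩, false), fun j => ?_⟩
    obtain ⟨h1, h2, h3⟩ := hx j
    simp only [Bool.false_eq_true, if_false]
    refine ⟨h1, h2, fun hj => ?_⟩
    by_cases hji : j = i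
    · rw [hji]; exact h.2.2
    · exact h3 fun h' => hj (Finset.mem_erase.2 ⟨hji, h'⟩)
  · refine ⟨(⟨i, hiD⟩, true), fun j => ?_⟩
    obtain ⟨h1, h2, h3⟩ := hx j
    simp only [if_true]
    by_cases hji : j = i
    · subst hji
      simp [h.2.2.2]
    · rw [Function.update_of_ne hji]
      exact ⟨h1, h2, fun hj => h3 fun hmem => hj (Finset.mem_erase.2 ⟨hji, hmem⟩)⟩
  · exact absurd h.2.1 hi

/-- A map on the boundary of a grid cell extends to the cell. -/
lemma exists_extension_cell {Y : Type*} [TopologicalSpace Y] {X : Set Y} (a : ι → ℤ) (D : Finset ι)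
    (hX : CubeExtends D.card X) {F : (ι → ℝ) → Y}
    (hF : ContinuousOn F {x ∈ cell a D | dirs x ≠ D})
    (hm : MapsTo F {x ∈ cell a D | dirs x ≠ D} X) :
    ∃ G : (ι → ℝ) → Y, ContinuousOn G (cell a D) ∧ MapsTo G (cell a D) X ∧
      EqOn G F {x ∈ cell a D | dirs x ≠ D} := by
  classical
  let e := D.equivFin
  let φ : (Fin D.card → ℝ) → ι → ℝ := fun y i =>
    if h : i ∈ D then a i + (y (e ⟨i, h⟩) + 1) / 2 else a i
  let ψ : (ι → ℝ) → Fin D.card → ℝ := fun x k => 2 * (x (e.symm k) - a (e.symm k)) - 1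
  have hφc : Continuous φ := by
    refine continuous_pi fun i => ?_
    by_cases h : i ∈ D
    · simp only [φ, h, dif_pos]; fun_prop
    · simp only [φ, h, dif_neg, not_false_eq_true]; fun_prop
  have hψc : Continuous ψ := by fun_prop
  have hφψ : ∀ x ∈ cell a D, φ (ψ x) = x := by
    intro x hx
    funext i
    by_cases h : i ∈ D
    · simp only [φ, ψ, h, dif_pos, Equiv.symm_apply_apply]; ring
    · simp only [φ, h, dif_neg, not_false_eq_true]; exact ((hx i).2.2 h).symm
  have hφcell : ∀ y ∈ closedBall (0 : Fin D.card → ℝ) 1, φ y ∈ cell a D := by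
    intro y hy i
    rw [mem_closedBall_zero_iff, pi_norm_le_iff_of_nonneg zero_le_one] at hy
    by_cases h : i ∈ D
    · have := abs_le.1 (hy (e ⟨i, h⟩))
      have hφi : φ y i = a i + (y (e ⟨i, h⟩) + 1) / 2 := dif_pos h
      rw [hφi]
      exact ⟨by linarith, by linarith, fun h' => absurd h h'⟩
    · simp [φ, h]
  have hφbd : ∀ y ∈ sphere (0 : Fin D.card → ℝ) 1, φ y ∈ {x ∈ cell a D | dirs x ≠ D} := by
    intro y hy
    refine ⟨hφcell y (sphere_subset_closedBall hy), fun hd => ?_⟩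
    have hlt : ‖y‖ < 1 := by
      rw [pi_norm_lt_iff zero_lt_one]
      intro k
      have hk : (e.symm k : ι) ∈ dirs (φ y) := by
        rw [hd]
        exact (e.symm k).2
      rcases coord_cases (hφcell y (sphere_subset_closedBall hy)) (e.symm k) with h | h | h
      · exact absurd hk h.1
      · exact absurd hk h.2.1
      · have h4 := h.2.2.2
        simp only [φ, (e.symm k).2, dif_pos, Subtype.coe_eta, Equiv.apply_symm_apply] at h4
        exact abs_lt.2 ⟨by linarith, by linarith⟩
    exact hlt.ne (mem_sphere_zero_iff_norm.1 hy)
  have hψball : ∀ x ∈ cell a D, ψ x ∈ closedBall (0 : Fin D.card → ℝ) 1 := by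
    intro x hx
    rw [mem_closedBall_zero_iff, pi_norm_le_iff_of_nonneg zero_le_one]
    intro k
    have := hx (e.symm k)
    exact abs_le.2 ⟨by simp only [ψ]; linarith, by simp only [ψ]; linarith⟩
  have hψsph : ∀ x ∈ {x ∈ cell a D | dirs x ≠ D}, ψ x ∈ sphere (0 : Fin D.card → ℝ) 1 := by
    intro x hx'
    obtain ⟨hx, hne⟩ := hx'
    rw [mem_sphere_zero_iff_norm]
    refine le_antisymm (mem_closedBall_zero_iff.1 (hψball x hx)) ?_
    obtain ⟨i, hiD, hi⟩ : ∃ i ∈ D, i ∉ dirs x := by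
      by_contra! h
      exact hne ((dirs_subset hx).antisymm h)
    refine le_trans ?_ (norm_le_pi_norm (ψ x) (e ⟨i, hiD⟩))
    simp only [ψ, Equiv.symm_apply_apply, Real.norm_eq_abs]
    rcases coord_cases hx i with h | h | h
    · simp [h.2.2]
    · rw [h.2.2.2]
      refine le_trans ?_ (le_abs_self _)
      linarith
    · exact absurd h.2.1 hi
  obtain ⟨g, hgc, hgm, hge⟩ := hX (F ∘ φ) (hF.comp hφc.continuousOn hφbd) (hm.comp hφbd)
  refine ⟨g ∘ ψ, hgc.comp hψc.continuousOn hψball, hgm.comp hψball, fun x hx => ?_⟩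
  simp only [Function.comp_apply]
  rw [hge (hψsph x hx), Function.comp_apply, hφψ x hx.1]

/-- A map on a union `L` of grid cells that is carried by `R` extends to a map carried by `R`,
provided each `R a D` has the extension property in dimension `D.card`. -/
lemma exists_carried_extension {Y : Type*} [TopologicalSpace Y]
    (R : (ι → ℤ) → Finset ι → Set Y)
    (hR : ∀ a D a' D', cell a D ⊆ cell a' D' → D ⊂ D' → R a D ⊆ R a' D')
    (hExt : ∀ a D, CubeExtends D.card (R a D))
    {L : Set (ι → ℝ)} (hL : ∀ x ∈ L, cell (corner x) (dirs x) ⊆ L)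
    {f : (ι → ℝ) → Y} (hf : ContinuousOn f L) (hfR : ∀ x ∈ L, f x ∈ R (corner x) (dirs x)) :
    ∃ F : (ι → ℝ) → Y, EqOn F f L ∧ (∀ x, F x ∈ R (corner x) (dirs x)) ∧
      ∀ a D, ContinuousOn F (cell a D) := by
  classical
  have key : ∀ j : ℕ, ∃ F : (ι → ℝ) → Y, EqOn F f L ∧
      (∀ x, (x ∈ L ∨ (dirs x).card < j) → F x ∈ R (corner x) (dirs x)) ∧
      ∀ a D, (cell a D ⊆ L ∨ D.card < j) → ContinuousOn F (cell a D) := by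
    intro j
    induction j with
    | zero =>
      refine ⟨f, fun _ _ => rfl, fun x hx => hfR x (by simpa using hx), fun a D h => hf.mono ?_⟩
      simpa using h
    | succ j ih =>
      obtain ⟨F, hFL, hFR, hFc⟩ := ih
      have hG : ∀ a D, ∃ G : (ι → ℝ) → Y, D.card = j → ContinuousOn G (cell a D) ∧
          MapsTo G (cell a D) (R a D) ∧ EqOn G F {x ∈ cell a D | dirs x ≠ D} := by
        intro a D
        by_cases hD : D.card = j
        swap
        · exact ⟨F, fun h => absurd h hD⟩
        suffices h : ∃ G : (ι → ℝ) → Y, ContinuousOn G (cell a D) ∧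
            MapsTo G (cell a D) (R a D) ∧ EqOn G F {x ∈ cell a D | dirs x ≠ D} from
          h.imp fun G hG _ => hG
        refine exists_extension_cell a D (hExt a D)
          (continuousOn_boundary fun b D' h => hFc b D' (Or.inr (hD ▸ h))) ?_
        rintro x ⟨hx, hne⟩
        have hss : dirs x ⊂ D := (dirs_subset hx).ssubset_of_ne hne
        exact hR _ _ _ _ (cell_self_subset hx) hss
          (hFR x (Or.inr (hD ▸ Finset.card_lt_card hss)))
      choose G hG using hG
      refine ⟨fun x => if x ∈ L ∨ (dirs x).card ≠ j then F x else G (corner x) (dirs x) x,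
        fun x hx => ?_, fun x hx => ?_, fun a D h => ?_⟩
      · simp only [hx, true_or, if_true]
        exact hFL hx
      · by_cases h : x ∈ L ∨ (dirs x).card ≠ j
        · simp only [h, if_true]
          exact hFR x (by grind)
        · simp only [h, if_false]
          push Not at h
          exact (hG _ _ h.2).2.1 (mem_cell_self x)
      · by_cases h' : cell a D ⊆ L ∨ D.card < j
        · refine (hFc a D h').congr fun x hx => if_pos ?_
          exact h'.imp (fun h => h hx)
            fun h => ((Finset.card_le_card (dirs_subset hx)).trans_lt h).ne
        · push Not at h'
          have hD : D.card = j := by grind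
          refine (hG a D hD).1.congr fun x hx => ?_
          by_cases hxD : dirs x = D
          · have hc := corner_eq_of_dirs_eq hx hxD
            have hxL : x ∉ L := fun hxL => h'.1 (by simpa only [hc, hxD] using hL x hxL)
            simp [hxL, hxD, hD, hc]
          · rw [(hG a D hD).2.2 ⟨hx, hxD⟩]
            refine if_pos (Or.inr ?_)
            exact (hD ▸ Finset.card_lt_card ((dirs_subset hx).ssubset_of_ne hxD)).ne
  obtain ⟨F, hFL, hFR, hFc⟩ := key (Fintype.card ι + 1)
  exact ⟨F, hFL, fun x => hFR x (Or.inr (Nat.lt_succ_of_le (Finset.card_le_univ _))),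
    fun a D => hFc a D (Or.inr (Nat.lt_succ_of_le (Finset.card_le_univ _)))⟩

/-- The boundary of the cube of integral size `N` is a union of grid cells. -/
lemma cell_subset_sphere {N : ℕ} (hN : 0 < N) {x : ι → ℝ} (hx : x ∈ sphere (0 : ι → ℝ) N) :
    cell (corner x) (dirs x) ⊆ sphere (0 : ι → ℝ) N := by
  intro y hy
  rw [mem_sphere_zero_iff_norm] at hx ⊢
  have hN' : (0 : ℝ) < N := by exact_mod_cast hN
  apply le_antisymm
  · rw [pi_norm_le_iff_of_nonneg hN'.le]
    intro i
    have hxi := abs_le.1 ((norm_le_pi_norm x i).trans hx.le)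
    obtain ⟨h1, h2, h3⟩ := hy i
    have hlo : -(N : ℤ) ≤ ⌊x i⌋ := Int.le_floor.2 (by push_cast; exact hxi.1)
    have hlo' : -(N : ℝ) ≤ ⌊x i⌋ := by exact_mod_cast hlo
    simp only [corner] at h1 h2 h3
    refine abs_le.2 ⟨hlo'.trans h1, ?_⟩
    by_cases hi : i ∈ dirs x
    · have hne := mem_dirs.1 hi
      have hlt : (⌊x i⌋ : ℝ) < N :=
        lt_of_lt_of_le (lt_of_le_of_ne (Int.floor_le _) hne.symm) hxi.2
      have hlt' : ⌊x i⌋ < (N : ℤ) := by exact_mod_cast hlt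
      have : ((⌊x i⌋ + 1 : ℤ) : ℝ) ≤ N := by exact_mod_cast hlt'
      push_cast at this
      linarith
    · rw [h3 hi]
      exact (Int.floor_le _).trans hxi.2
  · obtain ⟨i, hi⟩ : ∃ i, (N : ℝ) ≤ ‖x i‖ := by
      by_contra! h
      exact ((pi_norm_lt_iff hN').2 h).ne hx
    have hxi := abs_le.1 ((norm_le_pi_norm x i).trans hx.le)
    refine le_trans ?_ (norm_le_pi_norm y i)
    have hx' : x i = N ∨ x i = -N := by
      rcases le_abs.1 hi with h | h
      · exact Or.inl (le_antisymm hxi.2 h)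
      · exact Or.inr (le_antisymm (by linarith) hxi.1)
    have hfl : (⌊x i⌋ : ℝ) = x i := by
      rcases hx' with h | h
      · rw [h]; simp
      · rw [h]
        have : ⌊(-(N : ℝ))⌋ = -(N : ℤ) := by
          rw [Int.floor_eq_iff]; push_cast; constructor <;> linarith
        rw [this]; push_cast; rfl
    have hyi : y i = x i := by
      have h3 := (hy i).2.2 (fun h => mem_dirs.1 h hfl.symm)
      rw [h3]; exact hfl
    rw [hyi]; exact hi

/-- A function continuous on every grid cell is continuous on every cube. -/
lemma continuousOn_closedBall {Y : Type*} [TopologicalSpace Y] {F : (ι → ℝ) → Y}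
    (hF : ∀ a D, ContinuousOn F (cell a D)) (N : ℕ) :
    ContinuousOn F (closedBall (0 : ι → ℝ) N) := by
  classical
  have hT : ContinuousOn F (⋃ a : Icc (fun _ : ι => -(N : ℤ)) (fun _ => (N : ℤ)),
      cell (a : ι → ℤ) Finset.univ) :=
    LocallyFinite.continuousOn_iUnion (locallyFinite_of_finite _)
      (fun _ => isClosed_cell _ _) fun _ => hF _ _
  refine hT.mono fun x hx => mem_iUnion.2 ⟨⟨corner x, ?_⟩, ?_⟩
  · rw [mem_closedBall_zero_iff, pi_norm_le_iff_of_nonneg (by positivity)] at hx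
    constructor
    · intro i
      exact Int.le_floor.2 (by push_cast; exact (abs_le.1 (hx i)).1)
    · intro i
      have := (Int.floor_le (x i)).trans (abs_le.1 (hx i)).2
      exact_mod_cast this
  · exact fun i => ⟨Int.floor_le _, (Int.lt_floor_add_one _).le,
      fun h => absurd (Finset.mem_univ i) h⟩

lemma dist_le_one {a : ι → ℤ} {D : Finset ι} {x y : ι → ℝ} (hx : x ∈ cell a D)
    (hy : y ∈ cell a D) : dist x y ≤ 1 := by
  rw [dist_pi_le_iff zero_le_one]
  intro i
  have h1 := hx i
  have h2 := hy i
  exact abs_le.2 ⟨by linarith, by linarith⟩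

end GridCell

section Gluing

variable {Y : Type*} [TopologicalSpace Y]

/-- If `H` is a homotopy of the identity of `X` and `H 1 ∘ f` extends from the boundary of the cube
to the cube, then so does `f`. -/
lemma exists_extension_of_homotopy {X : Set Y} {n : ℕ} {H : ℝ → Y → Y}
    (hH : ContinuousOn (fun p : ℝ × Y => H p.1 p.2) (Icc 0 1 ×ˢ X))
    (hHX : ∀ t ∈ Icc (0 : ℝ) 1, MapsTo (H t) X X) (hH0 : ∀ x ∈ X, H 0 x = x)
    {f g : (Fin n → ℝ) → Y} (hf : ContinuousOn f (sphere 0 1)) (hfX : MapsTo f (sphere 0 1) X)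
    (hg : ContinuousOn g (closedBall 0 1)) (hgX : MapsTo g (closedBall 0 1) X)
    (hgf : ∀ x ∈ sphere (0 : Fin n → ℝ) 1, g x = H 1 (f x)) :
    ∃ g : (Fin n → ℝ) → Y, ContinuousOn g (closedBall 0 1) ∧ MapsTo g (closedBall 0 1) X ∧
      EqOn g f (sphere 0 1) := by
  have hdouble : MapsTo (fun y : Fin n → ℝ => (2 : ℝ) • y) (closedBall 0 (1 / 2))
      (closedBall 0 1) := by
    intro y hy
    rw [mem_closedBall_zero_iff] at hy ⊢
    rw [norm_smul, Real.norm_ofNat]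
    linarith
  have hpos : ∀ y ∈ {y : Fin n → ℝ | 1 / 2 ≤ ‖y‖ ∧ ‖y‖ ≤ 1}, 0 < ‖y‖ := fun y hy =>
    lt_of_lt_of_le one_half_pos hy.1
  have hradial : MapsTo (fun y : Fin n → ℝ => ‖y‖⁻¹ • y) {y | 1 / 2 ≤ ‖y‖ ∧ ‖y‖ ≤ 1}
      (sphere 0 1) := by
    intro y hy
    rw [mem_sphere_zero_iff_norm, norm_smul, norm_inv, norm_norm,
      inv_mul_cancel₀ (hpos y hy).ne']
  have htime : MapsTo (fun y : Fin n → ℝ => 2 - 2 * ‖y‖) {y | 1 / 2 ≤ ‖y‖ ∧ ‖y‖ ≤ 1}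
      (Icc 0 1) := fun y hy => ⟨by linarith [hy.2], by linarith [hy.1]⟩
  let k : (Fin n → ℝ) → Y := fun y =>
    if ‖y‖ ≤ 1 / 2 then g ((2 : ℝ) • y) else H (2 - 2 * ‖y‖) (f (‖y‖⁻¹ • y))
  have hk1 : EqOn k (fun y => g ((2 : ℝ) • y)) (closedBall 0 (1 / 2)) := fun y hy =>
    if_pos (mem_closedBall_zero_iff.1 hy)
  have hk2 : EqOn k (fun y => H (2 - 2 * ‖y‖) (f (‖y‖⁻¹ • y)))
      {y | 1 / 2 ≤ ‖y‖ ∧ ‖y‖ ≤ 1} := by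
    intro y hy
    by_cases h : ‖y‖ ≤ 1 / 2
    · have h' : ‖y‖ = 1 / 2 := le_antisymm h hy.1
      have hs := hradial hy
      simp only [h', one_div, inv_inv] at hs
      simp only [k, h', one_div, inv_inv]
      rw [hgf _ hs]
      norm_num
    · exact if_neg h
  have hcover : closedBall (0 : Fin n → ℝ) 1 ⊆
      closedBall 0 (1 / 2) ∪ {y | 1 / 2 ≤ ‖y‖ ∧ ‖y‖ ≤ 1} := by
    intro y hy
    rcases le_total ‖y‖ (1 / 2) with h | h
    · exact Or.inl (mem_closedBall_zero_iff.2 h)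
    · exact Or.inr ⟨h, mem_closedBall_zero_iff.1 hy⟩
  refine ⟨k, ContinuousOn.mono ?_ hcover, fun y hy => ?_, fun y hy => ?_⟩
  · have hclosed : IsClosed {y : Fin n → ℝ | 1 / 2 ≤ ‖y‖ ∧ ‖y‖ ≤ 1} :=
      (isClosed_le continuous_const continuous_norm).inter
        (isClosed_le continuous_norm continuous_const)
    refine ContinuousOn.union_of_isClosed ?_ ?_ isClosed_closedBall hclosed
    · exact (hg.comp (by fun_prop) hdouble).congr hk1
    · refine ContinuousOn.congr ?_ hk2
      have hrc : ContinuousOn (fun y : Fin n → ℝ => ‖y‖⁻¹ • y) {y | 1 / 2 ≤ ‖y‖ ∧ ‖y‖ ≤ 1} :=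
        (continuousOn_id.norm.inv₀ fun y hy => (hpos y hy).ne').smul continuousOn_id
      exact hH.comp (f := fun y : Fin n → ℝ => (2 - 2 * ‖y‖, f (‖y‖⁻¹ • y)))
        (ContinuousOn.prodMk (by fun_prop) (hf.comp hrc hradial))
        fun y hy => ⟨htime hy, hfX (hradial hy)⟩
  · rcases hcover hy with h | h
    · rw [hk1 h]; exact hgX (hdouble h)
    · rw [hk2 h]; exact hHX _ (htime h) (hfX (hradial h))
  · have h1 : ‖y‖ = 1 := mem_sphere_zero_iff_norm.1 hy
    rw [hk2 ⟨by norm_num [h1], h1.le⟩]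
    simp only [h1, inv_one, one_smul, mul_one, sub_self]
    exact hH0 _ (hfX hy)

/-- A space that contracts to one of its points has the extension property in all dimensions. -/
lemma cubeExtends_of_contraction {X : Set Y} (n : ℕ) {H : ℝ → Y → Y} {c : Y} (hc : c ∈ X)
    (hH : ContinuousOn (fun p : ℝ × Y => H p.1 p.2) (Icc 0 1 ×ˢ X))
    (hHX : ∀ t ∈ Icc (0 : ℝ) 1, MapsTo (H t) X X) (hH0 : ∀ x ∈ X, H 0 x = x)
    (hH1 : ∀ x ∈ X, H 1 x = c) : CubeExtends n X := fun _ hf hfX =>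
  exists_extension_of_homotopy hH hHX hH0 hf hfX (g := fun _ => c) continuousOn_const
    (fun _ _ => hc) fun _ hx => (hH1 _ (hfX hx)).symm

open GridCell in
/-- Gluing: suppose a homotopy of `A ∪ B` pushes one open set into `A` and another into `B`, the two
together covering `A ∪ B`. If `A` and `B` have the extension property up to dimension `n` and
`A ∩ B` has it below `n`, then `A ∪ B` has it in dimension `n`. -/
lemma CubeExtends.union {A B U V : Set Y} {n : ℕ} {H : ℝ → Y → Y}
    (hH : ContinuousOn (fun p : ℝ × Y => H p.1 p.2) (Icc 0 1 ×ˢ (A ∪ B)))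
    (hHX : ∀ t ∈ Icc (0 : ℝ) 1, MapsTo (H t) (A ∪ B) (A ∪ B)) (hH0 : ∀ x ∈ A ∪ B, H 0 x = x)
    (hU : IsOpen U) (hV : IsOpen V) (hUV : A ∪ B ⊆ U ∪ V)
    (hHU : ∀ x ∈ A ∪ B, x ∈ U → H 1 x ∈ A) (hHV : ∀ x ∈ A ∪ B, x ∈ V → H 1 x ∈ B)
    (hA : ∀ m ≤ n, CubeExtends m A) (hB : ∀ m ≤ n, CubeExtends m B)
    (hAB : ∀ m < n, CubeExtends m (A ∩ B)) : CubeExtends n (A ∪ B) := by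
  classical
  intro f hf hfX
  have hopen : ∀ W : Set Y, IsOpen W →
      IsOpen {x : Fin n → ℝ | x ∈ sphere (0 : Fin n → ℝ) 1 → f x ∈ W} := by
    intro W hW
    have h := hf.preimage_isClosed_of_isClosed isClosed_sphere hW.isClosed_compl
    rw [← isOpen_compl_iff] at h
    convert h using 1
    ext x
    simp
  obtain ⟨δ, hδ, hball⟩ := lebesgue_number_lemma_of_metric (isCompact_sphere (0 : Fin n → ℝ) 1)
    (c := fun b : Bool => {x : Fin n → ℝ | x ∈ sphere (0 : Fin n → ℝ) 1 → f x ∈ cond b U V})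
    (fun b => hopen _ (by cases b <;> assumption)) (fun x hx => by
      rcases hUV (hfX hx) with h | h
      · exact mem_iUnion.2 ⟨true, fun _ => h⟩
      · exact mem_iUnion.2 ⟨false, fun _ => h⟩)
  obtain ⟨N', hN'⟩ := exists_nat_one_div_lt hδ
  obtain ⟨N, hN, hNδ⟩ : ∃ N : ℕ, 0 < N ∧ (N : ℝ)⁻¹ < δ :=
    ⟨N' + 1, N'.succ_pos, by simpa using hN'⟩
  have hNpos : (0 : ℝ) < N := by exact_mod_cast hN
  have hshrink : MapsTo (fun x : Fin n → ℝ => (N : ℝ)⁻¹ • x) (sphere 0 N) (sphere 0 1) := by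
    intro x hx
    rw [mem_sphere_zero_iff_norm] at hx ⊢
    rw [norm_smul, hx, norm_inv, Real.norm_natCast, inv_mul_cancel₀ hNpos.ne']
  let P : Set Y → (Fin n → ℤ) → Finset (Fin n) → Prop := fun W a D =>
    ∀ x ∈ cell a D, x ∈ sphere (0 : Fin n → ℝ) N → f ((N : ℝ)⁻¹ • x) ∈ W
  have hPmono : ∀ W a D a' D', cell a D ⊆ cell a' D' → P W a' D' → P W a D :=
    fun W a D a' D' h hP x hx => hP x (h hx)
  have hPUV : ∀ a D, P U a D ∨ P V a D := by
    intro a D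
    by_cases h : ∃ x ∈ cell a D, x ∈ sphere (0 : Fin n → ℝ) N
    · obtain ⟨x, hx, hxs⟩ := h
      obtain ⟨b, hb⟩ := hball _ (hshrink hxs)
      have hPb : P (cond b U V) a D := by
        intro y hy hys
        refine hb ?_ (hshrink hys)
        rw [mem_ball, dist_smul₀, norm_inv, Real.norm_natCast]
        have := mul_le_mul_of_nonneg_left (dist_le_one hy hx) (inv_pos.2 hNpos).le
        linarith
      cases b
      · exact Or.inr hPb
      · exact Or.inl hPb
    · push Not at h
      exact Or.inl fun x hx hxs => absurd hxs (h x hx)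
  let R : (Fin n → ℤ) → Finset (Fin n) → Set Y := fun a D =>
    if D.card < n ∧ P U a D ∧ P V a D then A ∩ B else if P U a D then A else B
  have hRsub : ∀ a D, R a D ⊆ A ∪ B := by
    intro a D
    simp only [R]
    split_ifs
    · exact inter_subset_left.trans subset_union_left
    · exact subset_union_left
    · exact subset_union_right
  have hR : ∀ a D a' D', cell a D ⊆ cell a' D' → D ⊂ D' → R a D ⊆ R a' D' := by
    intro a D a' D' hsub hD
    have hcard : D.card < n :=
      (Finset.card_lt_card hD).trans_le ((Finset.card_le_univ D').trans_eq (Fintype.card_fin n))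
    have hU' := hPmono U _ _ _ _ hsub
    have hV' := hPmono V _ _ _ _ hsub
    have hor := hPUV a D
    simp only [R, hcard, true_and]
    by_cases hU2 : P U a D <;> by_cases hV2 : P V a D
    · simp only [hU2, hV2, and_self, if_true]
      split_ifs
      exacts [subset_rfl, inter_subset_left, inter_subset_right]
    · simp only [hU2, hV2, mt hV' hV2, and_false, if_false, if_true]
      split_ifs with h
      · exact subset_rfl
      · exact absurd ((hPUV a' D').resolve_right (mt hV' hV2)) h
    · simp only [hU2, mt hU' hU2, false_and, and_false, if_false, subset_rfl]
    · exact absurd hor (by simp [hU2, hV2])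
  have hExt : ∀ a D, CubeExtends D.card (R a D) := by
    intro a D
    have hcard : D.card ≤ n := (Finset.card_le_univ D).trans_eq (Fintype.card_fin n)
    simp only [R]
    split_ifs with h1 h2
    · exact hAB _ h1.1
    · exact hA _ hcard
    · exact hB _ hcard
  have hc : ContinuousOn (fun x => H 1 (f ((N : ℝ)⁻¹ • x))) (sphere 0 N) := by
    have h1 : ContinuousOn (H 1) (A ∪ B) :=
      hH.comp (f := fun y => ((1 : ℝ), y)) (by fun_prop) fun y hy => ⟨by simp, hy⟩
    exact h1.comp (hf.comp (by fun_prop) hshrink) fun x hx => hfX (hshrink hx)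
  have hcR : ∀ x ∈ sphere (0 : Fin n → ℝ) N,
      H 1 (f ((N : ℝ)⁻¹ • x)) ∈ R (corner x) (dirs x) := by
    intro x hx
    have hX := hfX (hshrink hx)
    have hxU : P U (corner x) (dirs x) → H 1 (f ((N : ℝ)⁻¹ • x)) ∈ A := fun h =>
      hHU _ hX (h x (mem_cell_self x) hx)
    have hxV : P V (corner x) (dirs x) → H 1 (f ((N : ℝ)⁻¹ • x)) ∈ B := fun h =>
      hHV _ hX (h x (mem_cell_self x) hx)
    have hor := hPUV (corner x) (dirs x)
    simp only [R]
    split_ifs with h1 h2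
    · exact ⟨hxU h1.2.1, hxV h1.2.2⟩
    · exact hxU h2
    · exact hxV (hor.resolve_left h2)
  obtain ⟨F, hFe, hFR, hFc⟩ := exists_carried_extension R hR hExt
    (fun x hx => cell_subset_sphere hN hx) hc hcR
  have hgrow : MapsTo (fun x : Fin n → ℝ => (N : ℝ) • x) (closedBall 0 1) (closedBall 0 N) := by
    intro x hx
    rw [mem_closedBall_zero_iff] at hx ⊢
    rw [norm_smul, Real.norm_natCast]
    exact mul_le_of_le_one_right hNpos.le hx
  refine exists_extension_of_homotopy hH hHX hH0 hf hfX (g := fun x => F ((N : ℝ) • x))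
    ((continuousOn_closedBall hFc N).comp (by fun_prop) hgrow)
    (fun x _ => hRsub _ _ (hFR _)) fun x hx => ?_
  rw [hFe (by
    rw [mem_sphere_zero_iff_norm] at hx ⊢
    rw [norm_smul, Real.norm_natCast, hx, mul_one])]
  simp only [smul_smul, inv_mul_cancel₀ hNpos.ne', one_smul]

end Gluing

section HomotopyGroups

variable {Y : Type*} [TopologicalSpace Y]

lemma CubeExtends.nonempty [Nonempty Y] {X : Set Y} (h : CubeExtends 0 X) : X.Nonempty := by
  have hs : sphere (0 : Fin 0 → ℝ) 1 = ∅ :=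
    sphere_eq_empty_of_subsingleton one_ne_zero
  obtain ⟨g, -, hg, -⟩ := h (fun _ => Classical.arbitrary Y)
    (by rw [hs]; exact continuousOn_empty _) (by rw [hs]; exact mapsTo_empty _ _)
  exact ⟨g 0, hg (mem_closedBall_self zero_le_one)⟩

/-- The affine map from the cube `[-1, 1]^i` onto `[0, 1]^i`, extended by clamping. -/
noncomputable def unitCubeOfReal {i : ℕ} (z : Fin i → ℝ) : Fin i → unitInterval :=
  fun j => projIcc 0 1 zero_le_one ((z j + 1) / 2)

lemma continuous_unitCubeOfReal {i : ℕ} :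
    Continuous (unitCubeOfReal : (Fin i → ℝ) → Fin i → unitInterval) :=
  continuous_pi fun j => continuous_projIcc.comp (by fun_prop)

lemma unitCubeOfReal_apply {i : ℕ} (z : Fin i → unitInterval) :
    unitCubeOfReal (fun j => 2 * (z j : ℝ) - 1) = z := by
  funext j
  have h : (2 * (z j : ℝ) - 1 + 1) / 2 = z j := by ring
  simp only [unitCubeOfReal, h, projIcc_val]

lemma unitCubeOfReal_mem_boundary {i : ℕ} {z : Fin i → ℝ} {j : Fin i} (h : |z j| = 1) :
    unitCubeOfReal z ∈ Cube.boundary (Fin i) := by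
  refine ⟨j, ?_⟩
  rcases eq_or_eq_neg_of_abs_eq h with h | h
  · right
    simp [unitCubeOfReal, h]
  · left
    simp [unitCubeOfReal, h]

/-- The extension property in dimension `i + 1` makes the `i`-th homotopy groups trivial. -/
lemma CubeExtends.subsingleton_homotopyGroup {X : Set Y} {i : ℕ} (h : CubeExtends (i + 1) X)
    (x : X) : Subsingleton (HomotopyGroup (Fin i) X x) := by
  refine ⟨fun a b => Quotient.inductionOn₂ a b fun p q => Quotient.sound ?_⟩
  let P : (Fin (i + 1) → ℝ) → Y := fun y => (p (unitCubeOfReal (Fin.tail y)) : Y)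
  let Q : (Fin (i + 1) → ℝ) → Y := fun y => (q (unitCubeOfReal (Fin.tail y)) : Y)
  have htail : Continuous fun y : Fin (i + 1) → ℝ => Fin.tail y :=
    continuous_pi fun j => continuous_apply j.succ
  have hP : Continuous P :=
    continuous_subtype_val.comp (p.1.continuous.comp (continuous_unitCubeOfReal.comp htail))
  have hQ : Continuous Q :=
    continuous_subtype_val.comp (q.1.continuous.comp (continuous_unitCubeOfReal.comp htail))
  have hside : ∀ y : Fin (i + 1) → ℝ, ∀ j : Fin i, |y j.succ| = 1 → P y = x ∧ Q y = x := by
    intro y j hj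
    have hb : unitCubeOfReal (Fin.tail y) ∈ Cube.boundary (Fin i) :=
      unitCubeOfReal_mem_boundary (j := j) hj
    exact ⟨congrArg Subtype.val (p.2 _ hb), congrArg Subtype.val (q.2 _ hb)⟩
  have hcases : ∀ y ∈ sphere (0 : Fin (i + 1) → ℝ) 1, |y 0| = 1 ∨ ∃ j : Fin i, |y j.succ| = 1 := by
    intro y hy
    rw [mem_sphere_zero_iff_norm] at hy
    by_contra! hne
    refine hy.not_lt ((pi_norm_lt_iff zero_lt_one).2 fun k => ?_)
    have hk : |y k| ≤ 1 := hy ▸ norm_le_pi_norm y k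
    refine lt_of_le_of_ne hk ?_
    cases k using Fin.cases with
    | zero => exact hne.1
    | succ j => exact hne.2 j
  let f : (Fin (i + 1) → ℝ) → Y := fun y => if y 0 ≤ 0 then P y else Q y
  have hfP : ∀ y, y 0 ≤ 0 → f y = P y := fun y hy => if_pos hy
  have hfQ : ∀ y ∈ sphere (0 : Fin (i + 1) → ℝ) 1, 0 ≤ y 0 → f y = Q y := by
    intro y hy hy0
    by_cases h0 : y 0 ≤ 0
    · rw [hfP y h0]
      rcases hcases y hy with h1 | ⟨j, hj⟩
      · simp [le_antisymm h0 hy0] at h1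
      · rw [(hside y j hj).1, (hside y j hj).2]
    · exact if_neg h0
  have hfc : ContinuousOn f (sphere 0 1) := by
    have h1 : ContinuousOn f (sphere 0 1 ∩ {y | y 0 ≤ 0}) :=
      hP.continuousOn.congr fun y hy => hfP y hy.2
    have h2 : ContinuousOn f (sphere 0 1 ∩ {y | 0 ≤ y 0}) :=
      hQ.continuousOn.congr fun y hy => hfQ y hy.1 hy.2
    refine (h1.union_of_isClosed h2
      (isClosed_sphere.inter (isClosed_le (continuous_apply 0) continuous_const))
      (isClosed_sphere.inter (isClosed_le continuous_const (continuous_apply 0)))).mono ?_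
    intro y hy
    exact (le_total (y 0) 0).imp (fun h => ⟨hy, h⟩) fun h => ⟨hy, h⟩
  have hfX : MapsTo f (sphere 0 1) X := by
    intro y _
    simp only [f]
    split_ifs
    · exact Subtype.coe_prop _
    · exact Subtype.coe_prop _
  obtain ⟨g, hgc, hgX, hgf⟩ := h f hfc hfX
  let c : unitInterval × (Fin i → unitInterval) → Fin (i + 1) → ℝ := fun s =>
    Fin.cons (2 * (s.1 : ℝ) - 1) fun j => 2 * (s.2 j : ℝ) - 1
  have hc : Continuous c := by
    refine continuous_pi fun k => ?_
    cases k using Fin.cases with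
    | zero => simp only [c, Fin.cons_zero]; fun_prop
    | succ j => simp only [c, Fin.cons_succ]; fun_prop
  have hcoord : ∀ t : unitInterval, |2 * (t : ℝ) - 1| ≤ 1 := fun t =>
    abs_le.2 ⟨by linarith [t.2.1], by linarith [t.2.2]⟩
  have hcball : ∀ s, c s ∈ closedBall (0 : Fin (i + 1) → ℝ) 1 := by
    intro s
    rw [mem_closedBall_zero_iff, pi_norm_le_iff_of_nonneg zero_le_one]
    intro k
    cases k using Fin.cases with
    | zero => exact hcoord s.1
    | succ j => exact hcoord (s.2 j)
  have hcsphere : ∀ s k, |c s k| = 1 → c s ∈ sphere (0 : Fin (i + 1) → ℝ) 1 := by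
    intro s k hk
    rw [mem_sphere_zero_iff_norm]
    exact le_antisymm (mem_closedBall_zero_iff.1 (hcball s)) (hk ▸ norm_le_pi_norm (c s) k)
  have hPc : ∀ s, P (c s) = p s.2 := fun s => by
    simp only [P, c, Fin.tail_cons, unitCubeOfReal_apply]
  have hQc : ∀ s, Q (c s) = q s.2 := fun s => by
    simp only [Q, c, Fin.tail_cons, unitCubeOfReal_apply]
  refine ⟨⟨⟨⟨fun s => ⟨g (c s), hgX (hcball s)⟩, ?_⟩, fun z => ?_, fun z => ?_⟩, ?_⟩⟩
  · exact (hgc.comp_continuous hc hcball).subtype_mk _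
  · apply Subtype.ext
    have h0 : c (0, z) 0 = -1 := by simp [c]
    change g (c (0, z)) = (p z : Y)
    rw [hgf (hcsphere _ 0 (by simp [h0])), hfP _ (by rw [h0]; norm_num), hPc]
  · apply Subtype.ext
    have h1 : c (1, z) 0 = 1 := by simp [c]; norm_num
    change g (c (1, z)) = (q z : Y)
    have hs := hcsphere (1, z) 0 (by simp [h1])
    rw [hgf hs, hfQ _ hs (by rw [h1]; norm_num), hQc]
  · intro t z hz
    apply Subtype.ext
    change g (c (t, z)) = (p z : Y)
    have hpz : p z = x := p.2 z hz
    rw [hpz]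
    obtain ⟨j, hj⟩ := hz
    have hj' : |c (t, z) j.succ| = 1 := by
      rcases hj with hj | hj
      · simp [c, hj]
      · simp [c, hj]; norm_num
    rw [hgf (hcsphere _ _ hj')]
    have hPQ := hside _ j hj'
    simp only [f, hPQ.1, hPQ.2, ite_self]

end HomotopyGroups

namespace SC

variable {V : Type*} [Fintype V]

lemma realization_union (Δ₁ Δ₂ : SC V) :
    (SC.union Δ₁ Δ₂).realization = Δ₁.realization ∪ Δ₂.realization := by
  ext x
  simp only [realization, SC.union, mem_union, mem_ofPred_eq, or_and_right, exists_or, and_or_left]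

lemma realization_inter (Δ₁ Δ₂ : SC V) :
    (SC.inter Δ₁ Δ₂).realization = Δ₁.realization ∩ Δ₂.realization := by
  classical
  ext x
  constructor
  · rintro ⟨h0, h1, s, hs, hx⟩
    exact ⟨⟨h0, h1, s, hs.1, hx⟩, ⟨h0, h1, s, hs.2, hx⟩⟩
  · rintro ⟨⟨h0, h1, s, hs, hx⟩, ⟨-, -, t, ht, hx'⟩⟩
    exact ⟨h0, h1, s ∩ t, ⟨Δ₁.down hs Finset.inter_subset_left,
      Δ₂.down ht Finset.inter_subset_right⟩, fun v hv => Finset.mem_inter.2 ⟨hx v hv, hx' v hv⟩⟩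

lemma cubeExtends_realization_simplex {s : Finset V} (hs : s.Nonempty) (n : ℕ) :
    CubeExtends n (SC.simplex s).realization := by
  classical
  obtain ⟨v₀, hv₀⟩ := hs
  have hmem : ∀ x : V → ℝ, x ∈ (SC.simplex s).realization ↔
      (∀ v, 0 ≤ x v) ∧ ∑ v, x v = 1 ∧ ∀ v, x v ≠ 0 → v ∈ s := by
    intro x
    refine and_congr_right fun _ => and_congr_right fun _ =>
      ⟨?_, fun h => ⟨s, Finset.Subset.refl s, h⟩⟩
    rintro ⟨t, ht, h⟩ v hv
    exact ht (h v hv)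
  have hc : Pi.single v₀ (1 : ℝ) ∈ (SC.simplex s).realization := by
    rw [hmem]
    refine ⟨fun v => ?_, by simp, fun v hv => ?_⟩
    · by_cases h : v = v₀
      · subst h; simp
      · simp [h]
    · by_cases h : v = v₀
      · exact h ▸ hv₀
      · simp [h] at hv
  refine cubeExtends_of_contraction n hc
    (H := fun t x => (1 - t) • x + t • (Pi.single v₀ (1 : ℝ) : V → ℝ)) (by fun_prop) ?_
    (by simp) (by simp)
  rintro t ⟨ht0, ht1⟩ x hx
  rw [hmem] at hx hc ⊢
  refine ⟨fun v => ?_, ?_, fun v hv => ?_⟩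
  · have h1 := hx.1 v
    have h2 := hc.1 v
    have h3 : 0 ≤ 1 - t := by linarith
    simp only [Pi.add_apply, Pi.smul_apply, smul_eq_mul]
    positivity
  · simp only [Pi.add_apply, Pi.smul_apply, smul_eq_mul, Finset.sum_add_distrib, ← Finset.mul_sum,
      hx.2.1, hc.2.1]
    ring
  · by_contra hvs
    have h1 := not_imp_comm.1 (hx.2.2 v) hvs
    have h2 := not_imp_comm.1 (hc.2.2 v) hvs
    simp [h1, h2] at hv

/-- Lower all barycentric coordinates by `r`, cut off at zero, and renormalize. -/
noncomputable def trim (r : ℝ) (x : V → ℝ) : V → ℝ := fun v =>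
  max (x v - r) 0 / ∑ w, max (x w - r) 0

lemma trim_sum_pos {Δ : SC V} {x : V → ℝ} (hx : x ∈ Δ.realization) {r : ℝ}
    (hr : r ≤ (Fintype.card V + 1 : ℝ)⁻¹) : 0 < ∑ w, max (x w - r) 0 := by
  have h1 : ∑ w, (x w - r) ≤ ∑ w, max (x w - r) 0 :=
    Finset.sum_le_sum fun w _ => le_max_left _ _
  rw [Finset.sum_sub_distrib, hx.2.1, Finset.sum_const, nsmul_eq_mul, Finset.card_univ] at h1
  have hpos : (0 : ℝ) < Fintype.card V + 1 := by positivity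
  have h2 : (Fintype.card V : ℝ) * r ≤ Fintype.card V * (Fintype.card V + 1 : ℝ)⁻¹ :=
    mul_le_mul_of_nonneg_left hr (by positivity)
  have h3 : (Fintype.card V : ℝ) * (Fintype.card V + 1 : ℝ)⁻¹ < 1 := by
    rw [← div_eq_mul_inv, div_lt_one hpos]
    linarith
  linarith

lemma trim_mem_realization {Δ Δ' : SC V} {x : V → ℝ} (hx : x ∈ Δ.realization) {r : ℝ}
    (hr : r ≤ (Fintype.card V + 1 : ℝ)⁻¹) (h : ∃ s ∈ Δ'.faces, ∀ v, r < x v → v ∈ s) :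
    trim r x ∈ Δ'.realization := by
  have hpos := trim_sum_pos hx hr
  obtain ⟨s, hs, hxs⟩ := h
  refine ⟨fun v => div_nonneg (le_max_right _ _) hpos.le, ?_, s, hs, fun v hv => hxs v ?_⟩
  · simp only [trim, ← Finset.sum_div]
    exact div_self hpos.ne'
  · by_contra! hle
    exact hv (by simp [trim, max_eq_right (sub_nonpos.2 hle)])

lemma isOpen_setOf_exists_face (Δ : SC V) (r : ℝ) :
    IsOpen {x : V → ℝ | ∃ s ∈ Δ.faces, ∀ v, r ≤ x v → v ∈ s} := by
  have h : {x : V → ℝ | ∃ s ∈ Δ.faces, ∀ v, r ≤ x v → v ∈ s} =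
      ⋃ s ∈ Δ.faces, ⋂ v : V, ⋂ _ : v ∉ s, {x : V → ℝ | x v < r} := by
    ext x
    simp only [mem_ofPred_eq, mem_iUnion, mem_iInter, exists_prop, ← not_le, not_imp_not]
  rw [h]
  exact isOpen_biUnion fun s _ => isOpen_iInter_of_finite fun v => isOpen_iInter_of_finite fun _ =>
    isOpen_lt (continuous_apply v) continuous_const

lemma cubeExtends_realization_union {Δ₁ Δ₂ : SC V} {n : ℕ}
    (h₁ : ∀ m ≤ n, CubeExtends m Δ₁.realization) (h₂ : ∀ m ≤ n, CubeExtends m Δ₂.realization)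
    (h : ∀ m < n, CubeExtends m (SC.inter Δ₁ Δ₂).realization) :
    CubeExtends n (SC.union Δ₁ Δ₂).realization := by
  set ε : ℝ := (Fintype.card V + 1 : ℝ)⁻¹ with hε
  have hεpos : 0 < ε := by positivity
  have hstep : ∀ t ∈ Icc (0 : ℝ) 1, 0 ≤ t * ε ∧ t * ε ≤ ε := fun t ht =>
    ⟨mul_nonneg ht.1 hεpos.le, mul_le_of_le_one_left hεpos.le ht.2⟩
  have hnear : ∀ Δ : SC V, Δ.realization ⊆ {x | ∃ s ∈ Δ.faces, ∀ v, ε ≤ x v → v ∈ s} := by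
    rintro Δ x ⟨-, -, s, hs, hx⟩
    exact ⟨s, hs, fun v hv => hx v (hεpos.trans_le hv).ne'⟩
  have hpush : ∀ Δ : SC V, ∀ x ∈ (SC.union Δ₁ Δ₂).realization,
      x ∈ {x : V → ℝ | ∃ s ∈ Δ.faces, ∀ v, ε ≤ x v → v ∈ s} →
      trim (1 * ε) x ∈ Δ.realization := by
    rintro Δ x hx ⟨s, hs, hxs⟩
    rw [one_mul]
    exact trim_mem_realization hx le_rfl ⟨s, hs, fun v hv => hxs v hv.le⟩
  have hcont : ContinuousOn (fun p : ℝ × (V → ℝ) => trim (p.1 * ε) p.2)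
      (Icc 0 1 ×ˢ (SC.union Δ₁ Δ₂).realization) := by
    refine continuousOn_pi.2 fun v => ContinuousOn.div (by fun_prop) (by fun_prop) fun p hp => ?_
    exact (trim_sum_pos hp.2 (hstep _ hp.1).2).ne'
  have hmaps : ∀ t ∈ Icc (0 : ℝ) 1, MapsTo (trim (t * ε)) (SC.union Δ₁ Δ₂).realization
      (SC.union Δ₁ Δ₂).realization := by
    intro t ht x hx
    refine trim_mem_realization hx (hstep t ht).2 ?_
    obtain ⟨-, -, s, hs, hxs⟩ := hx
    exact ⟨s, hs, fun v hv => hxs v ((hstep t ht).1.trans_lt hv).ne'⟩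
  have hzero : ∀ x ∈ (SC.union Δ₁ Δ₂).realization, trim (0 * ε) x = x := by
    intro x hx
    funext v
    simp [trim, hx.1, hx.2.1]
  rw [realization_inter] at h
  rw [realization_union] at hcont hmaps hzero hpush ⊢
  exact CubeExtends.union (H := fun t => trim (t * ε)) hcont hmaps hzero
    (isOpen_setOf_exists_face Δ₁ ε) (isOpen_setOf_exists_face Δ₂ ε)
    (union_subset_union (hnear Δ₁) (hnear Δ₂)) (hpush Δ₁) (hpush Δ₂) h₁ h₂ h

end SC

lemma Constructible.cubeExtends {V : Type*} [Fintype V] {Δ : SC V} {d : ℤ}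
    (h : Constructible Δ d) : ∀ n : ℕ, (n : ℤ) ≤ d → CubeExtends n Δ.realization := by
  induction h with
  | simplex s =>
    intro n hn
    exact SC.cubeExtends_realization_simplex (Finset.card_pos.1 (by omega)) n
  | union _ _ he _ ih₁ ih₂ ih =>
    intro n hn
    exact SC.cubeExtends_realization_union (fun m hm => ih₁ m (by omega))
      (fun m hm => ih₂ m (by omega)) fun m hm => ih m (by omega)

/-- Every constructible simplicial complex of dimension `d` is
`(d-1)`-connected. -/
theorem constructible_connected {V : Type*} [Fintype V] (Δ : SC V) (d : ℤ)
    (h : Constructible Δ d) : KConnected (d - 1) (SC.realization Δ) :=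
  ⟨fun hd => (h.cubeExtends 0 (by push_cast; omega)).nonempty.to_subtype,
    fun x i hi => (h.cubeExtends (i + 1) (by push_cast; omega)).subsingleton_homotopyGroup x⟩
end

section
/- Every constructible simplicial complex is homotopy Cohen-Macaulay. -/
open scoped BigOperators

/-- A simplicial complex is homotopy Cohen-Macaulay if for every face `F`
(including the empty face), the link of `F` is
`(dim link_Δ(F) - 1)`-connected. -/
def HomotopyCM {V : Type*} [Fintype V] [DecidableEq V] (Δ : SC V) : Prop :=
  ∀ F ∈ Δ.faces,
    KConnected (SC.dim (SC.link Δ F) - 1) (SC.realization (SC.link Δ F))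

open Metric Set

/-- Every map from the boundary of the `n`-cube `[-1,1]ⁿ` into `Y` extends to the whole cube. -/
def SphereExtends {Z : Type*} [TopologicalSpace Z] (n : ℕ) (Y : Set Z) : Prop :=
  ∀ f : (Fin n → ℝ) → Z, ContinuousOn f (sphere 0 1) → MapsTo f (sphere 0 1) Y →
    ∃ g : (Fin n → ℝ) → Z, ContinuousOn g (closedBall 0 1) ∧
      MapsTo g (closedBall 0 1) Y ∧ EqOn g f (sphere 0 1)

theorem exists_glue {X Z : Type*} [TopologicalSpace X] [TopologicalSpace Z] {S T : Set X}
    (hS : IsClosed S) (hT : IsClosed T) {f g : X → Z} (hf : ContinuousOn f S)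
    (hg : ContinuousOn g T) (h : EqOn f g (S ∩ T)) :
    ∃ k : X → Z, ContinuousOn k (S ∪ T) ∧ EqOn k f S ∧ EqOn k g T := by
  classical
  have h1 : EqOn (S.piecewise f g) f S := fun x hx => by simp [hx]
  have h2 : EqOn (S.piecewise f g) g T := fun x hx => by
    by_cases hxS : x ∈ S
    · simpa [hxS] using h ⟨hxS, hx⟩
    · simp [hxS]
  exact ⟨S.piecewise f g, (hf.congr h1).union_of_isClosed (hg.congr h2) hS hT, h1, h2⟩

namespace Grid

/-- The cell of the integer cubical subdivision of the line containing `x` in its relative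
interior: `2k` stands for the vertex `k` and `2k + 1` for the edge `[k, k + 1]`. -/
noncomputable def code₁ (x : ℝ) : ℤ := ⌊x⌋ + ⌈x⌉

theorem code₁_cases (x : ℝ) :
    (Even (code₁ x) ∧ 2 * x = code₁ x) ∨ (Odd (code₁ x) ∧ |2 * x - code₁ x| < 1) := by
  have h1 := Int.floor_le x
  have h2 := Int.lt_floor_add_one x
  have h3 := Int.le_ceil x
  have h4 := Int.ceil_lt_add_one x
  rcases eq_or_lt_of_le (Int.floor_le_ceil x) with h | h
  · left
    rw [code₁, ← h]
    rw [← h] at h3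
    refine ⟨⟨_, rfl⟩, ?_⟩
    push_cast
    linarith
  · right
    have h5 : ⌈x⌉ = ⌊x⌋ + 1 := le_antisymm (Int.ceil_le_floor_add_one x) h
    have h6 : (⌊x⌋ : ℝ) < x := lt_of_le_of_ne h1 fun h' => by
      rw [← h'] at h
      simp at h
    have h7 : x < ⌈x⌉ := lt_of_le_of_ne h3 fun h' => by
      rw [h'] at h
      simp at h
    rw [code₁, h5]
    rw [h5] at h7
    push_cast at h7 ⊢
    refine ⟨⟨⌊x⌋, by ring⟩, ?_⟩
    rw [abs_lt]
    constructor <;> linarith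

theorem face₁_iff (x : ℝ) (z : ℤ) :
    (code₁ x = z ∨ (Odd z ∧ (code₁ x = z - 1 ∨ code₁ x = z + 1))) ↔
      |2 * x - z| ≤ 1 ∧ (Even z → 2 * x = z) := by
  generalize hc : code₁ x = c
  have h := code₁_cases x
  rw [hc] at h
  constructor
  · rintro (rfl | ⟨ho, rfl | rfl⟩)
    · rcases h with ⟨h, h'⟩ | ⟨h, h'⟩
      · simp [h']
      · exact ⟨h'.le, fun he => absurd h (Int.not_odd_iff_even.2 he)⟩
    · rcases h with ⟨h, h'⟩ | ⟨h, h'⟩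
      · refine ⟨by rw [h']; push_cast; rw [abs_le]; constructor <;> linarith,
          fun he => absurd ho (Int.not_odd_iff_even.2 he)⟩
      · exact absurd h (by grind)
    · rcases h with ⟨h, h'⟩ | ⟨h, h'⟩
      · refine ⟨by rw [h']; push_cast; rw [abs_le]; constructor <;> linarith,
          fun he => absurd ho (Int.not_odd_iff_even.2 he)⟩
      · exact absurd h (by grind)
  · rintro ⟨h1, h2⟩
    rw [abs_le] at h1
    rcases h with ⟨h, h'⟩ | ⟨h, h'⟩
    · rw [h'] at h1 h2
      have h3 : -1 ≤ c - z := by exact_mod_cast h1.1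
      have h4 : c - z ≤ 1 := by exact_mod_cast h1.2
      rcases Int.even_or_odd z with hz | hz
      · left
        exact_mod_cast h2 hz
      · right
        refine ⟨hz, ?_⟩
        grind
    · rw [abs_lt] at h'
      have h3 : -2 < c - z := by
        have : (-2 : ℝ) < c - z := by linarith
        exact_mod_cast this
      have h4 : c - z < 2 := by
        have : (c - z : ℝ) < 2 := by linarith
        exact_mod_cast this
      rcases Int.even_or_odd z with hz | hz
      · rw [h2 hz] at h'
        have h5 : -1 < z - c := by exact_mod_cast h'.1
        have h6 : z - c < 1 := by exact_mod_cast h'.2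
        left
        omega
      · left
        grind

theorem code₁_eq_iff {x : ℝ} {z : ℤ} (hz : Odd z) : code₁ x = z ↔ |2 * x - z| < 1 := by
  constructor
  · rintro rfl
    rcases code₁_cases x with ⟨h, -⟩ | ⟨-, h⟩
    · exact absurd hz (Int.not_odd_iff_even.2 h)
    · exact h
  · intro h
    rcases (face₁_iff x z).2 ⟨h.le, fun he => absurd hz (Int.not_odd_iff_even.2 he)⟩ with
      h' | ⟨-, h'⟩
    · exact h'
    · rcases code₁_cases x with ⟨-, h1⟩ | ⟨h1, -⟩
      · rw [h1] at h
        exfalso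
        rcases h' with h' | h' <;> · rw [h'] at h; push_cast at h; norm_num at h
      · exfalso
        grind

theorem abs_lt_iff_code₁ (x : ℝ) (N : ℕ) : |x| < N ↔ |code₁ x| < 2 * N := by
  have h := code₁_cases x
  generalize code₁ x = c at *
  have e : |c| < 2 * (N : ℤ) ↔ -(2 * (N : ℝ)) < c ∧ (c : ℝ) < 2 * N := by
    rw [abs_lt]
    exact_mod_cast Iff.rfl
  rcases h with ⟨-, h⟩ | ⟨ho, h⟩
  · rw [e, abs_lt, ← h]
    constructor <;> rintro ⟨h1, h2⟩ <;> constructor <;> linarith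
  · rw [abs_lt] at h ⊢
    rw [abs_lt]
    constructor
    · rintro ⟨h1, h2⟩
      have h3 : (-(2 * N) - 1 : ℤ) < c := by
        have : (-(2 * N) - 1 : ℝ) < c := by linarith
        exact_mod_cast this
      have h4 : c < (2 * N + 1 : ℤ) := by
        have : c < (2 * N + 1 : ℝ) := by linarith
        exact_mod_cast this
      grind
    · rintro ⟨h1, h2⟩
      have h3 : (-(2 * N) + 1 : ℝ) ≤ c := by exact_mod_cast h1
      have h4 : (c + 1 : ℝ) ≤ 2 * N := by exact_mod_cast h2
      constructor <;> linarith

theorem abs_le_iff_code₁ (x : ℝ) (N : ℕ) : |x| ≤ N ↔ |code₁ x| ≤ 2 * N := by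
  have h := code₁_cases x
  generalize code₁ x = c at *
  have e : |c| ≤ 2 * (N : ℤ) ↔ -(2 * (N : ℝ)) ≤ c ∧ (c : ℝ) ≤ 2 * N := by
    rw [abs_le]
    exact_mod_cast Iff.rfl
  rcases h with ⟨-, h⟩ | ⟨ho, h⟩
  · rw [e, abs_le, ← h]
    constructor <;> rintro ⟨h1, h2⟩ <;> constructor <;> linarith
  · rw [abs_lt] at h
    rw [abs_le, abs_le]
    constructor
    · rintro ⟨h1, h2⟩
      have h3 : (-(2 * N) - 1 : ℤ) < c := by
        have : (-(2 * N) - 1 : ℝ) < c := by linarith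
        exact_mod_cast this
      have h4 : c < (2 * N + 1 : ℤ) := by
        have : c < (2 * N + 1 : ℝ) := by linarith
        exact_mod_cast this
      grind
    · rintro ⟨h1, h2⟩
      have h3 : (-(2 * N) + 1 : ℤ) ≤ c := by grind
      have h4 : c + 1 ≤ (2 * N : ℤ) := by grind
      have h3 : (-(2 * N) + 1 : ℝ) ≤ c := by exact_mod_cast h3
      have h4 : (c + 1 : ℝ) ≤ 2 * N := by exact_mod_cast h4
      constructor <;> linarith

variable {ι : Type*}

/-- The cell of the integer cubical subdivision of `ι → ℝ` containing `x` in its relative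
interior. -/
noncomputable def code (x : ι → ℝ) : ι → ℤ := fun j => code₁ (x j)

/-- `w` is a (not necessarily proper) face of `z`. -/
def Face (w z : ι → ℤ) : Prop :=
  ∀ j, w j = z j ∨ (Odd (z j) ∧ (w j = z j - 1 ∨ w j = z j + 1))

/-- The closed cell coded by `z`. -/
def cell (z : ι → ℤ) : Set (ι → ℝ) :=
  {x | ∀ j, |2 * x j - z j| ≤ 1 ∧ (Even (z j) → 2 * x j = z j)}

/-- The union of the relatively open cells with code in `C`. -/
def carrier (C : Finset (ι → ℤ)) : Set (ι → ℝ) := {x | code x ∈ C}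

/-- A set of cells closed under taking faces. -/
def IsComplex (C : Finset (ι → ℤ)) : Prop := ∀ z ∈ C, ∀ w, Face w z → w ∈ C

theorem mem_cell {x : ι → ℝ} {z : ι → ℤ} : x ∈ cell z ↔ Face (code x) z :=
  forall_congr' fun j => (face₁_iff (x j) (z j)).symm

theorem Face.refl (z : ι → ℤ) : Face z z := fun _ => Or.inl rfl

theorem Face.trans {u w z : ι → ℤ} (h : Face u w) (h' : Face w z) : Face u z := by
  intro j
  have := h j
  have := h' j
  grind

theorem isClosed_cell (z : ι → ℤ) : IsClosed (cell z) := by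
  simp only [cell, ofPred_forall, ofPred_and]
  refine isClosed_iInter fun j => IsClosed.inter ?_ (isClosed_iInter fun _ => ?_)
  · exact isClosed_le (by fun_prop) continuous_const
  · exact isClosed_eq (by fun_prop) continuous_const

theorem IsComplex.isClosed_carrier {C : Finset (ι → ℤ)} (hC : IsComplex C) :
    IsClosed (carrier C) := by
  have : carrier C = ⋃ z ∈ C, cell z := by
    ext x
    simp only [mem_iUnion, mem_cell, exists_prop]
    exact ⟨fun h => ⟨_, h, Face.refl _⟩, fun ⟨z, hz, h⟩ => hC z hz _ h⟩
  rw [this]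
  exact C.finite_toSet.isClosed_biUnion fun z _ => isClosed_cell z

section

variable [Fintype ι]

/-- The dimension of a cell. -/
def dim (z : ι → ℤ) : ℕ := Fintype.card {j // Odd (z j)}

theorem Face.dim_lt {w z : ι → ℤ} (h : Face w z) (hne : w ≠ z) : dim w < dim z := by
  classical
  obtain ⟨j, hj⟩ := Function.ne_iff.1 hne
  rw [dim, dim, Fintype.card_subtype, Fintype.card_subtype]
  refine Finset.card_lt_card (Finset.ssubset_iff_of_subset ?_ |>.2 ⟨j, ?_, ?_⟩)
  · intro k
    have := h k
    simp only [Finset.mem_filter_univ]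
    grind
  · have := h j
    simp only [Finset.mem_filter_univ]
    grind
  · have := h j
    simp only [Finset.mem_filter_univ]
    grind

theorem exists_extend_cell {Z : Type*} [TopologicalSpace Z] {Y : Set Z} (z : ι → ℤ)
    (hY : SphereExtends (dim z) Y) {f : (ι → ℝ) → Z}
    (hf : ContinuousOn f {x ∈ cell z | code x ≠ z})
    (hfY : MapsTo f {x ∈ cell z | code x ≠ z} Y) :
    ∃ g : (ι → ℝ) → Z, ContinuousOn g (cell z) ∧ MapsTo g (cell z) Y ∧
      EqOn g f {x ∈ cell z | code x ≠ z} := by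
  classical
  let e : {j // Odd (z j)} ≃ Fin (dim z) := Fintype.equivFin _
  let π : (ι → ℝ) → (Fin (dim z) → ℝ) := fun x k => 2 * x (e.symm k) - z (e.symm k)
  let σ : (Fin (dim z) → ℝ) → (ι → ℝ) := fun y j =>
    if h : Odd (z j) then (z j + y (e ⟨j, h⟩)) / 2 else z j / 2
  have hπ : Continuous π := by fun_prop
  have hσ : Continuous σ := by
    refine continuous_pi fun j => ?_
    by_cases h : Odd (z j)
    · simp only [σ, h, dite_true]
      fun_prop
    · simp only [σ, h, dite_false]
      fun_prop
  have hσπ : ∀ x ∈ cell z, σ (π x) = x := by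
    intro x hx
    ext j
    by_cases h : Odd (z j)
    · simp [σ, π, h]
    · have := (hx j).2 (Int.not_odd_iff_even.1 h)
      simp only [σ, h, dite_false]
      linarith
  have hπball : MapsTo π (cell z) (closedBall 0 1) := by
    intro x hx
    rw [mem_closedBall_zero_iff, pi_norm_le_iff_of_nonneg zero_le_one]
    exact fun k => (hx _).1
  have hσcell : MapsTo σ (closedBall 0 1) (cell z) := by
    intro y hy j
    rw [mem_closedBall_zero_iff, pi_norm_le_iff_of_nonneg zero_le_one] at hy
    by_cases h : Odd (z j)
    · refine ⟨?_, fun he => absurd h (Int.not_odd_iff_even.2 he)⟩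
      simp only [σ, h, dite_true]
      convert hy (e ⟨j, h⟩) using 1
      rw [Real.norm_eq_abs]
      congr 1
      ring
    · simp only [σ, h, dite_false]
      constructor
      · rw [abs_le]
        constructor <;> linarith
      · intro
        ring
  have hσsph : MapsTo σ (sphere 0 1) {x ∈ cell z | code x ≠ z} := by
    intro y hy
    refine ⟨hσcell (sphere_subset_closedBall hy), fun hc => ?_⟩
    have : ‖y‖ < 1 := by
      rw [pi_norm_lt_iff zero_lt_one]
      intro k
      obtain ⟨⟨j, hj⟩, rfl⟩ := e.surjective k
      have := (code₁_eq_iff hj).1 (congr_fun hc j)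
      simp only [σ, hj, dite_true] at this
      convert this using 1
      rw [Real.norm_eq_abs]
      congr 1
      ring
    rw [mem_sphere_zero_iff_norm] at hy
    linarith
  have hπsph : MapsTo π {x ∈ cell z | code x ≠ z} (sphere 0 1) := by
    rintro x ⟨hx, hne⟩
    rw [mem_sphere_zero_iff_norm]
    refine le_antisymm (mem_closedBall_zero_iff.1 (hπball hx)) (not_lt.1 fun hlt => hne ?_)
    rw [pi_norm_lt_iff zero_lt_one] at hlt
    ext j
    by_cases h : Odd (z j)
    · refine (code₁_eq_iff h).2 ?_
      simpa [π] using hlt (e ⟨j, h⟩)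
    · exact (mem_cell.1 hx j).resolve_right fun h' => h h'.1
  obtain ⟨g, hg, hgY, hgf⟩ := hY (f ∘ σ) (hf.comp hσ.continuousOn hσsph) (hfY.comp hσsph)
  refine ⟨g ∘ π, hg.comp hπ.continuousOn hπball, hgY.comp hπball, fun x hx => ?_⟩
  rw [Function.comp_apply, hgf (hπsph hx), Function.comp_apply, hσπ x hx.1]

theorem exists_extend_carrier {Z : Type*} [TopologicalSpace Z] {Y : Set Z}
    (C : Finset (ι → ℤ)) (hC : IsComplex C) (D : Finset (ι → ℤ)) (hD : IsComplex D)
    (hDC : D ⊆ C) (hY : ∀ z ∈ C, z ∉ D → SphereExtends (dim z) Y) {f : (ι → ℝ) → Z}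
    (hf : ContinuousOn f (carrier D)) (hfY : MapsTo f (carrier D) Y) :
    ∃ g : (ι → ℝ) → Z, ContinuousOn g (carrier C) ∧ MapsTo g (carrier C) Y ∧
      EqOn g f (carrier D) := by
  classical
  induction hn : (C \ D).card generalizing D f with
  | zero =>
    rw [Finset.card_eq_zero, Finset.sdiff_eq_empty_iff_subset] at hn
    obtain rfl := Finset.Subset.antisymm hn hDC
    exact ⟨f, hf, hfY, fun _ _ => rfl⟩
  | succ n ih =>
    obtain ⟨z, hz, hmin⟩ := (C \ D).exists_min_image dim (Finset.card_pos.1 (by omega))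
    rw [Finset.mem_sdiff] at hz
    have hface : ∀ w, Face w z → w ≠ z → w ∈ D := by
      intro w hw hne
      by_contra hwD
      exact (hw.dim_lt hne).not_ge (hmin w (Finset.mem_sdiff.2 ⟨hC z hz.1 w hw, hwD⟩))
    have hbd : {x ∈ cell z | code x ≠ z} ⊆ carrier D := fun x hx =>
      hface _ (mem_cell.1 hx.1) hx.2
    obtain ⟨g, hg, hgY, hgf⟩ :=
      exists_extend_cell z (hY z hz.1 hz.2) (hf.mono hbd) (hfY.mono_left hbd)
    obtain ⟨k, hk, hkf, hkg⟩ := exists_glue hD.isClosed_carrier (isClosed_cell z) hf hg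
      fun x hx => (hgf ⟨hx.2, fun h => hz.2 (h ▸ hx.1)⟩).symm
    have hsub : carrier (insert z D) ⊆ carrier D ∪ cell z := by
      intro x hx
      rcases Finset.mem_insert.1 hx with h | h
      · exact Or.inr (mem_cell.2 (h ▸ Face.refl _))
      · exact Or.inl h
    have hD' : IsComplex (insert z D) := by
      intro w hw v hv
      rcases Finset.mem_insert.1 hw with rfl | h
      · by_cases hvw : v = w
        · simp [hvw]
        · exact Finset.mem_insert_of_mem (hface v hv hvw)
      · exact Finset.mem_insert_of_mem (hD w h v hv)
    have hkY : MapsTo k (carrier (insert z D)) Y := by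
      intro x hx
      rcases hsub hx with h | h
      · rw [hkf h]
        exact hfY h
      · rw [hkg h]
        exact hgY h
    have hcard : (C \ insert z D).card = n := by
      have : C \ insert z D = (C \ D).erase z := by grind
      rw [this, Finset.card_erase_of_mem (Finset.mem_sdiff.2 hz), hn, Nat.add_sub_cancel]
    obtain ⟨l, hl, hlY, hlk⟩ := ih (insert z D) hD' (Finset.insert_subset hz.1 hDC)
      (fun w hw hwD => hY w hw fun h => hwD (Finset.mem_insert_of_mem h)) (hk.mono hsub) hkY hcard
    exact ⟨l, hl, hlY, fun x hx => (hlk (Finset.mem_insert_of_mem hx)).trans (hkf hx)⟩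

theorem exists_odd_face₁ {N : ℕ} (hN : 0 < N) {w : ℤ} (hw : |w| ≤ 2 * N) :
    ∃ z : ℤ, Odd z ∧ |z| ≤ 2 * N ∧ (w = z ∨ (Odd z ∧ (w = z - 1 ∨ w = z + 1))) := by
  rcases Int.even_or_odd w with h | h
  · rcases lt_or_ge w (2 * N) with h' | h'
    · exact ⟨w + 1, by grind⟩
    · exact ⟨w - 1, by grind⟩
  · exact ⟨w, by grind⟩

theorem exists_extend_closedBall {n N : ℕ} (hN : 0 < N) {Z : Type*} [TopologicalSpace Z]
    {A B : Set Z} (hA : ∀ m ≤ n, SphereExtends m A) (hB : ∀ m ≤ n, SphereExtends m B)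
    (hAB : ∀ m < n, SphereExtends m (A ∩ B)) {f : (Fin n → ℝ) → Z}
    (hf : ContinuousOn f (sphere 0 N))
    (hsmall : ∀ z, MapsTo f (cell z ∩ sphere 0 N) A ∨ MapsTo f (cell z ∩ sphere 0 N) B) :
    ∃ g : (Fin n → ℝ) → Z, ContinuousOn g (closedBall 0 N) ∧
      MapsTo g (closedBall 0 N) (A ∪ B) ∧ EqOn g f (sphere 0 N) := by
  classical
  have hN' : (0 : ℝ) < N := by exact_mod_cast hN
  let P : Finset (Fin n → ℤ) := Finset.Icc (fun _ => -(2 * N)) (fun _ => 2 * N)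
  have memP : ∀ z, z ∈ P ↔ ∀ j, |z j| ≤ 2 * N := by
    intro z
    simp only [P, Finset.mem_Icc, Pi.le_def, abs_le, forall_and]
  let Q : Finset (Fin n → ℤ) := P.filter fun z => ∃ j, |z j| = 2 * N
  let α : (Fin n → ℤ) → Prop := fun z => MapsTo f (cell z ∩ sphere 0 N) A
  let T : Finset (Fin n → ℤ) := P.filter fun z => ∀ j, Odd (z j)
  let CA : Finset (Fin n → ℤ) := P.filter fun w => ∃ z ∈ T, α z ∧ Face w z
  let CB : Finset (Fin n → ℤ) := P.filter fun w => ∃ z ∈ T, ¬ α z ∧ Face w z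
  have hP : IsComplex P := by
    intro z hz w hw
    rw [memP] at hz ⊢
    intro j
    have := hz j
    have := hw j
    grind
  have hQ : IsComplex Q := by
    intro z hz w hw
    obtain ⟨hzP, j, hj⟩ := Finset.mem_filter.1 hz
    refine Finset.mem_filter.2 ⟨hP z hzP w hw, j, ?_⟩
    have := hw j
    grind
  have hCA : IsComplex CA := by
    intro z hz w hw
    obtain ⟨hzP, u, hu, hα, hzu⟩ := Finset.mem_filter.1 hz
    exact Finset.mem_filter.2 ⟨hP z hzP w hw, u, hu, hα, hw.trans hzu⟩
  have hCB : IsComplex CB := by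
    intro z hz w hw
    obtain ⟨hzP, u, hu, hα, hzu⟩ := Finset.mem_filter.1 hz
    exact Finset.mem_filter.2 ⟨hP z hzP w hw, u, hu, hα, hw.trans hzu⟩
  have inter_complex : ∀ {C D : Finset (Fin n → ℤ)}, IsComplex C → IsComplex D →
      IsComplex (C ∩ D) := by
    intro C D hC hD z hz w hw
    rw [Finset.mem_inter] at hz ⊢
    exact ⟨hC z hz.1 w hw, hD z hz.2 w hw⟩
  have union_complex : ∀ {C D : Finset (Fin n → ℤ)}, IsComplex C → IsComplex D →
      IsComplex (C ∪ D) := by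
    intro C D hC hD z hz w hw
    rw [Finset.mem_union] at hz ⊢
    exact hz.imp (fun h => hC z h w hw) (fun h => hD z h w hw)
  have hcover : ∀ w ∈ P, w ∈ CA ∨ w ∈ CB := by
    intro w hw
    choose z hzodd hzN hwz using fun j => exists_odd_face₁ hN ((memP w).1 hw j)
    have hzT : z ∈ T := Finset.mem_filter.2 ⟨(memP z).2 hzN, hzodd⟩
    by_cases h : α z
    · exact Or.inl (Finset.mem_filter.2 ⟨hw, z, hzT, h, hwz⟩)
    · exact Or.inr (Finset.mem_filter.2 ⟨hw, z, hzT, h, hwz⟩)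
  have ball_eq : closedBall 0 N = carrier P := by
    ext x
    rw [mem_closedBall_zero_iff, pi_norm_le_iff_of_nonneg hN'.le, carrier, mem_ofPred_eq, memP]
    exact forall_congr' fun j => abs_le_iff_code₁ (x j) N
  have sphere_eq : sphere 0 N = carrier Q := by
    ext x
    have h1 : ‖x‖ ≤ N ↔ code x ∈ P := by
      rw [← mem_closedBall_zero_iff, ball_eq]
      rfl
    have h2 : ‖x‖ < N ↔ ∀ j, |code x j| < 2 * N := by
      rw [pi_norm_lt_iff hN']
      exact forall_congr' fun j => abs_lt_iff_code₁ (x j) N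
    have h3 : x ∈ carrier Q ↔ code x ∈ P ∧ ∃ j, |code x j| = 2 * N := Finset.mem_filter
    rw [mem_sphere_zero_iff_norm, h3, ← h1]
    constructor
    · intro h
      refine ⟨h.le, ?_⟩
      have h4 := mt h2.2 h.not_lt
      push Not at h4
      obtain ⟨j, hj⟩ := h4
      exact ⟨j, le_antisymm ((memP _).1 (h1.1 h.le) j) hj⟩
    · rintro ⟨h, j, hj⟩
      refine le_antisymm h (not_lt.1 fun hlt => ?_)
      exact (h2.1 hlt j).ne hj
  have hfA : MapsTo f (carrier (Q ∩ CA)) A := by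
    intro x hx
    obtain ⟨hxQ, hxA⟩ := Finset.mem_inter.1 hx
    obtain ⟨-, z, -, hα, hz⟩ := Finset.mem_filter.1 hxA
    exact hα ⟨mem_cell.2 hz, sphere_eq ▸ hxQ⟩
  have hfB : MapsTo f (carrier (Q ∩ CB)) B := by
    intro x hx
    obtain ⟨hxQ, hxB⟩ := Finset.mem_inter.1 hx
    obtain ⟨-, z, -, hα, hz⟩ := Finset.mem_filter.1 hxB
    exact (hsmall z).resolve_left hα ⟨mem_cell.2 hz, sphere_eq ▸ hxQ⟩
  rw [sphere_eq] at hf ⊢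
  rw [ball_eq]
  have dim_le : ∀ z : Fin n → ℤ, dim z ≤ n := fun z => by
    simpa [dim] using Fintype.card_subtype_le fun j => Odd (z j)
  have hdim : ∀ w ∈ CA ∩ CB, dim w < n := by
    intro w hw
    obtain ⟨hwA, hwB⟩ := Finset.mem_inter.1 hw
    obtain ⟨-, u, hu, hαu, hwu⟩ := Finset.mem_filter.1 hwA
    obtain ⟨-, v, hv, hαv, hwv⟩ := Finset.mem_filter.1 hwB
    have h : w ≠ u ∨ w ≠ v := by
      by_contra! h
      exact hαv (h.2 ▸ h.1 ▸ hαu)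
    rcases h with h | h
    · exact (hwu.dim_lt h).trans_le (dim_le u)
    · exact (hwv.dim_lt h).trans_le (dim_le v)
  have hR := inter_complex hCA hCB
  obtain ⟨r, hr, hrY, hrf⟩ := exists_extend_carrier (Y := A ∩ B) (CA ∩ CB) hR
    (Q ∩ (CA ∩ CB)) (inter_complex hQ hR) Finset.inter_subset_right
    (fun z hz _ => hAB _ (hdim z hz)) (f := f) (hf.mono fun x hx => (Finset.mem_inter.1 hx).1)
    (fun x hx => by
      obtain ⟨h1, h2⟩ := Finset.mem_inter.1 hx
      obtain ⟨h2, h3⟩ := Finset.mem_inter.1 h2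
      exact ⟨hfA (Finset.mem_inter.2 ⟨h1, h2⟩), hfB (Finset.mem_inter.2 ⟨h1, h3⟩)⟩)
  have key : ∀ (C : Finset (Fin n → ℤ)) (Y : Set Z), IsComplex C → CA ∩ CB ⊆ C →
      (∀ m ≤ n, SphereExtends m Y) → MapsTo f (carrier (Q ∩ C)) Y →
      MapsTo r (carrier (CA ∩ CB)) Y →
      ∃ g : (Fin n → ℝ) → Z, ContinuousOn g (carrier C) ∧ MapsTo g (carrier C) Y ∧
        EqOn g f (carrier (Q ∩ C)) ∧ EqOn g r (carrier (CA ∩ CB)) := by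
    intro C Y hC hRC hY hfY hrY
    obtain ⟨k, hk, hkf, hkr⟩ := exists_glue (inter_complex hQ hC).isClosed_carrier
      hR.isClosed_carrier (hf.mono fun x hx => (Finset.mem_inter.1 hx).1) hr
      fun x hx => (hrf (Finset.mem_inter.2 ⟨(Finset.mem_inter.1 hx.1).1, hx.2⟩)).symm
    have hsub : carrier (Q ∩ C ∪ CA ∩ CB) ⊆ carrier (Q ∩ C) ∪ carrier (CA ∩ CB) :=
      fun x hx => Finset.mem_union.1 hx
    obtain ⟨g, hg, hgY, hgk⟩ := exists_extend_carrier (Y := Y) C hC (Q ∩ C ∪ CA ∩ CB)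
      (union_complex (inter_complex hQ hC) hR)
      (Finset.union_subset Finset.inter_subset_right hRC) (fun z _ _ => hY _ (dim_le z))
      (hk.mono hsub) (fun x hx => by
        rcases hsub hx with h | h
        · rw [hkf h]
          exact hfY h
        · rw [hkr h]
          exact hrY h)
    exact ⟨g, hg, hgY, fun x hx => (hgk (Finset.mem_union_left _ hx)).trans (hkf hx),
      fun x hx => (hgk (Finset.mem_union_right _ hx)).trans (hkr hx)⟩
  obtain ⟨a, ha, haY, haf, har⟩ := key CA A hCA Finset.inter_subset_left hA hfA
    (hrY.mono_right inter_subset_left)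
  obtain ⟨b, hb, hbY, hbf, hbr⟩ := key CB B hCB Finset.inter_subset_right hB hfB
    (hrY.mono_right inter_subset_right)
  obtain ⟨g, hg, hga, hgb⟩ := exists_glue hCA.isClosed_carrier hCB.isClosed_carrier ha hb
    fun x hx => (har (Finset.mem_inter.2 hx)).trans (hbr (Finset.mem_inter.2 hx)).symm
  refine ⟨g, hg.mono fun x hx => hcover _ hx, fun x hx => ?_, fun x hx => ?_⟩
  · rcases hcover _ hx with h | h
    · rw [hga h]
      exact Or.inl (haY h)
    · rw [hgb h]
      exact Or.inr (hbY h)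
  · rcases hcover _ (Finset.mem_filter.1 hx).1 with h | h
    · rw [hga h]
      exact haf (Finset.mem_inter.2 ⟨hx, h⟩)
    · rw [hgb h]
      exact hbf (Finset.mem_inter.2 ⟨hx, h⟩)

end

end Grid

theorem exists_extend_of_homotopy {n : ℕ} {Z : Type*} [TopologicalSpace Z] {Y : Set Z}
    {H : ℝ × (Fin n → ℝ) → Z} (hH : ContinuousOn H (Icc 0 1 ×ˢ sphere 0 1))
    (hHY : MapsTo H (Icc 0 1 ×ˢ sphere 0 1) Y) {g : (Fin n → ℝ) → Z}
    (hg : ContinuousOn g (closedBall 0 1)) (hgY : MapsTo g (closedBall 0 1) Y)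
    (hgH : ∀ x ∈ sphere 0 1, g x = H (1, x)) :
    ∃ k : (Fin n → ℝ) → Z, ContinuousOn k (closedBall 0 1) ∧
      MapsTo k (closedBall 0 1) Y ∧ ∀ x ∈ sphere 0 1, k x = H (0, x) := by
  let S : Set (Fin n → ℝ) := {x | 1 / 2 ≤ ‖x‖ ∧ ‖x‖ ≤ 1}
  let T : Set (Fin n → ℝ) := {x | ‖x‖ ≤ 1 / 2}
  let p : (Fin n → ℝ) → ℝ × (Fin n → ℝ) := fun x => (2 - 2 * ‖x‖, ‖x‖⁻¹ • x)
  have hS : IsClosed S := (isClosed_le continuous_const continuous_norm).inter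
    (isClosed_le continuous_norm continuous_const)
  have hT : IsClosed T := isClosed_le continuous_norm continuous_const
  have hpos : ∀ x ∈ S, ‖x‖ ≠ 0 := fun x hx => by
    have := hx.1
    intro h
    norm_num [h] at this
  have hp : ContinuousOn p S := by
    refine ContinuousOn.prodMk (by fun_prop) ?_
    exact (continuous_norm.continuousOn.inv₀ hpos).smul continuousOn_id
  have hpS : MapsTo p S (Icc 0 1 ×ˢ sphere 0 1) := by
    intro x hx
    refine ⟨⟨?_, ?_⟩, ?_⟩
    · have := hx.2
      simp only [p]
      linarith
    · have := hx.1
      simp only [p]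
      linarith
    · simp [p, norm_smul, hpos x hx]
  have h2 : MapsTo (fun x : Fin n → ℝ => (2 : ℝ) • x) T (closedBall 0 1) := by
    intro x hx
    have : ‖x‖ ≤ 1 / 2 := hx
    rw [mem_closedBall_zero_iff, norm_smul, Real.norm_two]
    linarith
  obtain ⟨k, hk, hkS, hkT⟩ := exists_glue hS hT (hH.comp hp hpS)
    (hg.comp (by fun_prop) h2) (by
      intro x hx
      have hn : ‖x‖ = 1 / 2 := le_antisymm hx.2 hx.1.1
      have hs : (2 : ℝ) • x ∈ sphere (0 : Fin n → ℝ) 1 := by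
        rw [mem_sphere_zero_iff_norm, norm_smul, Real.norm_two, hn]
        norm_num
      have : p x = (1, (2 : ℝ) • x) := by
        simp only [p, hn]
        norm_num
      simp only [Function.comp_apply]
      rw [hgH _ hs, this])
  have hcover : ∀ x ∈ closedBall (0 : Fin n → ℝ) 1, x ∈ S ∪ T := by
    intro x hx
    rw [mem_closedBall_zero_iff] at hx
    rcases le_total (1 / 2) ‖x‖ with h | h
    · exact Or.inl ⟨h, hx⟩
    · exact Or.inr h
  refine ⟨k, hk.mono hcover, fun x hx => ?_, fun x hx => ?_⟩
  · rcases hcover x hx with h | h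
    · rw [hkS h]
      exact hHY (hpS h)
    · rw [hkT h]
      exact hgY (h2 h)
  · rw [mem_sphere_zero_iff_norm] at hx
    have hxS : x ∈ S := ⟨by rw [hx]; norm_num, hx.le⟩
    rw [hkS hxS]
    simp [p, hx]

theorem Convex.sphereExtends {Z : Type*} [AddCommGroup Z] [Module ℝ Z] [TopologicalSpace Z]
    [ContinuousAdd Z] [ContinuousSMul ℝ Z] {Y : Set Z} (hY : Convex ℝ Y) (hne : Y.Nonempty)
    (n : ℕ) : SphereExtends n Y := by
  intro f hf hfY
  obtain ⟨c, hc⟩ := hne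
  obtain ⟨k, hk, hkY, hkf⟩ := exists_extend_of_homotopy (Y := Y)
    (H := fun q => (1 - q.1) • f q.2 + q.1 • c) (g := fun _ => c)
    (by
      have : ContinuousOn (fun q : ℝ × (Fin n → ℝ) => f q.2) (Icc 0 1 ×ˢ sphere 0 1) :=
        hf.comp continuousOn_snd fun q hq => hq.2
      exact ((continuousOn_const.sub continuousOn_fst).smul this).add
        (continuousOn_fst.smul continuousOn_const))
    (fun q hq => hY (hfY hq.2) hc (sub_nonneg.2 hq.1.2) hq.1.1 (by ring))
    continuousOn_const (fun _ _ => hc) (fun x _ => by simp)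
  exact ⟨k, hk, hkY, fun x hx => by simp [hkf x hx]⟩

/-- Subtract `δ` from all coordinates, truncate at `0`, and normalize. -/
noncomputable def push {V : Type*} [Fintype V] (δ : ℝ) (y : V → ℝ) : V → ℝ :=
  fun v => max (y v - δ) 0 / ∑ w, max (y w - δ) 0

section

variable {V : Type*} [Fintype V]

theorem sum_push_pos {δ : ℝ} (hδ : δ * Fintype.card V < 1) {y : V → ℝ} (hy : ∑ v, y v = 1) :
    0 < ∑ v, max (y v - δ) 0 := by
  have h : ∑ v, (y v - δ) ≤ ∑ v, max (y v - δ) 0 :=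
    Finset.sum_le_sum fun v _ => le_max_left _ _
  rw [Finset.sum_sub_distrib, hy, Finset.sum_const, Finset.card_univ, nsmul_eq_mul] at h
  linarith

theorem continuousOn_push {X : Type*} [TopologicalSpace X] {S : Set X} {δ : X → ℝ}
    {f : X → V → ℝ} (hδ : ContinuousOn δ S) (hf : ContinuousOn f S)
    (hlt : ∀ x ∈ S, δ x * Fintype.card V < 1) (hsum : ∀ x ∈ S, ∑ v, f x v = 1) :
    ContinuousOn (fun x => push (δ x) (f x)) S := by
  have hc : ∀ v, ContinuousOn (fun x => max (f x v - δ x) 0) S := fun v =>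
    ContinuousOn.sup (f := fun x => f x v - δ x) ((continuousOn_pi.1 hf v).sub hδ)
      continuousOn_const
  exact continuousOn_pi.2 fun v => (hc v).div (continuousOn_finsetSum _ fun w _ => hc w)
    fun x hx => (sum_push_pos (hlt x hx) (hsum x hx)).ne'

theorem push_mem {δ : ℝ} (hδ : δ * Fintype.card V < 1) {y : V → ℝ} (hy : ∑ v, y v = 1)
    {Δ : SC V} {s : Finset V} (hs : s ∈ Δ.faces) (h : ∀ v, δ < y v → v ∈ s) :
    push δ y ∈ Δ.realization := by
  have hpos := sum_push_pos hδ hy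
  refine ⟨fun v => div_nonneg (le_max_right _ _) hpos.le, ?_, s, hs, fun v hv => h v ?_⟩
  · simp only [push]
    rw [← Finset.sum_div, div_self hpos.ne']
  · by_contra! hle
    exact hv (by simp [push, hle])

theorem push_zero {y : V → ℝ} (h0 : ∀ v, 0 ≤ y v) (hy : ∑ v, y v = 1) : push 0 y = y := by
  ext v
  simp [push, h0, hy]

theorem realization_union (A B : SC V) :
    (A.union B).realization = A.realization ∪ B.realization := by
  ext f
  constructor
  · rintro ⟨h0, h1, s, hs | hs, h⟩
    · exact Or.inl ⟨h0, h1, s, hs, h⟩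
    · exact Or.inr ⟨h0, h1, s, hs, h⟩
  · rintro (⟨h0, h1, s, hs, h⟩ | ⟨h0, h1, s, hs, h⟩)
    · exact ⟨h0, h1, s, Or.inl hs, h⟩
    · exact ⟨h0, h1, s, Or.inr hs, h⟩

theorem realization_inter (A B : SC V) :
    (A.inter B).realization = A.realization ∩ B.realization := by
  classical
  ext f
  constructor
  · rintro ⟨h0, h1, s, hs, h⟩
    exact ⟨⟨h0, h1, s, hs.1, h⟩, ⟨h0, h1, s, hs.2, h⟩⟩
  · rintro ⟨⟨h0, h1, s, hs, h⟩, ⟨-, -, t, ht, h'⟩⟩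
    exact ⟨h0, h1, s ∩ t, ⟨A.down hs Finset.inter_subset_left, B.down ht Finset.inter_subset_right⟩,
      fun v hv => Finset.mem_inter.2 ⟨h v hv, h' v hv⟩⟩

theorem convex_realization_simplex (s : Finset V) : Convex ℝ (SC.simplex s).realization := by
  rintro f ⟨hf0, hf1, t, ht, hf⟩ g ⟨hg0, hg1, u, hu, hg⟩ a b ha hb hab
  refine ⟨fun v => ?_, ?_, s, Finset.Subset.refl s, fun v hv => ?_⟩
  · exact add_nonneg (mul_nonneg ha (hf0 v)) (mul_nonneg hb (hg0 v))
  · simp [Finset.sum_add_distrib, ← Finset.mul_sum, hf1, hg1, hab]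
  · by_contra hvs
    have h1 : f v = 0 := by
      by_contra h
      exact hvs (ht (hf v h))
    have h2 : g v = 0 := by
      by_contra h
      exact hvs (hu (hg v h))
    simp [h1, h2] at hv

theorem realization_simplex_nonempty {s : Finset V} (hs : s.Nonempty) :
    (SC.simplex s).realization.Nonempty := by
  classical
  obtain ⟨v, hv⟩ := hs
  refine ⟨Pi.single v 1, fun w => ?_, by simp, s, Finset.Subset.refl s, fun w hw => ?_⟩
  · by_cases h : w = v
    · subst h
      simp
    · simp [h]
  · by_cases h : w = v
    · exact h ▸ hv
    · simp [h] at hw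

theorem SphereExtends.union {A B : SC V} {n : ℕ}
    (hA : ∀ m ≤ n, SphereExtends m A.realization) (hB : ∀ m ≤ n, SphereExtends m B.realization)
    (hAB : ∀ m < n, SphereExtends m (A.inter B).realization) :
    SphereExtends n (A.union B).realization := by
  intro f hf hfY
  let ε : ℝ := 1 / (Fintype.card V + 1)
  have hε : 0 < ε := by positivity
  have hεV : ε * Fintype.card V < 1 := by
    rw [div_mul_eq_mul_div, div_lt_one (by positivity)]
    linarith
  obtain ⟨δ, hδ, hfδ⟩ := Metric.uniformContinuousOn_iff.1
    ((isCompact_sphere 0 1).uniformContinuousOn_of_continuous hf) ε hε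
  obtain ⟨M, hM⟩ := exists_nat_one_div_lt hδ
  let N : ℕ := M + 1
  have hN : (0 : ℝ) < N := by positivity
  have hNδ : (N : ℝ)⁻¹ < δ := by simpa [N] using hM
  let H : ℝ × (Fin n → ℝ) → (V → ℝ) := fun q => push (q.1 * ε) (f q.2)
  have htε : ∀ t ∈ Icc (0 : ℝ) 1, t * ε * Fintype.card V < 1 := by
    intro t ht
    refine lt_of_le_of_lt ?_ hεV
    exact mul_le_mul_of_nonneg_right (mul_le_of_le_one_left hε.le ht.2) (Nat.cast_nonneg _)
  have hH : ContinuousOn H (Icc 0 1 ×ˢ sphere 0 1) := by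
    exact continuousOn_push (continuous_fst.mul continuous_const).continuousOn
      (hf.comp continuousOn_snd fun q hq => hq.2) (fun q hq => htε _ hq.1)
      fun q hq => (hfY hq.2).2.1
  have hHY : MapsTo H (Icc 0 1 ×ˢ sphere 0 1) (A.union B).realization := by
    intro q hq
    obtain ⟨h0, h1, s, hs, h⟩ := hfY hq.2
    refine push_mem (htε _ hq.1) h1 hs fun v hv => h v ?_
    exact ((mul_nonneg hq.1.1 hε.le).trans_lt hv).ne'
  have hscale : MapsTo (fun x : Fin n → ℝ => (N : ℝ)⁻¹ • x) (sphere 0 N) (sphere 0 1) := by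
    intro x hx
    rw [mem_sphere_zero_iff_norm] at hx ⊢
    rw [norm_smul, hx, norm_inv, Real.norm_of_nonneg hN.le, inv_mul_cancel₀ hN.ne']
  obtain ⟨g, hg, hgY, hgf⟩ := Grid.exists_extend_closedBall (n := n) (N := N) M.succ_pos hA hB
    (by simpa only [realization_inter] using hAB)
    (f := fun x => H (1, (N : ℝ)⁻¹ • x))
    (hH.comp (by fun_prop) fun x hx => ⟨by simp, hscale hx⟩) (by
      intro z
      rcases (Grid.cell z ∩ sphere 0 (N : ℝ)).eq_empty_or_nonempty with he | ⟨x₀, hx₀, hx₀N⟩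
      · left
        rw [he]
        exact mapsTo_empty _ _
      obtain ⟨-, -, s, hs, hsup⟩ := hfY (hscale hx₀N)
      have key : ∀ x ∈ Grid.cell z ∩ sphere 0 (N : ℝ), ∀ v,
          1 * ε < f ((N : ℝ)⁻¹ • x) v → v ∈ s := by
        rintro x ⟨hx, hxN⟩ v hv
        refine hsup v fun h0 => ?_
        have hd : dist x x₀ ≤ 1 := by
          refine (dist_pi_le_iff zero_le_one).2 fun j => ?_
          have h1 := abs_le.1 (hx j).1
          have h2 := abs_le.1 (hx₀ j).1
          rw [Real.dist_eq, abs_le]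
          constructor <;> linarith
        have hd' : dist ((N : ℝ)⁻¹ • x) ((N : ℝ)⁻¹ • x₀) < δ := by
          rw [dist_smul₀, norm_inv, Real.norm_of_nonneg hN.le]
          exact (mul_le_of_le_one_right (inv_nonneg.2 hN.le) hd).trans_lt hNδ
        have h3 := (dist_le_pi_dist _ _ v).trans_lt (hfδ _ (hscale hxN) _ (hscale hx₀N) hd')
        rw [h0, Real.dist_eq, sub_zero] at h3
        linarith [le_abs_self (f ((N : ℝ)⁻¹ • x) v)]
      refine hs.imp (fun h x hx => ?_) (fun h x hx => ?_) <;>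
      exact push_mem (by simpa using hεV) (hfY (hscale hx.2)).2.1 h (key x hx))
  have hscale' : MapsTo (fun x : Fin n → ℝ => (N : ℝ) • x) (closedBall 0 1)
      (closedBall 0 N) := by
    intro x hx
    rw [mem_closedBall_zero_iff] at hx ⊢
    rw [norm_smul, Real.norm_of_nonneg hN.le]
    exact mul_le_of_le_one_right hN.le hx
  rw [← realization_union] at hgY
  obtain ⟨k, hk, hkY, hkf⟩ := exists_extend_of_homotopy hH hHY
    (hg.comp (by fun_prop) hscale') (hgY.comp hscale') (by
      intro x hx
      have hx' : (N : ℝ) • x ∈ sphere (0 : Fin n → ℝ) N := by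
        rw [mem_sphere_zero_iff_norm] at hx ⊢
        rw [norm_smul, hx, Real.norm_of_nonneg hN.le, mul_one]
      refine (hgf hx').trans ?_
      simp only [inv_smul_smul₀ hN.ne'])
  refine ⟨k, hk, hkY, fun x hx => ?_⟩
  rw [hkf x hx]
  simpa [H] using push_zero (hfY hx).1 (hfY hx).2.1

end

open scoped unitInterval Topology in
theorem SphereExtends.subsingleton_homotopyGroup {Z : Type*} [TopologicalSpace Z] {Y : Set Z}
    {i : ℕ} (hY : SphereExtends (i + 1) Y) (x : Y) : Subsingleton (HomotopyGroup (Fin i) Y x) := by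
  refine ⟨fun a b => ?_⟩
  induction a using Quotient.inductionOn with | _ p
  induction b using Quotient.inductionOn with | _ q
  refine Quotient.sound ?_
  let u : (Fin (i + 1) → ℝ) → (I^(Fin i)) := fun y j =>
    projIcc 0 1 zero_le_one ((y j.succ + 1) / 2)
  have hu : Continuous u := continuous_pi fun j => continuous_projIcc.comp (by fun_prop)
  let e : I × (I^(Fin i)) → (Fin (i + 1) → ℝ) := fun s =>
    Fin.cons (2 * (s.1 : ℝ) - 1) fun j => 2 * (s.2 j : ℝ) - 1
  have he : Continuous e := by
    refine continuous_pi fun j => ?_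
    refine Fin.cases ?_ (fun k => ?_) j
    · simp only [e, Fin.cons_zero]
      fun_prop
    · simp only [e, Fin.cons_succ]
      fun_prop
  have hue : ∀ s, u (e s) = s.2 := by
    intro s
    ext j
    simp [u, e]
  have habs : ∀ t : I, |2 * (t : ℝ) - 1| ≤ 1 := fun t => by
    rw [abs_le]
    constructor <;> linarith [t.2.1, t.2.2]
  have heball : ∀ s, e s ∈ closedBall (0 : Fin (i + 1) → ℝ) 1 := by
    intro s
    rw [mem_closedBall_zero_iff, pi_norm_le_iff_of_nonneg zero_le_one]
    intro j
    refine Fin.cases ?_ (fun k => ?_) j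
    · exact habs _
    · exact habs _
  have hesph : ∀ s j, |e s j| = 1 → e s ∈ sphere (0 : Fin (i + 1) → ℝ) 1 := by
    intro s j hj
    rw [mem_sphere_zero_iff_norm]
    refine le_antisymm (mem_closedBall_zero_iff.1 (heball s)) ?_
    rw [← hj]
    exact norm_le_pi_norm (e s) j
  have hbd : ∀ y ∈ sphere (0 : Fin (i + 1) → ℝ) 1, y 0 = 0 → u y ∈ Cube.boundary (Fin i) := by
    intro y hy h0
    rw [mem_sphere_zero_iff_norm] at hy
    by_contra hb
    refine hy.not_lt ((pi_norm_lt_iff zero_lt_one).2 fun j => ?_)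
    refine Fin.cases ?_ (fun k => ?_) j
    · simp [h0]
    · by_contra! hk
      rw [Real.norm_eq_abs, le_abs] at hk
      refine hb ⟨k, ?_⟩
      rcases hk with hk | hk
      · exact Or.inr (projIcc_of_right_le _ (by linarith))
      · exact Or.inl (projIcc_of_le_left _ (by linarith))
  obtain ⟨f, hf, hfp, hfq⟩ := exists_glue
    (S := sphere 0 1 ∩ {y : Fin (i + 1) → ℝ | y 0 ≤ 0})
    (T := sphere 0 1 ∩ {y : Fin (i + 1) → ℝ | 0 ≤ y 0})
    (isClosed_sphere.inter (isClosed_le (by fun_prop) continuous_const))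
    (isClosed_sphere.inter (isClosed_le continuous_const (by fun_prop)))
    (f := fun y => (p (u y) : Z)) (g := fun y => (q (u y) : Z))
    (continuous_subtype_val.comp (p.1.continuous.comp hu)).continuousOn
    (continuous_subtype_val.comp (q.1.continuous.comp hu)).continuousOn (by
      rintro y ⟨⟨hy, h1⟩, -, h2⟩
      have := hbd y hy (le_antisymm h1 h2)
      simp only
      rw [GenLoop.boundary p _ this, GenLoop.boundary q _ this])
  have hcover : ∀ y ∈ sphere (0 : Fin (i + 1) → ℝ) 1,
      y ∈ sphere 0 1 ∩ {y : Fin (i + 1) → ℝ | y 0 ≤ 0} ∪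
        sphere 0 1 ∩ {y : Fin (i + 1) → ℝ | 0 ≤ y 0} := fun y hy =>
    (le_total (y 0) 0).imp (fun h => ⟨hy, h⟩) (fun h => ⟨hy, h⟩)
  obtain ⟨g, hg, hgY, hgf⟩ := hY f (hf.mono hcover) (fun y hy => by
    rcases hcover y hy with h | h
    · rw [hfp h]
      exact (p (u y)).2
    · rw [hfq h]
      exact (q (u y)).2)
  let F : C(I × (I^(Fin i)), Y) := ⟨fun s => ⟨g (e s), hgY (heball s)⟩,
    (hg.comp_continuous he heball).subtype_mk _⟩
  have hFp : ∀ s, e s ∈ sphere (0 : Fin (i + 1) → ℝ) 1 → e s 0 ≤ 0 → F s = p s.2 := by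
    intro s hs h
    refine Subtype.ext ?_
    change g (e s) = _
    rw [hgf hs, hfp ⟨hs, h⟩]
    simp only [hue]
  have hFq : ∀ s, e s ∈ sphere (0 : Fin (i + 1) → ℝ) 1 → 0 ≤ e s 0 → F s = q s.2 := by
    intro s hs h
    refine Subtype.ext ?_
    change g (e s) = _
    rw [hgf hs, hfq ⟨hs, h⟩]
    simp only [hue]
  refine ⟨⟨⟨F, fun c => ?_, fun c => ?_⟩, fun t c hc => ?_⟩⟩
  · exact hFp (0, c) (hesph _ 0 (by simp [e])) (by simp [e])
  · exact hFq (1, c) (hesph _ 0 (by norm_num [e])) (by norm_num [e])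
  · change F (t, c) = p c
    have hs : e (t, c) ∈ sphere (0 : Fin (i + 1) → ℝ) 1 := by
      obtain ⟨j, hj | hj⟩ := hc
      · exact hesph _ j.succ (by simp [e, hj])
      · exact hesph _ j.succ (by norm_num [e, hj])
    rcases le_total (e (t, c) 0) 0 with h | h
    · exact hFp _ hs h
    · rw [hFq _ hs h, GenLoop.boundary q c hc, GenLoop.boundary p c hc]

namespace Constructible

variable {V : Type*} {Δ : SC V} {d : ℤ}

theorem card_le (h : Constructible Δ d) : ∀ s ∈ Δ.faces, (s.card : ℤ) ≤ d + 1 := by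
  induction h with
  | simplex s =>
    intro t ht
    have : t.card ≤ s.card := Finset.card_le_card ht
    omega
  | union _ _ _ _ ih₁ ih₂ _ => exact fun s hs => hs.elim (ih₁ s) (ih₂ s)

theorem union_comm (A B : SC V) : A.union B = B.union A := by
  simp only [SC.union, Set.union_comm]

variable [DecidableEq V]

theorem link_union_of_notMem {A B : SC V} {F : Finset V} (hF : F ∉ B.faces) :
    (A.union B).link F = A.link F := by
  simp only [SC.link, SC.mk.injEq]
  ext G
  refine and_congr_right fun _ => or_iff_left fun h => hF (B.down h Finset.subset_union_right)

theorem link_union (A B : SC V) (F : Finset V) :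
    (A.union B).link F = (A.link F).union (B.link F) := by
  simp only [SC.link, SC.union, SC.mk.injEq]
  ext G
  exact and_or_left

theorem link_inter (A B : SC V) (F : Finset V) :
    (A.inter B).link F = (A.link F).inter (B.link F) := by
  simp only [SC.link, SC.inter, SC.mk.injEq]
  ext G
  exact and_and_left

theorem link_simplex {s F : Finset V} (hF : F ⊆ s) :
    (SC.simplex s).link F = SC.simplex (s \ F) := by
  simp only [SC.link, SC.simplex, SC.mk.injEq]
  ext G
  change Disjoint G F ∧ G ∪ F ⊆ s ↔ G ⊆ s \ F
  rw [Finset.subset_sdiff, Finset.union_subset_iff]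
  tauto

theorem sphereExtends [Fintype V] (h : Constructible Δ d) :
    ∀ F ∈ Δ.faces, ∀ n : ℕ, (n : ℤ) ≤ d - F.card →
      SphereExtends n (Δ.link F).realization := by
  induction h with
  | simplex s =>
    intro F hF n hn
    rw [link_simplex hF]
    refine (convex_realization_simplex _).sphereExtends (realization_simplex_nonempty ?_) n
    rw [← Finset.card_pos, Finset.card_sdiff_of_subset hF]
    omega
  | @union A B d e _ _ hde _ ihA ihB ihAB =>
    intro F hF n hn
    by_cases hA : F ∈ A.faces
    · by_cases hB : F ∈ B.faces
      · rw [link_union]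
        refine SphereExtends.union (fun m hm => ihA F hA m (by omega))
          (fun m hm => ihB F hB m (by omega)) fun m hm => ?_
        rw [← link_inter]
        exact ihAB F ⟨hA, hB⟩ m (by omega)
      · rw [link_union_of_notMem hB]
        exact ihA F hA n hn
    · rw [union_comm, link_union_of_notMem hA]
      exact ihB F (hF.resolve_left hA) n hn

theorem dim_link_le (h : Constructible Δ d) {F : Finset V} (hF : F ∈ Δ.faces) :
    (Δ.link F).dim ≤ d - F.card := by
  refine csSup_le ?_ ?_
  · exact ⟨_, ∅, ⟨Finset.disjoint_empty_left F, by simpa using hF⟩, rfl⟩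
  · rintro _ ⟨G, ⟨hd, hG⟩, rfl⟩
    have := h.card_le _ hG
    rw [Finset.card_union_of_disjoint hd] at this
    push_cast at this ⊢
    linarith

end Constructible

/-- Every constructible simplicial complex is homotopy Cohen-Macaulay. -/
theorem constructible_homotopyCM {V : Type*} [Fintype V] [DecidableEq V]
    (Δ : SC V) (d : ℤ) (h : Constructible Δ d) : HomotopyCM Δ := by
  intro F hF
  have hd := h.dim_link_le hF
  refine ⟨fun hk => ?_, fun x i hi => ?_⟩
  · obtain ⟨g, -, hg, -⟩ := h.sphereExtends F hF 0 (by push_cast; linarith)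
      (fun _ => 0) continuousOn_const fun y hy => by
        rw [mem_sphere_zero_iff_norm, Subsingleton.elim y 0, norm_zero] at hy
        exact absurd hy zero_ne_one
    exact ⟨⟨g 0, hg (mem_closedBall_self zero_le_one)⟩⟩
  · exact (h.sphereExtends F hF (i + 1) (by push_cast; linarith)).subsingleton_homotopyGroup x
end

section
/- The direct product of two strongly constructible posets is strongly constructible. -/
open scoped BigOperators

namespace SC

/-- The order complex of a poset `P`: the simplicial complex whose faces are
the finite chains of `P`. -/
def orderComplex (P : Type*) [PartialOrder P] : SC P :=
  ⟨{s | ∀ a ∈ s, ∀ b ∈ s, a ≤ b ∨ b ≤ a},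
    fun s t hs hts a ha b hb => hs a (hts ha) b (hts hb)⟩

end SC

/-- A simplicial complex is pure shellable of dimension `d` if its facets all
have dimension `d` and can be listed as `G₁, …, G_m` so that for `i > 1` the
intersection of `G₁ ∪ ⋯ ∪ G_{i-1}` with `G_i` is pure of dimension `d - 1`. -/
def PureShellable {V : Type*} (Δ : SC V) (d : ℕ) : Prop :=
  ∃ (m : ℕ) (G : Fin m → Finset V), 0 < m ∧
    (∀ i, G i ∈ Δ.faces ∧ (G i).card = d + 1) ∧
    (∀ s ∈ Δ.faces, ∃ i, s ⊆ G i) ∧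
    ∀ i : Fin m, 0 < (i : ℕ) →
      ∀ s ⊆ G i, (∃ j, j < i ∧ s ⊆ G j) →
        ∃ t, t ⊆ G i ∧ (∃ j, j < i ∧ t ⊆ G j) ∧ t.card = d ∧ s ⊆ t

/-- A poset has rank `d` if its longest chains have `d + 1` elements. -/
def HasRank (P : Type*) [Preorder P] (d : ℕ) : Prop :=
  (∃ l : List P, l.Chain' (· < ·) ∧ l.length = d + 1) ∧
    ∀ l : List P, l.Chain' (· < ·) → l.length ≤ d + 1

/-- Strong constructibility: a finite poset `P` of rank `d` with a minimum
element is strongly constructible if it is bounded and pure shellable, or it is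
the union of two strongly constructible proper order ideals of rank `d` whose
intersection is strongly constructible of rank at least `d - 1`. -/
inductive SConstr : ∀ (P : Type) [PartialOrder P], ℕ → Prop
  | base (P : Type) [PartialOrder P] [Finite P] (d : ℕ)
      (hbot : ∃ m : P, ∀ x, m ≤ x) (htop : ∃ M : P, ∀ x, x ≤ M)
      (hshell : PureShellable (SC.orderComplex P) d) : SConstr P d
  | union (P : Type) [PartialOrder P] [Finite P] (d e : ℕ) (I₁ I₂ : Set P)
      (hmin : ∃ m : P, ∀ x, m ≤ x) (hrank : HasRank P d)
      (hl1 : IsLowerSet I₁) (hl2 : IsLowerSet I₂)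
      (hp1 : I₁ ≠ Set.univ) (hp2 : I₂ ≠ Set.univ)
      (hcover : I₁ ∪ I₂ = Set.univ)
      (hr1 : HasRank I₁ d) (hr2 : HasRank I₂ d)
      (hc1 : SConstr I₁ d) (hc2 : SConstr I₂ d)
      (he : d - 1 ≤ e)
      (hre : HasRank ↥(I₁ ∩ I₂) e) (hce : SConstr ↥(I₁ ∩ I₂) e) :
      SConstr P d

namespace SC

/-- A `d`-dimensional face of a simplicial complex. -/
def IsFaceOfDim {V : Type*} (Δ : SC V) (d : ℕ) (s : Finset V) : Prop :=
  s ∈ Δ.faces ∧ s.card = d + 1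

/-- A function on faces whose value orders the `d`-dimensional faces into a shelling,
regardless of how ties are broken. -/
def IsShellingKey {V α : Type*} [DecidableEq V] [LinearOrder α] (Δ : SC V) (d : ℕ)
    (k : Finset V → α) : Prop :=
  ∀ ⦃F F' : Finset V⦄, Δ.IsFaceOfDim d F → Δ.IsFaceOfDim d F' → F ≠ F' → k F' ≤ k F →
    ∃ v ∈ F, v ∉ F' ∧ ∃ F'', Δ.IsFaceOfDim d F'' ∧ k F'' < k F ∧ F.erase v ⊆ F''

theorem insert_mem_faces_orderComplex {P : Type*} [PartialOrder P] [DecidableEq P] {s : Finset P}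
    (hs : s ∈ (orderComplex P).faces) {a : P} (ha : ∀ b ∈ s, a ≤ b ∨ b ≤ a) :
    insert a s ∈ (orderComplex P).faces := by
  intro x hx y hy
  rcases Finset.mem_insert.1 hx with rfl | hx' <;> rcases Finset.mem_insert.1 hy with rfl | hy'
  · exact Or.inl le_rfl
  · exact ha y hy'
  · exact (ha x hx').symm
  · exact hs x hx' y hy'

theorem exists_greatest_of_mem_faces {P : Type*} [PartialOrder P] {s : Finset P}
    (hs : s ∈ (orderComplex P).faces) (hne : s.Nonempty) : ∃ m ∈ s, ∀ x ∈ s, x ≤ m := by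
  obtain ⟨m, hm⟩ := s.exists_maximal hne
  exact ⟨m, hm.1, fun x hx => (hs x hx m hm.1).elim id fun h => hm.2 hx h⟩

theorem exists_pred_of_mem_faces {P : Type*} [PartialOrder P] {s : Finset P}
    (hs : s ∈ (orderComplex P).faces) {v : P} (h : ∃ u ∈ s, u < v) :
    ∃ u ∈ s, u < v ∧ ∀ x ∈ s, x < v → x ≤ u := by
  classical
  obtain ⟨u, hu, huv⟩ := h
  obtain ⟨m, hm, hmax⟩ := exists_greatest_of_mem_faces
    ((orderComplex P).down hs (Finset.filter_subset (· < v) s))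
    ⟨u, Finset.mem_filter.2 ⟨hu, huv⟩⟩
  rw [Finset.mem_filter] at hm
  exact ⟨m, hm.1, hm.2, fun x hx hxv => hmax x (Finset.mem_filter.2 ⟨hx, hxv⟩)⟩

theorem exists_least_of_mem_faces {P : Type*} [PartialOrder P] {s : Finset P}
    (hs : s ∈ (orderComplex P).faces) (hne : s.Nonempty) : ∃ m ∈ s, ∀ x ∈ s, m ≤ x := by
  obtain ⟨m, hm⟩ := s.exists_minimal hne
  exact ⟨m, hm.1, fun x hx => (hs x hx m hm.1).elim (fun h => hm.2 hx h) id⟩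

theorem exists_succ_of_mem_faces {P : Type*} [PartialOrder P] {s : Finset P}
    (hs : s ∈ (orderComplex P).faces) {v : P} (h : ∃ u ∈ s, v < u) :
    ∃ u ∈ s, v < u ∧ ∀ x ∈ s, v < x → u ≤ x := by
  classical
  obtain ⟨u, hu, huv⟩ := h
  obtain ⟨m, hm, hmin⟩ := exists_least_of_mem_faces
    ((orderComplex P).down hs (Finset.filter_subset (v < ·) s))
    ⟨u, Finset.mem_filter.2 ⟨hu, huv⟩⟩
  rw [Finset.mem_filter] at hm
  exact ⟨m, hm.1, hm.2, fun x hx hxv => hmin x (Finset.mem_filter.2 ⟨hx, hxv⟩)⟩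

/-- A chain of the largest possible size is maximal. -/
theorem IsFaceOfDim.mem_of_comparable {P : Type*} [PartialOrder P] {d : ℕ}
    (hP : ∀ s ∈ (orderComplex P).faces, s.card ≤ d + 1) {F : Finset P}
    (hF : (orderComplex P).IsFaceOfDim d F) {a : P} (ha : ∀ b ∈ F, a ≤ b ∨ b ≤ a) : a ∈ F := by
  classical
  by_contra h
  have := hP _ (insert_mem_faces_orderComplex hF.1 ha)
  rw [Finset.card_insert_of_notMem h, hF.2] at this
  omega

theorem IsFaceOfDim.nonempty {V : Type*} {Δ : SC V} {d : ℕ} {F : Finset V}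
    (hF : Δ.IsFaceOfDim d F) : F.Nonempty :=
  Finset.card_pos.1 (hF.2 ▸ d.succ_pos)

end SC

open SC

theorem PureShellable.exists_isFaceOfDim {V : Type*} {Δ : SC V} {d : ℕ}
    (h : PureShellable Δ d) {s : Finset V} (hs : s ∈ Δ.faces) :
    ∃ F, Δ.IsFaceOfDim d F ∧ s ⊆ F := by
  obtain ⟨m, G, -, hG, hcov, -⟩ := h
  obtain ⟨i, hi⟩ := hcov s hs
  exact ⟨G i, hG i, hi⟩

theorem PureShellable.card_le {V : Type*} {Δ : SC V} {d : ℕ} (h : PureShellable Δ d)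
    {s : Finset V} (hs : s ∈ Δ.faces) : s.card ≤ d + 1 := by
  obtain ⟨F, hF, hsF⟩ := h.exists_isFaceOfDim hs
  exact hF.2 ▸ Finset.card_le_card hsF

theorem PureShellable.exists_isShellingKey {V : Type*} [DecidableEq V] {Δ : SC V} {d : ℕ}
    (h : PureShellable Δ d) : ∃ k : Finset V → ℕ, Δ.IsShellingKey d k := by
  obtain ⟨m, G, -, hG, hcov, hsh⟩ := h
  let I : Finset V → Set ℕ := fun F => {n | ∃ h : n < m, G ⟨n, h⟩ = F}
  have hI : ∀ F, Δ.IsFaceOfDim d F → sInf (I F) ∈ I F := by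
    intro F hF
    obtain ⟨i, hi⟩ := hcov F hF.1
    refine Nat.sInf_mem ⟨i, i.2, ?_⟩
    exact (Finset.eq_of_subset_of_card_le hi (by rw [(hG i).2, hF.2])).symm
  refine ⟨fun F => sInf (I F), fun F F' hF hF' hne hle => ?_⟩
  obtain ⟨hi, hiF⟩ := hI F hF
  obtain ⟨hj, hjF⟩ := hI F' hF'
  have hlt : sInf (I F') < sInf (I F) := by
    refine lt_of_le_of_ne hle fun h => hne ?_
    rw [← hiF, ← hjF]
    congr 2
    exact h.symm
  obtain ⟨t, htF, ⟨l, hl, htl⟩, htc, hst⟩ := hsh ⟨_, hi⟩ (Nat.zero_lt_of_lt hlt) (F ∩ F')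
    (by rw [hiF]; exact Finset.inter_subset_left)
    ⟨⟨_, hj⟩, hlt, by rw [hjF]; exact Finset.inter_subset_right⟩
  rw [hiF] at htF
  obtain ⟨v, hvF, hvt⟩ := Finset.exists_mem_notMem_of_card_lt_card
    (show t.card < F.card by rw [htc, hF.2]; exact d.lt_succ_self)
  refine ⟨v, hvF, fun hv => hvt (hst (Finset.mem_inter.2 ⟨hvF, hv⟩)), G l, hG l,
    lt_of_le_of_lt (Nat.sInf_le ⟨l.2, rfl⟩) hl, ?_⟩
  have : t = F.erase v := Finset.eq_of_subset_of_card_le (Finset.subset_erase.2 ⟨htF, hvt⟩)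
    (by rw [Finset.card_erase_of_mem hvF, hF.2, htc, Nat.add_sub_cancel])
  exact this ▸ htl

theorem PureShellable.of_isShellingKey {V α : Type*} [Finite V] [DecidableEq V] [LinearOrder α]
    {Δ : SC V} {d : ℕ} (hne : Δ.faces.Nonempty)
    (hpure : ∀ s ∈ Δ.faces, ∃ F, Δ.IsFaceOfDim d F ∧ s ⊆ F) {k : Finset V → α}
    (hk : Δ.IsShellingKey d k) : PureShellable Δ d := by
  let S := {F // Δ.IsFaceOfDim d F}
  let E : S ≃ Fin (Nat.card S) := Finite.equivFin S
  let f : Fin (Nat.card S) → α := fun i => k (E.symm i).1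
  let σ := Tuple.sort f
  have hmono : Monotone (f ∘ σ) := Tuple.monotone_sort f
  have hidx : ∀ F (hF : Δ.IsFaceOfDim d F), ∃ i, (E.symm (σ i)).1 = F :=
    fun F hF => ⟨σ.symm (E ⟨F, hF⟩), by simp⟩
  refine ⟨Nat.card S, fun i => (E.symm (σ i)).1, ?_, fun i => (E.symm (σ i)).2, ?_, ?_⟩
  · obtain ⟨s, hs⟩ := hne
    obtain ⟨F, hF, -⟩ := hpure s hs
    have : Nonempty S := ⟨⟨F, hF⟩⟩
    exact Nat.card_pos
  · intro s hs
    obtain ⟨F, hF, hsF⟩ := hpure s hs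
    obtain ⟨i, hi⟩ := hidx F hF
    exact ⟨i, hsF.trans hi.ge⟩
  · rintro i - s hsi ⟨j, hji, hsj⟩
    have hij : (E.symm (σ i)).1 ≠ (E.symm (σ j)).1 := fun h =>
      hji.ne' (σ.injective (E.symm.injective (Subtype.ext h)))
    obtain ⟨v, hv, hv', F, hF, hlt, hsub⟩ :=
      hk (E.symm (σ i)).2 (E.symm (σ j)).2 hij (hmono hji.le)
    obtain ⟨l, rfl⟩ := hidx F hF
    refine ⟨(E.symm (σ i)).1.erase v, Finset.erase_subset _ _, ⟨l, ?_, hsub⟩, ?_, ?_⟩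
    · exact lt_of_not_ge fun h => (hmono h).not_gt hlt
    · rw [Finset.card_erase_of_mem hv, (E.symm (σ i)).2.2, Nat.add_sub_cancel]
    · exact Finset.subset_erase.2 ⟨hsi, fun h => hv' (hsj h)⟩

section Prod

variable {P Q : Type*} [PartialOrder P] [PartialOrder Q]

theorem image_fst_mem_faces [DecidableEq P] {C : Finset (P × Q)}
    (hC : C ∈ (orderComplex (P × Q)).faces) : C.image Prod.fst ∈ (orderComplex P).faces := by
  intro a ha b hb
  obtain ⟨p, hp, rfl⟩ := Finset.mem_image.1 ha
  obtain ⟨q, hq, rfl⟩ := Finset.mem_image.1 hb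
  exact (hC p hp q hq).imp (fun h => h.1) fun h => h.1

theorem image_snd_mem_faces [DecidableEq Q] {C : Finset (P × Q)}
    (hC : C ∈ (orderComplex (P × Q)).faces) : C.image Prod.snd ∈ (orderComplex Q).faces := by
  intro a ha b hb
  obtain ⟨p, hp, rfl⟩ := Finset.mem_image.1 ha
  obtain ⟨q, hq, rfl⟩ := Finset.mem_image.1 hb
  exact (hC p hp q hq).imp (fun h => h.2) fun h => h.2

/-- A chain in a product has no two points one of which is strictly to the upper left
of the other. -/
theorem not_antidiagonal {C : Finset (P × Q)} (hC : C ∈ (orderComplex (P × Q)).faces)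
    {p q : P × Q} (hp : p ∈ C) (hq : q ∈ C) (h₁ : p.1 < q.1) (h₂ : q.2 < p.2) : False :=
  (hC p hp q hq).elim (fun h => h₂.not_ge h.2) fun h => h₁.not_ge h.1

theorem card_add_one_le_of_mem_faces [DecidableEq P] [DecidableEq Q] {C : Finset (P × Q)}
    (hC : C ∈ (orderComplex (P × Q)).faces) (hne : C.Nonempty) :
    C.card + 1 ≤ (C.image Prod.fst).card + (C.image Prod.snd).card := by
  induction C using Finset.strongInduction with
  | H C ih =>
    obtain ⟨m, hm, hmax⟩ := exists_greatest_of_mem_faces hC hne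
    have hcard := Finset.card_erase_add_one hm
    have hF : (C.erase m).image Prod.fst ⊆ C.image Prod.fst :=
      Finset.image_subset_image (Finset.erase_subset _ _)
    have hG : (C.erase m).image Prod.snd ⊆ C.image Prod.snd :=
      Finset.image_subset_image (Finset.erase_subset _ _)
    rcases (C.erase m).eq_empty_or_nonempty with h0 | h0
    · have h₁ := (hne.image Prod.fst).card_pos
      have h₂ := (hne.image Prod.snd).card_pos
      rw [h0, Finset.card_empty] at hcard
      omega
    have hih := ih _ (Finset.erase_ssubset hm)
      ((orderComplex _).down hC (Finset.erase_subset _ _)) h0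
    by_cases h₁ : m.1 ∈ (C.erase m).image Prod.fst
    · by_cases h₂ : m.2 ∈ (C.erase m).image Prod.snd
      · obtain ⟨p, hp, hp1⟩ := Finset.mem_image.1 h₁
        obtain ⟨q, hq, hq2⟩ := Finset.mem_image.1 h₂
        rw [Finset.mem_erase] at hp hq
        rcases hC p hp.2 q hq.2 with h | h
        · exact absurd (Prod.ext (le_antisymm (hmax q hq.2).1 (hp1 ▸ h.1)) hq2) hq.1
        · exact absurd (Prod.ext hp1 (le_antisymm (hmax p hp.2).2 (hq2 ▸ h.2))) hp.1
      · have := Finset.card_lt_card ((Finset.ssubset_iff_of_subset hG).2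
          ⟨m.2, Finset.mem_image_of_mem _ hm, h₂⟩)
        have := Finset.card_le_card hF
        omega
    · have := Finset.card_lt_card ((Finset.ssubset_iff_of_subset hF).2
          ⟨m.1, Finset.mem_image_of_mem _ hm, h₁⟩)
      have := Finset.card_le_card hG
      omega

/-- A chain in a product of two chains extends to one of the largest possible size. -/
theorem exists_chain_extension [DecidableEq P] [DecidableEq Q] {F : Finset P} {G : Finset Q}
    (hF : F ∈ (orderComplex P).faces) (hG : G ∈ (orderComplex Q).faces)
    (hFne : F.Nonempty) (hGne : G.Nonempty)
    {s : Finset (P × Q)} (hs : s ∈ (orderComplex (P × Q)).faces) (hsub : s ⊆ F ×ˢ G) :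
    ∃ C ∈ (orderComplex (P × Q)).faces, s ⊆ C ∧ C ⊆ F ×ˢ G ∧ F.card + G.card ≤ C.card + 1 := by
  obtain ⟨n, hn⟩ : ∃ n, F.card + G.card = n := ⟨_, rfl⟩
  induction n using Nat.strong_induction_on generalizing F G s with
  | _ n ih =>
    obtain ⟨x, hx, hxmax⟩ := exists_greatest_of_mem_faces hF hFne
    obtain ⟨y, hy, hymax⟩ := exists_greatest_of_mem_faces hG hGne
    have hs' : s.erase (x, y) ∈ (orderComplex (P × Q)).faces :=
      (orderComplex _).down hs (Finset.erase_subset _ _)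
    have hmem : ∀ p ∈ s.erase (x, y), p ∈ s ∧ p.1 ∈ F ∧ p.2 ∈ G ∧ p ≠ (x, y) := fun p hp =>
      ⟨Finset.mem_of_mem_erase hp,
        (Finset.mem_product.1 (hsub (Finset.mem_of_mem_erase hp))).1,
        (Finset.mem_product.1 (hsub (Finset.mem_of_mem_erase hp))).2, Finset.ne_of_mem_erase hp⟩
    have hFc := Finset.card_erase_add_one hx
    have hGc := Finset.card_erase_add_one hy
    have finish : ∀ C ∈ (orderComplex (P × Q)).faces, s.erase (x, y) ⊆ C → C ⊆ F ×ˢ G →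
        (x, y) ∉ C → F.card + G.card ≤ C.card + 2 →
        ∃ C ∈ (orderComplex (P × Q)).faces, s ⊆ C ∧ C ⊆ F ×ˢ G ∧
          F.card + G.card ≤ C.card + 1 := by
      intro C hC hsC hCFG hxy hcard
      refine ⟨insert (x, y) C, insert_mem_faces_orderComplex hC fun p hp => Or.inr ?_, ?_, ?_, ?_⟩
      · have := Finset.mem_product.1 (hCFG hp)
        exact ⟨hxmax _ this.1, hymax _ this.2⟩
      · rwa [Finset.subset_insert_iff]
      · exact Finset.insert_subset (Finset.mem_product.2 ⟨hx, hy⟩) hCFG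
      · rw [Finset.card_insert_of_notMem hxy]
        omega
    by_cases hA : (F.erase x).Nonempty ∧ ∀ p ∈ s.erase (x, y), p.1 ≠ x
    · obtain ⟨C, hC, hsC, hCFG, hcard⟩ := ih _ (by omega)
        ((orderComplex _).down hF (Finset.erase_subset x F)) hG hA.1 hGne hs'
        (fun p hp => Finset.mem_product.2
          ⟨Finset.mem_erase.2 ⟨hA.2 p hp, (hmem p hp).2.1⟩, (hmem p hp).2.2.1⟩) rfl
      refine finish C hC hsC (hCFG.trans (Finset.product_subset_product_left
        (Finset.erase_subset _ _))) (fun h => ?_) (by omega)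
      exact Finset.notMem_erase x F (Finset.mem_product.1 (hCFG h)).1
    by_cases hB : (G.erase y).Nonempty ∧ ∀ p ∈ s.erase (x, y), p.2 ≠ y
    · obtain ⟨C, hC, hsC, hCFG, hcard⟩ := ih _ (by omega) hF
        ((orderComplex _).down hG (Finset.erase_subset y G)) hFne hB.1 hs'
        (fun p hp => Finset.mem_product.2
          ⟨(hmem p hp).2.1, Finset.mem_erase.2 ⟨hB.2 p hp, (hmem p hp).2.2.1⟩⟩) rfl
      refine finish C hC hsC (hCFG.trans (Finset.product_subset_product_right
        (Finset.erase_subset _ _))) (fun h => ?_) (by omega)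
      exact Finset.notMem_erase y G (Finset.mem_product.1 (hCFG h)).2
    have hF0 : F.erase x = ∅ := by
      by_contra h
      have h := Finset.nonempty_iff_ne_empty.2 h
      obtain ⟨p, hp, hpx⟩ : ∃ p ∈ s.erase (x, y), p.1 = x := by
        by_contra! hcon
        exact hA ⟨h, hcon⟩
      obtain ⟨hps, -, hpG, hpne⟩ := hmem p hp
      have hpy : p.2 ≠ y := fun h => hpne (Prod.ext hpx h)
      obtain ⟨q, hq, hqy⟩ : ∃ q ∈ s.erase (x, y), q.2 = y := by
        by_contra! hcon
        exact hB ⟨⟨p.2, Finset.mem_erase.2 ⟨hpy, hpG⟩⟩, hcon⟩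
      obtain ⟨hqs, hqF, -, hqne⟩ := hmem q hq
      have hqx : q.1 ≠ x := fun h => hqne (Prod.ext h hqy)
      exact not_antidiagonal hs hqs hps (by rw [hpx]; exact lt_of_le_of_ne (hxmax _ hqF) hqx)
        (by rw [hqy]; exact lt_of_le_of_ne (hymax _ hpG) hpy)
    have hG0 : G.erase y = ∅ := by
      by_contra h
      obtain ⟨q, hq, hqy⟩ : ∃ q ∈ s.erase (x, y), q.2 = y := by
        by_contra! hcon
        exact hB ⟨Finset.nonempty_iff_ne_empty.2 h, hcon⟩
      obtain ⟨-, hqF, -, hqne⟩ := hmem q hq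
      have hqx : q.1 ∈ F.erase x := Finset.mem_erase.2 ⟨fun h => hqne (Prod.ext h hqy), hqF⟩
      simp [hF0] at hqx
    rw [hF0, Finset.card_empty] at hFc
    rw [hG0, Finset.card_empty] at hGc
    refine finish ∅ (fun a ha => by simp at ha) (fun p hp => ?_) (Finset.empty_subset _)
      (Finset.notMem_empty _) (by simp; omega)
    obtain ⟨-, hpF, hpG, hpne⟩ := hmem p hp
    have h₁ : p.1 ∉ F.erase x := by simp [hF0]
    have h₂ : p.2 ∉ G.erase y := by simp [hG0]
    simp only [Finset.mem_erase, not_and, hpF, hpG, not_true_eq_false, imp_false, not_not] at h₁ h₂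
    exact absurd (Prod.ext h₁ h₂) hpne

section MaximalChains

variable [DecidableEq P] [DecidableEq Q] {d e : ℕ}
  (hP : ∀ s ∈ (orderComplex P).faces, s.card ≤ d + 1)
  (hQ : ∀ s ∈ (orderComplex Q).faces, s.card ≤ e + 1)

include hP hQ

theorem card_le_of_mem_faces_prod {C : Finset (P × Q)} (hC : C ∈ (orderComplex (P × Q)).faces) :
    C.card ≤ d + e + 1 := by
  rcases C.eq_empty_or_nonempty with rfl | hne
  · simp
  have h₁ := hP _ (image_fst_mem_faces hC)
  have h₂ := hQ _ (image_snd_mem_faces hC)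
  have := card_add_one_le_of_mem_faces hC hne
  omega

theorem SC.IsFaceOfDim.image_fst {C : Finset (P × Q)}
    (hC : (orderComplex (P × Q)).IsFaceOfDim (d + e) C) :
    (orderComplex P).IsFaceOfDim d (C.image Prod.fst) := by
  have h₁ := hP _ (image_fst_mem_faces hC.1)
  have h₂ := hQ _ (image_snd_mem_faces hC.1)
  have := card_add_one_le_of_mem_faces hC.1 hC.nonempty
  rw [hC.2] at this
  exact ⟨image_fst_mem_faces hC.1, by omega⟩

theorem SC.IsFaceOfDim.image_snd {C : Finset (P × Q)}
    (hC : (orderComplex (P × Q)).IsFaceOfDim (d + e) C) :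
    (orderComplex Q).IsFaceOfDim e (C.image Prod.snd) := by
  have h₁ := hP _ (image_fst_mem_faces hC.1)
  have h₂ := hQ _ (image_snd_mem_faces hC.1)
  have := card_add_one_le_of_mem_faces hC.1 hC.nonempty
  rw [hC.2] at this
  exact ⟨image_snd_mem_faces hC.1, by omega⟩

theorem image_eq_of_subset_product {F : Finset P} {G : Finset Q}
    (hF : (orderComplex P).IsFaceOfDim d F) (hG : (orderComplex Q).IsFaceOfDim e G)
    {C : Finset (P × Q)} (hC : (orderComplex (P × Q)).IsFaceOfDim (d + e) C)
    (hsub : C ⊆ F ×ˢ G) : C.image Prod.fst = F ∧ C.image Prod.snd = G := by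
  constructor
  · refine Finset.eq_of_subset_of_card_le (fun x hx => ?_) ?_
    · obtain ⟨p, hp, rfl⟩ := Finset.mem_image.1 hx
      exact (Finset.mem_product.1 (hsub hp)).1
    · rw [hF.2, (hC.image_fst hP hQ).2]
  · refine Finset.eq_of_subset_of_card_le (fun x hx => ?_) ?_
    · obtain ⟨p, hp, rfl⟩ := Finset.mem_image.1 hx
      exact (Finset.mem_product.1 (hsub hp)).2
    · rw [hG.2, (hC.image_snd hP hQ).2]

theorem exists_isFaceOfDim_extension {F : Finset P} {G : Finset Q}
    (hF : (orderComplex P).IsFaceOfDim d F) (hG : (orderComplex Q).IsFaceOfDim e G)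
    {s : Finset (P × Q)} (hs : s ∈ (orderComplex (P × Q)).faces) (hsub : s ⊆ F ×ˢ G) :
    ∃ C, (orderComplex (P × Q)).IsFaceOfDim (d + e) C ∧ s ⊆ C ∧
      C.image Prod.fst = F ∧ C.image Prod.snd = G := by
  obtain ⟨C, hC, hsC, hCFG, hcard⟩ :=
    exists_chain_extension hF.1 hG.1 hF.nonempty hG.nonempty hs hsub
  have hC' : (orderComplex (P × Q)).IsFaceOfDim (d + e) C := by
    have := card_le_of_mem_faces_prod hP hQ hC
    rw [hF.2, hG.2] at hcard
    exact ⟨hC, by omega⟩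
  exact ⟨C, hC', hsC, image_eq_of_subset_product hP hQ hF hG hC' hCFG⟩

theorem exists_mem_left {C : Finset (P × Q)}
    (hC : (orderComplex (P × Q)).IsFaceOfDim (d + e) C) {v : P} {b : Q} (hvb : (v, b) ∈ C)
    (hmin : ∀ q ∈ C, q < (v, b) → q.1 ≠ v) (hv : ∃ u ∈ C.image Prod.fst, u < v) :
    ∃ u < v, (u, b) ∈ C := by
  obtain ⟨u, hu, huv, hmax⟩ := exists_pred_of_mem_faces (image_fst_mem_faces hC.1) hv
  refine ⟨u, huv, hC.mem_of_comparable
    (fun s hs => card_le_of_mem_faces_prod hP hQ hs) fun q hq => ?_⟩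
  by_cases h : q < (v, b)
  · exact Or.inr ⟨hmax _ (Finset.mem_image_of_mem _ hq) (lt_of_le_of_ne h.le.1 (hmin q hq h)),
      h.le.2⟩
  · have hle : (v, b) ≤ q := (hC.1 q hq _ hvb).elim
      (fun h' => (eq_of_le_of_not_lt h' h).ge) id
    exact Or.inl ⟨huv.le.trans hle.1, hle.2⟩

theorem exists_mem_above {C : Finset (P × Q)}
    (hC : (orderComplex (P × Q)).IsFaceOfDim (d + e) C) {v : P} {b : Q} (hvb : (v, b) ∈ C)
    (hmax : ∀ q ∈ C, (v, b) < q → q.2 ≠ b) (hb : ∃ c ∈ C.image Prod.snd, b < c) :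
    ∃ c, b < c ∧ (v, c) ∈ C := by
  obtain ⟨c, hc, hbc, hmin⟩ := exists_succ_of_mem_faces (image_snd_mem_faces hC.1) hb
  refine ⟨c, hbc, hC.mem_of_comparable
    (fun s hs => card_le_of_mem_faces_prod hP hQ hs) fun q hq => ?_⟩
  by_cases h : (v, b) < q
  · exact Or.inl ⟨h.le.1, hmin _ (Finset.mem_image_of_mem _ hq)
      (lt_of_le_of_ne h.le.2 (hmax q hq h).symm)⟩
  · have hle : q ≤ (v, b) := (hC.1 q hq _ hvb).elim id
      fun h' => (eq_of_le_of_not_lt h' h).ge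
    exact Or.inr ⟨hle.1, hle.2.trans hbc.le⟩

end MaximalChains

/-- The points weakly to the upper left of some point of `C`. -/
def upperLeft (C : Finset (P × Q)) : Set (P × Q) :=
  {z | ∃ p ∈ C, z.1 ≤ p.1 ∧ p.2 ≤ z.2}

theorem upperLeft_subset_iff {C C' : Finset (P × Q)} :
    upperLeft C ⊆ upperLeft C' ↔ ∀ p ∈ C, p ∈ upperLeft C' := by
  refine ⟨fun h p hp => h ⟨p, hp, le_rfl, le_rfl⟩, ?_⟩
  rintro h z ⟨p, hp, h₁, h₂⟩
  obtain ⟨q, hq, h₃, h₄⟩ := h p hp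
  exact ⟨q, hq, h₁.trans h₃, h₄.trans h₂⟩

theorem exists_corner_flip [Finite P] [Finite Q] [DecidableEq P] [DecidableEq Q] {d e : ℕ}
    (hP : ∀ s ∈ (orderComplex P).faces, s.card ≤ d + 1)
    (hQ : ∀ s ∈ (orderComplex Q).faces, s.card ≤ e + 1) {C : Finset (P × Q)}
    (hC : (orderComplex (P × Q)).IsFaceOfDim (d + e) C) {u v : P} {b c : Q}
    (hvb : (v, b) ∈ C) (hub : (u, b) ∈ C) (hvc : (v, c) ∈ C) (huv : u < v) (hbc : b < c) :
    ∃ C', (orderComplex (P × Q)).IsFaceOfDim (d + e) C' ∧ C.erase (v, b) ⊆ C' ∧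
      C'.image Prod.fst = C.image Prod.fst ∧ C'.image Prod.snd = C.image Prod.snd ∧
      (upperLeft C').ncard < (upperLeft C).ncard := by
  obtain ⟨u', hu', huv', hpred⟩ := exists_pred_of_mem_faces (image_fst_mem_faces hC.1)
    ⟨u, Finset.mem_image_of_mem Prod.fst hub, huv⟩
  obtain ⟨c', hc', hbc', hsucc⟩ := exists_succ_of_mem_faces (image_snd_mem_faces hC.1)
    ⟨c, Finset.mem_image_of_mem Prod.snd hvc, hbc⟩
  have hcases : ∀ q ∈ C.erase (v, b), q.1 < v ∧ q.2 ≤ b ∨ v ≤ q.1 ∧ b < q.2 := by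
    intro q hq
    obtain ⟨hne, hq⟩ := Finset.mem_erase.1 hq
    rcases hC.1 q hq _ hvb with h | h
    · refine Or.inl ⟨lt_of_le_of_ne h.1 fun h₁ => ?_, h.2⟩
      exact not_antidiagonal hC.1 hub hq (huv.trans_eq h₁.symm)
        (lt_of_le_of_ne h.2 fun h₂ => hne (Prod.ext h₁ h₂))
    · refine Or.inr ⟨h.1, lt_of_le_of_ne h.2 fun h₂ => ?_⟩
      exact not_antidiagonal hC.1 hvc hq
        (lt_of_le_of_ne h.1 fun h₁ => hne (Prod.ext h₁.symm h₂.symm)) (h₂.symm.trans_lt hbc)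
  have hchain : insert (u', c') (C.erase (v, b)) ∈ (orderComplex (P × Q)).faces := by
    refine insert_mem_faces_orderComplex ((orderComplex _).down hC.1 (Finset.erase_subset _ _))
      fun q hq => ?_
    have hqC := Finset.mem_of_mem_erase hq
    rcases hcases q hq with h | h
    · exact Or.inr ⟨hpred _ (Finset.mem_image_of_mem _ hqC) h.1, h.2.trans hbc'.le⟩
    · exact Or.inl ⟨huv'.le.trans h.1, hsucc _ (Finset.mem_image_of_mem _ hqC) h.2⟩
  have hnot : (u', c') ∉ C.erase (v, b) := fun h =>
    not_antidiagonal hC.1 (Finset.mem_of_mem_erase h) hvb huv' hbc'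
  have hface : (orderComplex (P × Q)).IsFaceOfDim (d + e) (insert (u', c') (C.erase (v, b))) :=
    ⟨hchain, by rw [Finset.card_insert_of_notMem hnot, Finset.card_erase_add_one hvb, hC.2]⟩
  obtain ⟨h₁, h₂⟩ := image_eq_of_subset_product hP hQ (hC.image_fst hP hQ) (hC.image_snd hP hQ)
    hface (Finset.insert_subset (Finset.mem_product.2 ⟨hu', hc'⟩)
      ((Finset.erase_subset _ _).trans Finset.subset_product))
  refine ⟨_, hface, Finset.subset_insert _ _, h₁, h₂, Set.ncard_lt_ncard ⟨?_, ?_⟩ (Set.toFinite _)⟩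
  · refine upperLeft_subset_iff.2 fun p hp => ?_
    rcases Finset.mem_insert.1 hp with rfl | hp
    · exact ⟨(v, b), hvb, huv'.le, hbc'.le⟩
    · exact ⟨p, Finset.mem_of_mem_erase hp, le_rfl, le_rfl⟩
  · intro h
    obtain ⟨q, hq, hq₁, hq₂⟩ := h (⟨(v, b), hvb, le_rfl, le_rfl⟩ : (v, b) ∈ upperLeft C)
    rcases Finset.mem_insert.1 hq with rfl | hq
    · exact huv'.not_ge hq₁
    · rcases hcases q hq with h | h
      · exact h.1.not_ge hq₁
      · exact h.2.not_ge hq₂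

/-- If `C ≠ C'` are maximal chains with the same projections and `C'` does not have more points
to its upper left than `C`, then `C'` passes strictly to the upper left of some point of `C`. -/
theorem exists_antidiagonal_of_ncard_le [Finite P] [Finite Q] [DecidableEq P] [DecidableEq Q]
    {d e : ℕ} (hP : ∀ s ∈ (orderComplex P).faces, s.card ≤ d + 1)
    (hQ : ∀ s ∈ (orderComplex Q).faces, s.card ≤ e + 1) {C C' : Finset (P × Q)}
    (hC : (orderComplex (P × Q)).IsFaceOfDim (d + e) C)
    (hC' : (orderComplex (P × Q)).IsFaceOfDim (d + e) C') (hne : C ≠ C')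
    (hfst : C.image Prod.fst = C'.image Prod.fst) (hsnd : C.image Prod.snd = C'.image Prod.snd)
    (hcard : (upperLeft C').ncard ≤ (upperLeft C).ncard) :
    ∃ p ∈ C, ∃ p' ∈ C', p'.1 < p.1 ∧ p.2 < p'.2 := by
  by_contra! hcon
  have key : ∀ p ∈ C, p ∉ C' → ∃ p' ∈ C', p.1 < p'.1 ∧ p'.2 < p.2 := by
    intro p hp hpC'
    by_contra! h
    refine hpC' (hC'.mem_of_comparable (fun s hs => card_le_of_mem_faces_prod hP hQ hs)
      fun p' hp' => ?_)
    have h₁ := image_fst_mem_faces hC.1 p.1 (Finset.mem_image_of_mem _ hp) p'.1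
      (hfst ▸ Finset.mem_image_of_mem _ hp')
    have h₂ := image_snd_mem_faces hC.1 p.2 (Finset.mem_image_of_mem _ hp) p'.2
      (hsnd ▸ Finset.mem_image_of_mem _ hp')
    have h₃ := hcon p hp p' hp'
    have h₄ := h p' hp'
    rcases h₁ with h₁ | h₁ <;> rcases h₂ with h₂ | h₂
    · exact Or.inl ⟨h₁, h₂⟩
    · rcases h₁.eq_or_lt with h₁ | h₁
      · exact Or.inr ⟨h₁.ge, h₂⟩
      · exact Or.inl ⟨h₁.le, (eq_of_le_of_not_lt h₂ (h₄ h₁)).ge⟩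
    · rcases h₁.eq_or_lt with h₁ | h₁
      · exact Or.inl ⟨h₁.ge, h₂⟩
      · exact Or.inr ⟨h₁.le, (eq_of_le_of_not_lt h₂ (h₃ h₁)).ge⟩
    · exact Or.inr ⟨h₁, h₂⟩
  have hsub : upperLeft C ⊆ upperLeft C' := by
    refine upperLeft_subset_iff.2 fun p hp => ?_
    by_cases hpC' : p ∈ C'
    · exact ⟨p, hpC', le_rfl, le_rfl⟩
    · obtain ⟨p', hp', h₁, h₂⟩ := key p hp hpC'
      exact ⟨p', hp', h₁.le, h₂.le⟩
  have heq := Set.eq_of_subset_of_ncard_le hsub hcard (Set.toFinite _)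
  obtain ⟨p, hp, hpC'⟩ := Finset.not_subset.1 fun h =>
    hne (Finset.eq_of_subset_of_card_le h (by rw [hC.2, hC'.2]))
  obtain ⟨p', hp', h₁, h₂⟩ := key p hp hpC'
  obtain ⟨q, hq, h₃, h₄⟩ : p' ∈ upperLeft C := heq ▸ ⟨p', hp', le_rfl, le_rfl⟩
  exact not_antidiagonal hC.1 hp hq (h₁.trans_le h₃) (h₄.trans_lt h₂)

/-- Shelling keys of two posets give a shelling key of their product: maximal chains are compared
by their first projections, then by their second projections, then by their upper left regions. -/
theorem isShellingKey_prod [Finite P] [Finite Q] [DecidableEq P] [DecidableEq Q]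
    (hbot : ∃ m : P, ∀ x, m ≤ x) (htop : ∃ M : Q, ∀ x, x ≤ M) {d e : ℕ}
    (hP : ∀ s ∈ (orderComplex P).faces, s.card ≤ d + 1)
    (hQ : ∀ s ∈ (orderComplex Q).faces, s.card ≤ e + 1)
    {kP : Finset P → ℕ} (hkP : (orderComplex P).IsShellingKey d kP)
    {kQ : Finset Q → ℕ} (hkQ : (orderComplex Q).IsShellingKey e kQ) :
    (orderComplex (P × Q)).IsShellingKey (d + e) fun C =>
      toLex (kP (C.image Prod.fst), toLex (kQ (C.image Prod.snd), (upperLeft C).ncard)) := by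
  classical
  intro C C' hC hC' hne hle
  have hF := hC.image_fst hP hQ
  have hG := hC.image_snd hP hQ
  have hF' := hC'.image_fst hP hQ
  have hG' := hC'.image_snd hP hQ
  have flip : ∀ {u v : P} {b c : Q}, (v, b) ∈ C → (u, b) ∈ C → (v, c) ∈ C → u < v → b < c →
      ∃ C'', (orderComplex (P × Q)).IsFaceOfDim (d + e) C'' ∧
        toLex (kP (C''.image Prod.fst), toLex (kQ (C''.image Prod.snd), (upperLeft C'').ncard)) <
        toLex (kP (C.image Prod.fst), toLex (kQ (C.image Prod.snd), (upperLeft C).ncard)) ∧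
        C.erase (v, b) ⊆ C'' := by
    intro u v b c hvb hub hvc huv hbc
    obtain ⟨C'', hC'', hsub, h₁, h₂, hlt⟩ := exists_corner_flip hP hQ hC hvb hub hvc huv hbc
    refine ⟨C'', hC'', ?_, hsub⟩
    rw [h₁, h₂]
    exact Prod.Lex.toLex_lt_toLex.2 (Or.inr ⟨rfl, Prod.Lex.toLex_lt_toLex.2 (Or.inr ⟨rfl, hlt⟩)⟩)
  have herase (p : P × Q) : C.erase p ∈ (orderComplex (P × Q)).faces :=
    (orderComplex _).down hC.1 (Finset.erase_subset _ _)
  rw [Prod.Lex.toLex_le_toLex] at hle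
  by_cases hfst : C.image Prod.fst = C'.image Prod.fst
  · replace hle := hle.resolve_left fun h => h.ne (by rw [hfst])
    replace hle := Prod.Lex.toLex_le_toLex.1 hle.2
    by_cases hsnd : C.image Prod.snd = C'.image Prod.snd
    · replace hle := (hle.resolve_left fun h => h.ne (by rw [hsnd])).2
      obtain ⟨p, hp, p', hp', h₁, h₂⟩ :=
        exists_antidiagonal_of_ncard_le hP hQ hC hC' hne hfst hsnd hle
      obtain ⟨⟨x, y⟩, hxy, hmin⟩ := exists_least_of_mem_faces
        ((orderComplex _).down hC.1 (Finset.filter_subset (fun q => p'.1 < q.1 ∧ q.2 < p'.2) C))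
        ⟨p, Finset.mem_filter.2 ⟨hp, h₁, h₂⟩⟩
      obtain ⟨hxy, hx, hy⟩ := Finset.mem_filter.1 hxy
      obtain ⟨u, hux, hu⟩ := exists_mem_left hP hQ hC hxy (fun q hq hlt hqx =>
        (hmin q (Finset.mem_filter.2 ⟨hq, hqx ▸ hx, hlt.le.2.trans_lt hy⟩)).not_gt hlt)
        ⟨p'.1, hfst ▸ Finset.mem_image_of_mem _ hp', hx⟩
      obtain ⟨⟨v, y'⟩, hvy₀, hmax⟩ := exists_greatest_of_mem_faces
        ((orderComplex _).down hC.1 (Finset.filter_subset (fun q => q.2 = y) C))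
        ⟨_, Finset.mem_filter.2 ⟨hxy, rfl⟩⟩
      obtain ⟨hvy, rfl⟩ := Finset.mem_filter.1 hvy₀
      have hxv : x ≤ v := (hmax _ (Finset.mem_filter.2 ⟨hxy, rfl⟩)).1
      obtain ⟨c, hyc, hc⟩ := exists_mem_above hP hQ hC hvy
        (fun q hq hlt hqy => (hmax q (Finset.mem_filter.2 ⟨hq, hqy⟩)).not_gt hlt)
        ⟨p'.2, hsnd ▸ Finset.mem_image_of_mem _ hp', hy⟩
      exact ⟨_, hvy, fun h => not_antidiagonal hC'.1 hp' h (hx.trans_le hxv) hy,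
        flip hvy hu hc (hux.trans_le hxv) hyc⟩
    · obtain ⟨v, hv, hv', G, hGf, hlt, hsub⟩ := hkQ hG hG' hsnd (hle.elim le_of_lt fun h => h.1.le)
      obtain ⟨p, hp, hpv⟩ := Finset.mem_image.1 hv
      obtain ⟨⟨a, v'⟩, hav₀, hmax⟩ := exists_greatest_of_mem_faces
        ((orderComplex _).down hC.1 (Finset.filter_subset (fun q => q.2 = v) C))
        ⟨_, Finset.mem_filter.2 ⟨hp, hpv⟩⟩
      obtain ⟨hav, rfl⟩ := Finset.mem_filter.1 hav₀
      refine ⟨_, hav, fun h => hv' (Finset.mem_image_of_mem _ h), ?_⟩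
      by_cases hrow : ∀ q ∈ C, q.2 = v' → q = (a, v')
      · obtain ⟨C'', hC'', hsC'', h₁, h₂⟩ := exists_isFaceOfDim_extension hP hQ hF hGf
          (herase (a, v')) fun q hq => by
            obtain ⟨hqne, hq⟩ := Finset.mem_erase.1 hq
            exact Finset.mem_product.2 ⟨Finset.mem_image_of_mem _ hq, hsub
              (Finset.mem_erase.2 ⟨fun h => hqne (hrow q hq h), Finset.mem_image_of_mem _ hq⟩)⟩
        refine ⟨C'', hC'', ?_, hsC''⟩
        beta_reduce
        rw [h₁, h₂]
        exact Prod.Lex.toLex_lt_toLex.2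
          (Or.inr ⟨rfl, Prod.Lex.toLex_lt_toLex.2 (Or.inl hlt)⟩)
      · push Not at hrow
        obtain ⟨⟨u, y⟩, hq, rfl, hqne⟩ := hrow
        have hu : u < a := lt_of_le_of_ne (hmax _ (Finset.mem_filter.2 ⟨hq, rfl⟩)).1
          fun h => hqne (by rw [h])
        obtain ⟨M, hM⟩ := htop
        obtain ⟨c, hyc, hc⟩ := exists_mem_above hP hQ hC hav
          (fun q hq hlt hqy => (hmax q (Finset.mem_filter.2 ⟨hq, hqy⟩)).not_gt hlt)
          ⟨M, hG.mem_of_comparable hQ fun b _ => Or.inr (hM b), lt_of_le_of_ne (hM _) fun h =>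
            hv' (h ▸ hG'.mem_of_comparable hQ fun b _ => Or.inr (hM b))⟩
        exact flip hav hq hc hu hyc
  · obtain ⟨v, hv, hv', F, hFf, hlt, hsub⟩ := hkP hF hF' hfst (hle.elim le_of_lt fun h => h.1.le)
    obtain ⟨p, hp, hpv⟩ := Finset.mem_image.1 hv
    obtain ⟨⟨v', b⟩, hvb₀, hmin⟩ := exists_least_of_mem_faces
      ((orderComplex _).down hC.1 (Finset.filter_subset (fun q => q.1 = v) C))
      ⟨_, Finset.mem_filter.2 ⟨hp, hpv⟩⟩
    obtain ⟨hvb, rfl⟩ := Finset.mem_filter.1 hvb₀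
    refine ⟨_, hvb, fun h => hv' (Finset.mem_image_of_mem _ h), ?_⟩
    by_cases hcol : ∀ q ∈ C, q.1 = v' → q = (v', b)
    · obtain ⟨C'', hC'', hsC'', h₁, h₂⟩ := exists_isFaceOfDim_extension hP hQ hFf hG
        (herase (v', b)) fun q hq => by
          obtain ⟨hqne, hq⟩ := Finset.mem_erase.1 hq
          exact Finset.mem_product.2 ⟨hsub
            (Finset.mem_erase.2 ⟨fun h => hqne (hcol q hq h), Finset.mem_image_of_mem _ hq⟩),
            Finset.mem_image_of_mem _ hq⟩
      refine ⟨C'', hC'', ?_, hsC''⟩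
      beta_reduce
      rw [h₁, h₂]
      exact Prod.Lex.toLex_lt_toLex.2 (Or.inl hlt)
    · push Not at hcol
      obtain ⟨⟨x, c⟩, hq, rfl, hqne⟩ := hcol
      have hc : b < c := lt_of_le_of_ne (hmin _ (Finset.mem_filter.2 ⟨hq, rfl⟩)).2
        fun h => hqne (by rw [h])
      obtain ⟨m, hm⟩ := hbot
      obtain ⟨u, hux, hu⟩ := exists_mem_left hP hQ hC hvb
        (fun q hq hlt hqx => (hmin q (Finset.mem_filter.2 ⟨hq, hqx⟩)).not_gt hlt)
        ⟨m, hF.mem_of_comparable hP fun b _ => Or.inl (hm b), lt_of_le_of_ne (hm _) fun h =>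
          hv' (h ▸ hF'.mem_of_comparable hP fun b _ => Or.inl (hm b))⟩
      exact flip hvb hu hq hux hc

/-- The order complex of a product is pure shellable if both factors are,
the first one having a least and the second one a greatest element. -/
theorem PureShellable.prod [Finite P] [Finite Q] (hbot : ∃ m : P, ∀ x, m ≤ x)
    (htop : ∃ M : Q, ∀ x, x ≤ M) {d e : ℕ} (hP : PureShellable (orderComplex P) d)
    (hQ : PureShellable (orderComplex Q) e) : PureShellable (orderComplex (P × Q)) (d + e) := by
  classical
  obtain ⟨kP, hkP⟩ := hP.exists_isShellingKey
  obtain ⟨kQ, hkQ⟩ := hQ.exists_isShellingKey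
  refine .of_isShellingKey ⟨∅, fun a ha => by simp at ha⟩ (fun s hs => ?_)
    (isShellingKey_prod hbot htop (fun _ => hP.card_le) (fun _ => hQ.card_le) hkP hkQ)
  obtain ⟨F, hF, hsF⟩ := hP.exists_isFaceOfDim (image_fst_mem_faces hs)
  obtain ⟨G, hG, hsG⟩ := hQ.exists_isFaceOfDim (image_snd_mem_faces hs)
  obtain ⟨C, hC, hsC, -⟩ := exists_isFaceOfDim_extension (fun _ => hP.card_le)
    (fun _ => hQ.card_le) hF hG hs
    (Finset.subset_product.trans (Finset.product_subset_product hsF hsG))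
  exact ⟨C, hC, hsC⟩

end Prod

theorem PureShellable.of_orderIso {P R : Type*} [PartialOrder P] [PartialOrder R] (φ : P ≃o R)
    {d : ℕ} (h : PureShellable (orderComplex P) d) : PureShellable (orderComplex R) d := by
  obtain ⟨m, G, hm, hG, hcov, hsh⟩ := h
  have hmap : ∀ (s : Finset R) (t : Finset P),
      s ⊆ t.map φ.toEquiv.toEmbedding ↔ s.map φ.symm.toEquiv.toEmbedding ⊆ t := by
    intro s t
    refine ⟨fun h x hx => ?_, fun h x hx => ?_⟩
    · obtain ⟨y, hy, rfl⟩ := Finset.mem_map.1 hx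
      obtain ⟨z, hz, rfl⟩ := Finset.mem_map.1 (h hy)
      simpa using hz
    · exact Finset.mem_map.2 ⟨φ.symm x, h (Finset.mem_map_of_mem _ hx), by simp⟩
  refine ⟨m, fun i => (G i).map φ.toEquiv.toEmbedding, hm, fun i => ⟨?_, ?_⟩, ?_, ?_⟩
  · intro a ha b hb
    obtain ⟨x, hx, rfl⟩ := Finset.mem_map.1 ha
    obtain ⟨y, hy, rfl⟩ := Finset.mem_map.1 hb
    simpa using (hG i).1 x hx y hy
  · rw [Finset.card_map, (hG i).2]
  · intro s hs
    obtain ⟨i, hi⟩ := hcov (s.map φ.symm.toEquiv.toEmbedding) (by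
      intro a ha b hb
      obtain ⟨x, hx, rfl⟩ := Finset.mem_map.1 ha
      obtain ⟨y, hy, rfl⟩ := Finset.mem_map.1 hb
      simpa using hs x hx y hy)
    exact ⟨i, (hmap _ _).2 hi⟩
  · rintro i hi s hsi ⟨j, hj, hsj⟩
    obtain ⟨t, hti, ⟨l, hl, htl⟩, htc, hst⟩ := hsh i hi _ ((hmap _ _).1 hsi)
      ⟨j, hj, (hmap _ _).1 hsj⟩
    exact ⟨t.map φ.toEquiv.toEmbedding, Finset.map_subset_map.2 hti,
      ⟨l, hl, Finset.map_subset_map.2 htl⟩, by rw [Finset.card_map, htc], (hmap _ _).2 hst⟩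

theorem exists_isChain_list_of_mem_faces {P : Type*} [PartialOrder P] {s : Finset P}
    (hs : s ∈ (orderComplex P).faces) :
    ∃ l : List P, l.IsChain (· < ·) ∧ l.length = s.card ∧ ∀ x ∈ l, x ∈ s := by
  classical
  induction s using Finset.strongInduction with
  | H s ih =>
    rcases s.eq_empty_or_nonempty with rfl | hne
    · exact ⟨[], by simp⟩
    obtain ⟨m, hm, hmin⟩ := exists_least_of_mem_faces hs hne
    obtain ⟨l, hl, hlen, hmem⟩ := ih _ (Finset.erase_ssubset hm)
      ((orderComplex P).down hs (Finset.erase_subset _ _))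
    refine ⟨m :: l, List.isChain_cons.2 ⟨fun y hy => ?_, hl⟩, ?_, ?_⟩
    · have := Finset.mem_erase.1 (hmem y (List.mem_of_mem_head? hy))
      exact lt_of_le_of_ne (hmin y this.2) this.1.symm
    · rw [List.length_cons, hlen, Finset.card_erase_add_one hm]
    · intro x hx
      rcases List.mem_cons.1 hx with rfl | hx
      · exact hm
      · exact Finset.mem_of_mem_erase (hmem x hx)

theorem le_total_of_mem_isChain_list {P : Type*} [PartialOrder P] {l : List P}
    (hl : l.IsChain (· < ·)) {a b : P} (ha : a ∈ l) (hb : b ∈ l) : a ≤ b ∨ b ≤ a := by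
  have hpw := List.pairwise_iff_getElem.1 (List.isChain_iff_pairwise.1 hl)
  obtain ⟨i, hi, rfl⟩ := List.getElem_of_mem ha
  obtain ⟨j, hj, rfl⟩ := List.getElem_of_mem hb
  rcases lt_trichotomy i j with h | rfl | h
  · exact Or.inl (hpw i j hi hj h).le
  · exact Or.inl le_rfl
  · exact Or.inr (hpw j i hj hi h).le

theorem PureShellable.hasRank {P : Type*} [PartialOrder P] {d : ℕ}
    (h : PureShellable (orderComplex P) d) : HasRank P d := by
  classical
  refine ⟨?_, fun l hl => ?_⟩
  · obtain ⟨F, hF, -⟩ := h.exists_isFaceOfDim (s := ∅) fun a ha => by simp at ha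
    obtain ⟨l, hl, hlen, -⟩ := exists_isChain_list_of_mem_faces hF.1
    exact ⟨l, hl, hlen.trans hF.2⟩
  · have hpw : l.Pairwise (· < ·) := List.isChain_iff_pairwise.1 hl
    rw [← List.toFinset_card_of_nodup (hpw.imp ne_of_lt)]
    refine h.card_le fun a ha b hb => ?_
    rw [List.mem_toFinset] at ha hb
    exact le_total_of_mem_isChain_list hl ha hb

theorem HasRank.of_isLowerSet_union {P : Type*} [PartialOrder P] {d : ℕ} {I₁ I₂ : Set P}
    (hl₁ : IsLowerSet I₁) (hl₂ : IsLowerSet I₂) (hcover : I₁ ∪ I₂ = Set.univ)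
    (h₁ : HasRank I₁ d) (h₂ : HasRank I₂ d) : HasRank P d := by
  refine ⟨?_, fun l hl => ?_⟩
  · obtain ⟨l, hl, hlen⟩ := h₁.1
    exact ⟨l.map Subtype.val, (List.isChain_map _).2 hl, by rw [List.length_map, hlen]⟩
  · have key : (∀ x ∈ l, x ∈ I₁) ∨ ∀ x ∈ l, x ∈ I₂ := by
      by_contra! hcon
      obtain ⟨⟨x, hx, hx₁⟩, y, hy, hy₂⟩ := hcon
      have hx₂ : x ∈ I₂ := (hcover.ge (Set.mem_univ x)).resolve_left hx₁
      have hy₁ : y ∈ I₁ := (hcover.ge (Set.mem_univ y)).resolve_right hy₂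
      exact (le_total_of_mem_isChain_list hl hx hy).elim (fun h => hx₁ (hl₁ h hy₁))
        fun h => hy₂ (hl₂ h hx₂)
    have bound : ∀ {I : Set P}, HasRank I d → (∀ x ∈ l, x ∈ I) → l.length ≤ d + 1 := by
      intro I hI hmem
      lift l to List I using hmem
      rw [List.length_map]
      exact hI.2 l ((List.isChain_map Subtype.val).1 hl)
    exact key.elim (bound h₁) (bound h₂)

theorem SConstr.hasRank {P : Type} [PartialOrder P] {d : ℕ} (h : SConstr P d) : HasRank P d := by
  cases h with
  | base _ _ _ _ h => exact h.hasRank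
  | union _ _ _ _ _ _ h => exact h

theorem SConstr.exists_least {P : Type} [PartialOrder P] {d : ℕ} (h : SConstr P d) :
    ∃ m : P, ∀ x, m ≤ x := by
  cases h with
  | base _ _ h => exact h
  | union _ _ _ _ _ h => exact h

/-- If `φ : R ≃o P × Q`, the points of `R` with first coordinate in `I` form `I × Q`. -/
def preimageFstIso {P Q R : Type*} [PartialOrder P] [PartialOrder Q] [PartialOrder R]
    (φ : R ≃o P × Q) (I : Set P) : {r : R | (φ r).1 ∈ I} ≃o I × Q where
  toFun r := (⟨(φ r).1, r.2⟩, (φ r).2)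
  invFun p := ⟨φ.symm (p.1, p.2), by simp⟩
  left_inv r := by simp
  right_inv p := by simp
  map_rel_iff' {a b} := φ.le_iff_le

/-- To show that products with `Q` are strongly constructible, it suffices to consider
bounded pure shellable first factors. -/
theorem SConstr.of_prod_of_shellable {Q : Type} [PartialOrder Q] [Finite Q] {e : ℕ}
    (hbot : ∃ m : Q, ∀ x, m ≤ x)
    (hbase : ∀ (P : Type) [PartialOrder P] [Finite P] (d : ℕ), (∃ m : P, ∀ x, m ≤ x) →
      (∃ M : P, ∀ x, x ≤ M) → PureShellable (orderComplex P) d →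
      ∀ (R : Type) [PartialOrder R], (R ≃o P × Q) → SConstr R (d + e))
    {P : Type} [PartialOrder P] {d : ℕ} (hP : SConstr P d) :
    ∀ (R : Type) [PartialOrder R], (R ≃o P × Q) → SConstr R (d + e) := by
  induction hP with
  | base P d hm hM hsh => exact hbase P d hm hM hsh
  | union P d e' I₁ I₂ hm hr hl₁ hl₂ hp₁ hp₂ hcover hr₁ hr₂ hc₁ hc₂ he hre hce ih₁ ih₂ ih =>
    intro R _ φ
    have := Finite.of_equiv _ φ.symm.toEquiv
    obtain ⟨m, hm⟩ := hm
    obtain ⟨m', hm'⟩ := hbot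
    have hlower : ∀ {I : Set P}, IsLowerSet I → IsLowerSet {r : R | (φ r).1 ∈ I} :=
      fun hI a b hba ha => hI (φ.monotone hba).1 ha
    have hproper : ∀ {I : Set P}, I ≠ Set.univ → {r : R | (φ r).1 ∈ I} ≠ Set.univ := by
      intro I hI h
      refine hI (Set.eq_univ_of_forall fun x => ?_)
      simpa using h.ge (Set.mem_univ (φ.symm (x, m')))
    have hcover' : {r : R | (φ r).1 ∈ I₁} ∪ {r : R | (φ r).1 ∈ I₂} = Set.univ :=
      Set.eq_univ_of_forall fun r => hcover.ge (Set.mem_univ (φ r).1)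
    have h₁ := ih₁ _ (preimageFstIso φ I₁)
    have h₂ := ih₂ _ (preimageFstIso φ I₂)
    have h₃ := ih _ (preimageFstIso φ (I₁ ∩ I₂))
    exact .union R (d + e) (e' + e) {r | (φ r).1 ∈ I₁} {r | (φ r).1 ∈ I₂}
      ⟨φ.symm (m, m'), fun x => φ.symm_apply_le.2 ⟨hm _, hm' _⟩⟩
      (.of_isLowerSet_union (hlower hl₁) (hlower hl₂) hcover' h₁.hasRank h₂.hasRank)
      (hlower hl₁) (hlower hl₂) (hproper hp₁) (hproper hp₂) hcover' h₁.hasRank h₂.hasRank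
      h₁ h₂ (by omega) h₃.hasRank h₃

/-- The direct product of two strongly constructible posets is strongly
constructible. -/
theorem sconstr_prod (P Q : Type) [PartialOrder P] [PartialOrder Q]
    [Finite P] [Finite Q] (d e : ℕ) (hP : SConstr P d) (hQ : SConstr Q e) :
    SConstr (P × Q) (d + e) := by
  refine hP.of_prod_of_shellable hQ.exists_least (fun P _ _ d hm hM hsh R _ φ => ?_) _ (.refl _)
  rw [add_comm]
  refine hQ.of_prod_of_shellable hm (fun Q _ _ e hm' hM' hsh' R _ ψ => ?_) R
    (φ.trans OrderIso.prodComm)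
  obtain ⟨m, hm⟩ := hm
  obtain ⟨M, hM⟩ := hM
  obtain ⟨m', hm'⟩ := hm'
  obtain ⟨M', hM'⟩ := hM'
  have := Finite.of_equiv _ ψ.symm.toEquiv
  exact .base R (e + d) ⟨ψ.symm (m', m), fun x => ψ.symm_apply_le.2 ⟨hm' _, hm _⟩⟩
    ⟨ψ.symm (M', M), fun x => ψ.le_symm_apply.2 ⟨hM' _, hM _⟩⟩
    ((hsh'.prod ⟨m', hm'⟩ ⟨M, hM⟩ hsh).of_orderIso ψ.symm)
end

section
/- In the absolute order on S_n, u ⪯ v holds if and only if every cycle of u can be obtained from some cycle of v by deleting elements, and any two cycles of u obtained from the same cycle c of v are noncrossing with respect to c. -/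
open Equiv

/-- The reflection length of a permutation `w`: the smallest number of
transpositions whose product is `w`. -/
noncomputable def reflLen {n : ℕ} (w : Equiv.Perm (Fin n)) : ℕ :=
  sInf {k | ∃ l : List (Equiv.Perm (Fin n)), l.length = k ∧
    (∀ t ∈ l, t.IsSwap) ∧ l.prod = w}

/-- The absolute order on `S_n`: `u ⪯ v` iff `ℓ_T u + ℓ_T (u⁻¹ v) = ℓ_T v`. -/
def AbsLe {n : ℕ} (u v : Equiv.Perm (Fin n)) : Prop :=
  reflLen u + reflLen (u⁻¹ * v) = reflLen v

/-- The cycle `a` can be obtained from the cycle `c` by deleting elements: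
the support of `a` is contained in that of `c`, and `a` sends each element of
its support to the first element of its support reached by iterating `c`. -/
def ObtainedByDeletion {n : ℕ} (a c : Equiv.Perm (Fin n)) : Prop :=
  a.support ⊆ c.support ∧
    ∀ x ∈ a.support, ∃ m : ℕ, 0 < m ∧ a x = (c ^ m) x ∧
      ∀ l : ℕ, 0 < l → l < m → (c ^ l) x ∉ a.support

/-- Two disjoint cycles `a`, `b` obtained from `c` by deletion are noncrossing
with respect to `c` if no 4-cycle `(i j k l)` obtainable from `c` by deletion
has `i, k` in `a` and `j, l` in `b`. -/
def NoncrossingWrt {n : ℕ} (a b c : Equiv.Perm (Fin n)) : Prop :=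
  ¬ ∃ i j k l : Fin n,
      [i, j, k, l].Nodup ∧
      i ∈ a.support ∧ k ∈ a.support ∧ j ∈ b.support ∧ l ∈ b.support ∧
      ObtainedByDeletion (Equiv.swap i l * Equiv.swap i k * Equiv.swap i j) c

namespace Equiv.Perm

variable {α : Type*} [Finite α]

lemma SameCycle.mem_of_mapsTo {f : Perm α} {S : Set α} {x y : α} (h : f.SameCycle x y)
    (hS : ∀ z ∈ S, f z ∈ S) (hx : x ∈ S) : y ∈ S := by
  obtain ⟨m, -, rfl⟩ := h.exists_pow_eq'
  clear h
  induction m with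
  | zero => simpa using hx
  | succ m ih => simpa [pow_succ'] using hS _ ih

lemma SameCycle.exists_first_pow_eq {f : Perm α} {x y : α} (h : f.SameCycle x y) :
    ∃ m : ℕ, 0 < m ∧ (f ^ m) x = y ∧ ∀ l : ℕ, 0 < l → l < m → (f ^ l) x ≠ y := by
  classical
  have hex : ∃ m : ℕ, 0 < m ∧ (f ^ m) x = y := by
    obtain ⟨m, hm, -, h⟩ := h.exists_pow_eq''
    exact ⟨m, hm, h⟩
  exact ⟨Nat.find hex, (Nat.find_spec hex).1, (Nat.find_spec hex).2,
    fun l hl hlm h => Nat.find_min hex hlm ⟨hl, h⟩⟩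

lemma pow_sub_apply_eq {β : Type*} {f : Perm β} {x y : β} {s r : ℕ} (hsr : s ≤ r)
    (h : (f ^ s) x = (f ^ r) y) : x = (f ^ (r - s)) y := by
  apply (f ^ s).injective
  rw [h, ← mul_apply, ← pow_add, Nat.add_sub_cancel' hsr]

/-- The number of cycles of a permutation, fixed points included. -/
noncomputable def numCycles {β : Type*} (f : Perm β) : ℕ :=
  Nat.card (Quotient (SameCycle.setoid f))

section mul_swap

variable [DecidableEq α] {w : Perm α} {p q : α}

lemma SameCycle.not_mul_swap (hpq : p ≠ q) (h : w.SameCycle p q) :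
    ¬ (w * swap p q).SameCycle p q := by
  intro h'
  obtain ⟨k, hk, rfl, hmin⟩ := h.exists_first_pow_eq
  have hp : ∀ j, 0 < j → j ≤ k → (w ^ j) p ≠ p := by
    intro j hj hjk hjp
    rcases hjk.eq_or_lt with rfl | hlt
    · exact hpq hjp.symm
    · refine hmin (k - j) (by omega) (by omega) ?_
      conv_lhs => rw [← hjp]
      rw [← mul_apply, ← pow_add, Nat.sub_add_cancel hjk]
  obtain ⟨j, hj, hjk, hjp⟩ := h'.symm.mem_of_mapsTo
    (S := {z | ∃ j, 0 < j ∧ j ≤ k ∧ (w ^ j) p = z}) (by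
      rintro _ ⟨j, hj, hjk, rfl⟩
      rcases hjk.eq_or_lt with rfl | hlt
      · exact ⟨1, one_pos, hj, by simp⟩
      · refine ⟨j + 1, by omega, by omega, ?_⟩
        rw [mul_apply, swap_apply_of_ne_of_ne (hp j hj hjk) (hmin j hj hlt), pow_succ', mul_apply])
    ⟨k, hk, le_rfl, Eq.refl _⟩
  exact hp j hj hjk hjp

lemma SameCycle.of_mul_swap (h : w.SameCycle p q) {x y : α}
    (hxy : (w * swap p q).SameCycle x y) : w.SameCycle x y := by
  refine hxy.mem_of_mapsTo (S := {z | w.SameCycle x z}) ?_ (SameCycle.refl w x)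
  intro z (hz : w.SameCycle x z)
  change w.SameCycle x (w (swap p q z))
  rw [sameCycle_apply_right]
  by_cases hzp : z = p
  · subst hzp; simpa using hz.trans h
  by_cases hzq : z = q
  · subst hzq; simpa using hz.trans h.symm
  rwa [swap_apply_of_ne_of_ne hzp hzq]

lemma SameCycle.numCycles_lt (hpq : p ≠ q) (h : w.SameCycle p q) :
    numCycles w < numCycles (w * swap p q) := by
  classical
  have := Fintype.ofFinite (Quotient (SameCycle.setoid w))
  have := Fintype.ofFinite (Quotient (SameCycle.setoid (w * swap p q)))
  rw [numCycles, numCycles, Nat.card_eq_fintype_card, Nat.card_eq_fintype_card]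
  refine Fintype.card_lt_of_surjective_not_injective
    (Quotient.map' (s₁ := SameCycle.setoid (w * swap p q)) (s₂ := SameCycle.setoid w)
      id fun x y hxy => h.of_mul_swap hxy) ?_ ?_
  · rintro ⟨x⟩
    exact ⟨Quotient.mk'' x, Eq.refl _⟩
  · intro hinj
    exact h.not_mul_swap hpq (Quotient.exact
      (hinj (a₁ := Quotient.mk'' p) (a₂ := Quotient.mk'' q) (Quotient.sound h)))

lemma numCycles_le_mul_swap_add_one (w : Perm α) (p q : α) :
    numCycles w ≤ numCycles (w * swap p q) + 1 := by
  classical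
  let g : α → Quotient (SameCycle.setoid w) := fun z =>
    if w.SameCycle z q then Quotient.mk'' p else Quotient.mk'' z
  have hmk : ∀ {x y : α}, w.SameCycle x y →
      (Quotient.mk'' x : Quotient (SameCycle.setoid w)) = Quotient.mk'' y :=
    fun h => Quotient.sound h
  have hw : ∀ z, g (w z) = g z := by
    intro z
    simp only [g, sameCycle_apply_left]
    split_ifs
    · rfl
    · exact hmk (sameCycle_apply_left.2 (SameCycle.refl _ _))
  have hgp : g p = Quotient.mk'' p := by simp [g]
  have hgq : g q = Quotient.mk'' p := by simp [g, SameCycle.refl]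
  have hg : ∀ z, g ((w * swap p q) z) = g z := by
    intro z
    rw [mul_apply, hw]
    by_cases hzp : z = p
    · subst hzp; simp [hgp, hgq]
    by_cases hzq : z = q
    · subst hzq; simp [hgp, hgq]
    rw [swap_apply_of_ne_of_ne hzp hzq]
  let F : Option (Quotient (SameCycle.setoid (w * swap p q))) → Quotient (SameCycle.setoid w) :=
    fun o => o.elim (Quotient.mk'' q) (Quotient.lift g fun x y hxy =>
      (SameCycle.mem_of_mapsTo (S := {z | g z = g x}) hxy
        (fun z hz => (hg z).trans hz) rfl).symm)
  have hF : Function.Surjective F := by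
    rintro ⟨x⟩
    by_cases hx : w.SameCycle x q
    · exact ⟨none, hmk hx.symm⟩
    · exact ⟨some (Quotient.mk'' x), if_neg hx⟩
  have := Nat.card_le_card_of_surjective F hF
  rwa [Finite.card_option] at this

lemma SameCycle.numCycles_mul_swap (hpq : p ≠ q) (h : w.SameCycle p q) :
    numCycles (w * swap p q) = numCycles w + 1 := by
  refine le_antisymm ?_ (h.numCycles_lt hpq)
  simpa [mul_assoc] using numCycles_le_mul_swap_add_one (w * swap p q) p q

end mul_swap

lemma numCycles_one {β : Type*} : numCycles (1 : Perm β) = Nat.card β := by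
  refine (Nat.card_congr (Equiv.ofBijective (Quotient.mk (SameCycle.setoid (1 : Perm β)))
    ⟨fun x y h => ?_, Quotient.mk_surjective⟩)).symm
  exact sameCycle_one.1 (Quotient.exact h)

lemma numCycles_le (w : Perm α) : numCycles w ≤ Nat.card α :=
  Nat.card_le_card_of_surjective _ Quotient.mk_surjective

lemma exists_sameCycle_of_ne_one {β : Type*} {w : Perm β} (hw : w ≠ 1) :
    ∃ p q, p ≠ q ∧ w.SameCycle p q := by
  obtain ⟨p, hp⟩ : ∃ p, w p ≠ p := by
    by_contra! h
    exact hw (Equiv.ext h)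
  exact ⟨p, w p, hp.symm, sameCycle_apply_right.2 (SameCycle.refl w p)⟩

end Equiv.Perm

open Equiv.Perm

section reflLen

variable {n : ℕ}

lemma reflLen_le_length {l : List (Perm (Fin n))} (hl : ∀ t ∈ l, t.IsSwap) :
    reflLen l.prod ≤ l.length :=
  Nat.sInf_le ⟨l, rfl, hl, rfl⟩

lemma exists_length_eq_reflLen (w : Perm (Fin n)) :
    ∃ l : List (Perm (Fin n)), l.length = reflLen w ∧ (∀ t ∈ l, t.IsSwap) ∧ l.prod = w := by
  refine Nat.sInf_mem (s := {k | ∃ l : List (Perm (Fin n)), l.length = k ∧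
    (∀ t ∈ l, t.IsSwap) ∧ l.prod = w}) ?_
  obtain ⟨l, hl, hs⟩ := (truncSwapFactors w).out
  exact ⟨_, l, rfl, hs, hl⟩

lemma reflLen_mul_le (u w : Perm (Fin n)) : reflLen (u * w) ≤ reflLen u + reflLen w := by
  obtain ⟨l, hl, hs, rfl⟩ := exists_length_eq_reflLen u
  obtain ⟨l', hl', hs', rfl⟩ := exists_length_eq_reflLen w
  rw [← hl, ← hl', ← List.prod_append, ← List.length_append]
  exact reflLen_le_length fun t ht => (List.mem_append.1 ht).elim (hs t) (hs' t)

lemma reflLen_one : reflLen (1 : Perm (Fin n)) = 0 :=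
  Nat.le_zero.1 (reflLen_le_length (l := []) (by simp))

lemma reflLen_swap_le {p q : Fin n} (hpq : p ≠ q) : reflLen (swap p q) ≤ 1 := by
  simpa using reflLen_le_length (l := [swap p q]) (by simpa using ⟨p, q, hpq, rfl⟩)

lemma le_length_add_numCycles (l : List (Perm (Fin n))) (hl : ∀ t ∈ l, t.IsSwap) :
    n ≤ l.length + numCycles l.prod := by
  induction l using List.reverseRecOn with
  | nil => simp [numCycles_one]
  | append_singleton l t ih =>
    obtain ⟨p, q, -, rfl⟩ := hl t (by simp)
    have h₁ := ih fun t ht => hl t (by simp [ht])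
    have h₂ := numCycles_le_mul_swap_add_one l.prod p q
    simp only [List.length_append, List.length_singleton, List.prod_append, List.prod_singleton]
    omega

lemma reflLen_add_numCycles (w : Perm (Fin n)) : reflLen w + numCycles w = n := by
  refine le_antisymm ?_ ?_
  · induction h : n - numCycles w using Nat.strong_induction_on generalizing w with
    | _ k ih =>
      subst h
      by_cases hw : w = 1
      · simp [hw, reflLen_one, numCycles_one]
      obtain ⟨p, q, hpq, hs⟩ := exists_sameCycle_of_ne_one hw
      have h₁ := hs.numCycles_mul_swap hpq
      have h₂ : numCycles (w * swap p q) ≤ n := by simpa using numCycles_le (w * swap p q)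
      have h₃ := ih _ (by omega) (w * swap p q) rfl
      have h₄ := reflLen_mul_le (w * swap p q) (swap p q)
      rw [mul_assoc, swap_mul_self, mul_one] at h₄
      have h₅ := reflLen_swap_le hpq
      omega
  · obtain ⟨l, hl, hs, rfl⟩ := exists_length_eq_reflLen w
    rw [← hl]
    exact le_length_add_numCycles l hs

lemma reflLen_mul_swap_add_one {w : Perm (Fin n)} {p q : Fin n} (hpq : p ≠ q)
    (h : w.SameCycle p q) : reflLen (w * swap p q) + 1 = reflLen w := by
  have h₁ := reflLen_add_numCycles w
  have h₂ := reflLen_add_numCycles (w * swap p q)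
  have h₃ := h.numCycles_mul_swap hpq
  omega

end reflLen

/-- Every point `x` has a set `G` of points, to be thought of as those that `v` visits between `x`
and `u x`, such that `u` preserves `G` and `u⁻¹ * v` preserves `insert x G`. -/
def HasClosedGaps {α : Type*} (u v : Perm α) : Prop :=
  ∀ x, ∃ G : Set α, x ∉ G ∧ (∀ z ∈ G, u z ∈ G) ∧ ∀ z ∈ insert x G, u⁻¹ (v z) ∈ insert x G

namespace HasClosedGaps

variable {α : Type*} {u v : Perm α}

lemma apply_eq_or_mem {x : α} {G : Set α} (hu : ∀ z ∈ G, u z ∈ G)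
    (hw : ∀ z ∈ insert x G, u⁻¹ (v z) ∈ insert x G) {z : α} (hz : z ∈ insert x G) :
    v z = u x ∨ v z ∈ G := by
  rcases hw z hz with h | h
  · exact .inl (inv_eq_iff_eq.1 h)
  · exact .inr (by simpa using hu _ h)

lemma forall_mem_insert_mul_swap [DecidableEq α] {x p q : α} {G : Set α}
    (hw : ∀ z ∈ insert x G, u⁻¹ (v z) ∈ insert x G) (hpq : p ∈ insert x G ↔ q ∈ insert x G) :
    ∀ z ∈ insert x G, u⁻¹ ((v * swap p q) z) ∈ insert x G := by
  intro z hz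
  refine hw _ ?_
  by_cases hzp : z = p
  · rw [hzp, swap_apply_left]; exact hpq.1 (hzp ▸ hz)
  by_cases hzq : z = q
  · rw [hzq, swap_apply_right]; exact hpq.2 (hzq ▸ hz)
  rwa [swap_apply_of_ne_of_ne hzp hzq]

variable [Finite α]

lemma sameCycle_apply (h : HasClosedGaps u v) (x : α) : v.SameCycle x (u x) := by
  obtain ⟨G, hxG, hu, hw⟩ := h x
  by_contra hn
  have key : ∀ z ∈ insert x G, v.SameCycle x z → v z ∈ G ∧ v.SameCycle x (v z) := by
    intro z hz hs
    have hs' := sameCycle_apply_right.2 hs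
    rcases apply_eq_or_mem hu hw hz with h | h
    · exact absurd (h ▸ hs') hn
    · exact ⟨h, hs'⟩
  refine hxG (SameCycle.mem_of_mapsTo (S := {z | z ∈ G ∧ v.SameCycle x z})
    (sameCycle_apply_left.2 (SameCycle.refl v x)) ?_ (key x (.inl rfl) (SameCycle.refl v x))).1
  exact fun z hz => key z (.inr hz.1) hz.2

lemma sameCycle_inv_mul_apply (h : HasClosedGaps u v) (x : α) :
    v.SameCycle x (u⁻¹ (v x)) := by
  have := h.sameCycle_apply (u⁻¹ (v x))
  rw [show u (u⁻¹ (v x)) = v x by simp, sameCycle_apply_right] at this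
  exact this.symm

lemma sameCycle (h : HasClosedGaps u v) {x y : α} (hxy : u.SameCycle x y) : v.SameCycle x y :=
  hxy.mem_of_mapsTo (S := {z | v.SameCycle x z})
    (fun z hz => SameCycle.trans hz (h.sameCycle_apply z)) (SameCycle.refl v x)

variable [DecidableEq α]

lemma mul_swap (h : HasClosedGaps u v) {p q : α} (hpq : ¬ v.SameCycle p q) :
    HasClosedGaps u (v * swap p q) := by
  intro x
  obtain ⟨G, hxG, hu, hw⟩ := h x
  by_cases hiff : p ∈ insert x G ↔ q ∈ insert x G
  · exact ⟨G, hxG, hu, forall_mem_insert_mul_swap hw hiff⟩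
  wlog hp : p ∈ insert x G generalizing p q
  · rw [swap_comm]
    exact this (fun h => hpq h.symm) (fun h => hiff h.symm) (by_contra fun hq => hiff (iff_of_false hp hq))
  have hq : q ∉ insert x G := fun hq => hiff (iff_of_true hp hq)
  by_cases hx : v.SameCycle q x
  · have hpx : ¬ v.SameCycle p x := fun h => hpq (h.trans hx.symm)
    refine ⟨{z | z ∈ G ∧ ¬ v.SameCycle p z}, fun h => hxG h.1,
      fun z hz => ⟨hu z hz.1, fun h' => hz.2 (h'.trans (h.sameCycle_apply z).symm)⟩,
      forall_mem_insert_mul_swap ?_ ?_⟩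
    · intro z hz
      have hz' : z ∈ insert x G ∧ ¬ v.SameCycle p z := by
        rcases hz with rfl | hz
        · exact ⟨.inl rfl, hpx⟩
        · exact ⟨.inr hz.1, hz.2⟩
      rcases hw z hz'.1 with h' | h'
      · exact .inl h'
      · exact .inr ⟨h', fun h'' => hz'.2 (h''.trans (h.sameCycle_inv_mul_apply z).symm)⟩
    · refine iff_of_false ?_ ?_
      · rintro (rfl | h')
        · exact hpx (SameCycle.refl _ _)
        · exact h'.2 (SameCycle.refl _ _)
      · rintro (h' | h')
        · exact hq (.inl h')
        · exact hq (.inr h'.1)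
  · refine ⟨{z | z ∈ G ∨ v.SameCycle q z}, fun h => h.elim hxG hx, ?_,
      forall_mem_insert_mul_swap ?_ ?_⟩
    · rintro z (hz | hz)
      · exact .inl (hu z hz)
      · exact .inr (hz.trans (h.sameCycle_apply z))
    · intro z hz
      have hz' : z ∈ insert x G ∨ v.SameCycle q z := by
        rcases hz with rfl | hz | hz
        · exact .inl (.inl rfl)
        · exact .inl (.inr hz)
        · exact .inr hz
      rcases hz' with hz | hz
      · rcases hw z hz with h' | h'
        · exact .inl h'
        · exact .inr (.inl h')
      · exact .inr (.inr (hz.trans (h.sameCycle_inv_mul_apply z)))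
    · refine iff_of_true ?_ (.inr (.inr (SameCycle.refl _ _)))
      rcases hp with h' | h'
      · exact .inl h'
      · exact .inr (.inl h')

lemma mul_swap_of_sameCycle {w : Perm α} (h : HasClosedGaps u (u * w)) {p q : α}
    (hpq : w.SameCycle p q) : HasClosedGaps u (u * (w * swap p q)) := by
  intro x
  obtain ⟨G, hxG, hu, hw⟩ := h x
  refine ⟨G, hxG, hu, ?_⟩
  rw [← mul_assoc]
  have hw' : ∀ z ∈ insert x G, w z ∈ insert x G := by simpa using hw
  exact forall_mem_insert_mul_swap hw
    ⟨fun h => hpq.mem_of_mapsTo hw' h, fun h => hpq.symm.mem_of_mapsTo hw' h⟩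

end HasClosedGaps

lemma hasClosedGaps_of_absLe {n : ℕ} {u w : Perm (Fin n)} (h : AbsLe u (u * w)) :
    HasClosedGaps u (u * w) := by
  induction hk : reflLen w generalizing w with
  | zero =>
    have : w = 1 := by
      by_contra hw
      obtain ⟨p, q, hpq, hs⟩ := exists_sameCycle_of_ne_one hw
      have := reflLen_mul_swap_add_one hpq hs
      omega
    subst this
    exact fun x => ⟨∅, by simp, by simp, by simp⟩
  | succ k ih =>
    have hw : w ≠ 1 := by
      rintro rfl
      simp [reflLen_one] at hk
    obtain ⟨p, q, hpq, hs⟩ := exists_sameCycle_of_ne_one hw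
    have h₁ := reflLen_mul_swap_add_one hpq hs
    have h₂ := reflLen_mul_le u (w * swap p q)
    have h₃ := reflLen_mul_le (u * (w * swap p q)) (swap p q)
    have h₄ := reflLen_swap_le hpq
    have hv : u * (w * swap p q) * swap p q = u * w := by simp [mul_assoc]
    rw [hv] at h₃
    rw [AbsLe, inv_mul_cancel_left] at h
    rw [← hv]
    refine (ih (w := w * swap p q) ?_ (by omega)).mul_swap fun hs' => ?_
    · rw [AbsLe, inv_mul_cancel_left]
      omega
    · have h₅ := reflLen_mul_swap_add_one hpq hs'
      rw [hv] at h₅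
      omega

lemma HasClosedGaps.absLe {n : ℕ} {u w : Perm (Fin n)} (h : HasClosedGaps u (u * w)) :
    AbsLe u (u * w) := by
  induction hk : reflLen w using Nat.strong_induction_on generalizing w with
  | _ k ih =>
    subst hk
    rw [AbsLe, inv_mul_cancel_left]
    by_cases hw : w = 1
    · simp [hw, reflLen_one]
    obtain ⟨p, q, hpq, hs⟩ := exists_sameCycle_of_ne_one hw
    have hs' : (u * w).SameCycle p q :=
      hs.mem_of_mapsTo (S := {z | (u * w).SameCycle p z})
        (fun z hz => SameCycle.trans hz (by simpa using h.sameCycle_inv_mul_apply z))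
        (SameCycle.refl _ _)
    have h₁ := reflLen_mul_swap_add_one hpq hs
    have h₂ := reflLen_mul_swap_add_one hpq hs'
    have h₃ := ih _ (by omega) (h.mul_swap_of_sameCycle hs) rfl
    rw [AbsLe, inv_mul_cancel_left, ← mul_assoc] at h₃
    omega

lemma absLe_iff_hasClosedGaps {n : ℕ} (u v : Perm (Fin n)) : AbsLe u v ↔ HasClosedGaps u v := by
  rw [← mul_inv_cancel_left u v]
  exact ⟨hasClosedGaps_of_absLe, HasClosedGaps.absLe⟩

section CycleFactors

variable {α : Type*} [Fintype α] [DecidableEq α] {f c : Perm α} {x y : α}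

lemma mem_support_iff_sameCycle (hc : c ∈ f.cycleFactorsFinset) (hx : x ∈ c.support) :
    y ∈ c.support ↔ f.SameCycle x y := by
  rw [cycle_is_cycleOf hx hc,
    mem_support_cycleOf_iff' (mem_support.1 (mem_cycleFactorsFinset_support_le hc hx))]

lemma pow_apply_of_mem_cycleFactorsFinset (hc : c ∈ f.cycleFactorsFinset) (hx : x ∈ c.support)
    (m : ℕ) : (c ^ m) x = (f ^ m) x := by
  rw [cycle_is_cycleOf hx hc, cycleOf_pow_apply_self]

lemma apply_of_mem_cycleFactorsFinset (hc : c ∈ f.cycleFactorsFinset) (hx : x ∈ c.support) :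
    c x = f x :=
  (mem_cycleFactorsFinset_iff.1 hc).2 x hx

lemma exists_mem_cycleFactorsFinset (hx : f x ≠ x) : ∃ c ∈ f.cycleFactorsFinset, x ∈ c.support :=
  ⟨f.cycleOf x, cycleOf_mem_cycleFactorsFinset_iff.2 (mem_support.2 hx),
    mem_support_cycleOf_iff.2 ⟨SameCycle.refl _ _, mem_support.2 hx⟩⟩

end CycleFactors

lemma swap_mul_swap_mul_swap_apply {α : Type*} [DecidableEq α] {i j k l : α}
    (h : [i, j, k, l].Nodup) :
    (swap i l * swap i k * swap i j) i = j ∧ (swap i l * swap i k * swap i j) j = k ∧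
      (swap i l * swap i k * swap i j) k = l ∧ (swap i l * swap i k * swap i j) l = i := by
  simp only [List.nodup_cons, List.mem_cons, List.not_mem_nil, not_or, or_false] at h
  obtain ⟨⟨hij, hik, hil⟩, ⟨hjk, hjl⟩, hkl, -⟩ := h
  simp only [mul_apply, swap_apply_def]
  grind

lemma mem_support_swap_mul_swap_mul_swap {α : Type*} [Fintype α] [DecidableEq α] {i j k l : α}
    (h : [i, j, k, l].Nodup) {z : α} :
    z ∈ (swap i l * swap i k * swap i j).support ↔ z = i ∨ z = j ∨ z = k ∨ z = l := by
  obtain ⟨h₁, h₂, h₃, h₄⟩ := swap_mul_swap_mul_swap_apply h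
  simp only [List.nodup_cons, List.mem_cons, List.not_mem_nil, not_or, or_false] at h
  rw [mem_support]
  constructor
  · intro hz
    by_contra! hne
    apply hz
    simp only [mul_apply]
    rw [swap_apply_of_ne_of_ne hne.1 hne.2.1, swap_apply_of_ne_of_ne hne.1 hne.2.2.1,
      swap_apply_of_ne_of_ne hne.1 hne.2.2.2]
  · rintro (rfl | rfl | rfl | rfl) <;> grind

lemma pow_apply_injOn {α : Type*} {f : Perm α} {x : α} {N : ℕ}
    (hN : ∀ l : ℕ, 0 < l → l < N → (f ^ l) x ≠ x) {r s : ℕ} (hr : r < N) (hs : s < N)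
    (h : (f ^ r) x = (f ^ s) x) : r = s := by
  wlog hrs : r ≤ s generalizing r s
  · exact (this hs hr h.symm (by omega)).symm
  have := pow_sub_apply_eq hrs h
  by_contra hne
  exact hN (s - r) (by omega) (by omega) this.symm

lemma nodup_pow_apply {α : Type*} {f : Perm α} {x : α} {N r s t : ℕ}
    (hN : ∀ l : ℕ, 0 < l → l < N → (f ^ l) x ≠ x) (hr : 0 < r) (hrs : r < s) (hst : s < t)
    (ht : t < N) : [x, (f ^ r) x, (f ^ s) x, (f ^ t) x].Nodup := by
  have := List.Nodup.map_on (f := fun e => (f ^ e) x) (l := [0, r, s, t])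
    (fun a ha b hb h => pow_apply_injOn hN (by simp at ha; omega) (by simp at hb; omega) h)
    (by simp; omega)
  simpa only [List.map_cons, List.map_nil, pow_zero, one_apply] using this

lemma obtainedByDeletion_fourCycle {n : ℕ} {c : Perm (Fin n)} {x : Fin n} {N r s t : ℕ}
    (hx : x ∈ c.support) (hNx : (c ^ N) x = x)
    (hN : ∀ l : ℕ, 0 < l → l < N → (c ^ l) x ≠ x) (hr : 0 < r) (hrs : r < s) (hst : s < t)
    (ht : t < N) :
    ObtainedByDeletion (swap x ((c ^ t) x) * swap x ((c ^ s) x) * swap x ((c ^ r) x)) c := by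
  have hnd := nodup_pow_apply hN hr hrs hst ht
  obtain ⟨h₁, h₂, h₃, h₄⟩ := swap_mul_swap_mul_swap_apply hnd
  have hmem : ∀ z, z ∈ (swap x ((c ^ t) x) * swap x ((c ^ s) x) * swap x ((c ^ r) x)).support ↔
      _ := fun z => mem_support_swap_mul_swap_mul_swap hnd
  have hnot : ∀ e < N, e ≠ 0 → e ≠ r → e ≠ s → e ≠ t →
      (c ^ e) x ∉ (swap x ((c ^ t) x) * swap x ((c ^ s) x) * swap x ((c ^ r) x)).support := by
    intro e he h0 her hes het hm
    rcases (hmem _).1 hm with h | h | h | h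
    · exact h0 (pow_apply_injOn (s := 0) hN he (by omega) h)
    · exact her (pow_apply_injOn hN he (by omega) h)
    · exact hes (pow_apply_injOn hN he (by omega) h)
    · exact het (pow_apply_injOn hN he (by omega) h)
  refine ⟨fun z hz => ?_, fun z hz => ?_⟩
  · rcases (hmem z).1 hz with rfl | rfl | rfl | rfl
    · exact hx
    all_goals exact pow_apply_mem_support.2 hx
  · rcases (hmem z).1 hz with rfl | rfl | rfl | rfl
    · exact ⟨r, hr, h₁, fun l hl hlr => hnot l (by omega) (by omega) (by omega) (by omega)
        (by omega)⟩
    · refine ⟨s - r, by omega, ?_, fun l hl hlr => ?_⟩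
      · rw [h₂, ← mul_apply, ← pow_add, Nat.sub_add_cancel hrs.le]
      · rw [← mul_apply, ← pow_add]
        exact hnot _ (by omega) (by omega) (by omega) (by omega) (by omega)
    · refine ⟨t - s, by omega, ?_, fun l hl hlr => ?_⟩
      · rw [h₃, ← mul_apply, ← pow_add, Nat.sub_add_cancel hst.le]
      · rw [← mul_apply, ← pow_add]
        exact hnot _ (by omega) (by omega) (by omega) (by omega) (by omega)
    · refine ⟨N - t, by omega, ?_, fun l hl hlr => ?_⟩
      · rw [h₄, ← mul_apply, ← pow_add, Nat.sub_add_cancel ht.le, hNx]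
      · rw [← mul_apply, ← pow_add]
        exact hnot _ (by omega) (by omega) (by omega) (by omega) (by omega)

section

variable {n : ℕ} {u v : Perm (Fin n)}

lemma HasClosedGaps.exists_obtainedByDeletion (h : HasClosedGaps u v) {a : Perm (Fin n)}
    (ha : a ∈ u.cycleFactorsFinset) : ∃ c ∈ v.cycleFactorsFinset, ObtainedByDeletion a c := by
  obtain ⟨x, hx⟩ := (mem_cycleFactorsFinset_iff.1 ha).1.nonempty_support
  have hux : u x ≠ x := mem_support.1 (mem_cycleFactorsFinset_support_le ha hx)
  have hvx : v x ≠ x := fun hvx => hux ((h.sameCycle_apply x).eq_of_left hvx).symm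
  obtain ⟨c, hc, hxc⟩ := exists_mem_cycleFactorsFinset hvx
  have hsub : a.support ⊆ c.support := fun y hy =>
    (mem_support_iff_sameCycle hc hxc).2 (h.sameCycle ((mem_support_iff_sameCycle ha hx).1 hy))
  refine ⟨c, hc, hsub, fun z hz => ?_⟩
  obtain ⟨G, hzG, hu, hw⟩ := h z
  obtain ⟨m, hm, hmz, hmin⟩ := (h.sameCycle_apply z).exists_first_pow_eq
  refine ⟨m, hm, ?_, fun l hl hlm hmem => ?_⟩
  · rw [apply_of_mem_cycleFactorsFinset ha hz,
      pow_apply_of_mem_cycleFactorsFinset hc (hsub hz), hmz]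
  · rw [pow_apply_of_mem_cycleFactorsFinset hc (hsub hz)] at hmem
    have key : ∀ e < m, (v ^ e) z ∈ insert z G := by
      intro e
      induction e with
      | zero => intro _; exact .inl rfl
      | succ e ih =>
        intro he
        rw [pow_succ', mul_apply]
        rcases apply_eq_or_mem hu hw (ih (by omega)) with h' | h'
        · exact absurd (by rwa [pow_succ', mul_apply]) (hmin (e + 1) (by omega) he)
        · exact .inr h'
    have hlG : (v ^ l) z ∈ G := by
      obtain ⟨e, rfl⟩ := Nat.exists_eq_add_one.2 hl
      rcases apply_eq_or_mem hu hw (key e (by omega)) with h' | h'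
      · exact absurd (by rwa [pow_succ', mul_apply]) (hmin (e + 1) (by omega) hlm)
      · rwa [pow_succ', mul_apply]
    exact hzG (((mem_support_iff_sameCycle ha hz).1 hmem).symm.mem_of_mapsTo hu hlG)

lemma HasClosedGaps.noncrossingWrt (h : HasClosedGaps u v) {a b c : Perm (Fin n)}
    (ha : a ∈ u.cycleFactorsFinset) (hb : b ∈ u.cycleFactorsFinset) (hab : a ≠ b)
    (hc : c ∈ v.cycleFactorsFinset) (hac : a.support ⊆ c.support) (hbc : b.support ⊆ c.support) :
    NoncrossingWrt a b c := by
  rintro ⟨i, j, k, l, hnd, hi, hk, hj, hl, -, hd⟩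
  obtain ⟨hdi, hdj, hdk, hdl⟩ := swap_mul_swap_mul_swap_apply hnd
  have hmem : ∀ z, z ∈ (swap i l * swap i k * swap i j).support ↔ _ :=
    fun z => mem_support_swap_mul_swap_mul_swap hnd
  set d := swap i l * swap i k * swap i j
  obtain ⟨m₁, hm₁, hij, -⟩ := hd i ((hmem i).2 (by simp))
  obtain ⟨m₂, hm₂, hjk, hjk'⟩ := hd j ((hmem j).2 (by simp))
  obtain ⟨m₄, hm₄, hli, hli'⟩ := hd l ((hmem l).2 (by simp))
  rw [hdi, pow_apply_of_mem_cycleFactorsFinset hc (hac hi)] at hij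
  rw [hdj, pow_apply_of_mem_cycleFactorsFinset hc (hbc hj)] at hjk
  rw [hdl, pow_apply_of_mem_cycleFactorsFinset hc (hbc hl)] at hli
  have hjl : j ≠ l := by
    rintro rfl
    simp at hnd
  have hba : ∀ y ∈ b.support, y ∉ a.support := fun y hyb hya =>
    hab ((cycle_is_cycleOf hya ha).trans (cycle_is_cycleOf hyb hb).symm)
  obtain ⟨r, hr, hra, hrmax⟩ : ∃ r ≤ m₁, (v ^ r) i ∈ a.support ∧
      ∀ s, r < s → s ≤ m₁ → (v ^ s) i ∉ a.support :=
    ⟨Nat.findGreatest (fun r => (v ^ r) i ∈ a.support) m₁, Nat.findGreatest_le _,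
      Nat.findGreatest_spec (P := fun r => (v ^ r) i ∈ a.support) (Nat.zero_le _) hi,
      fun s hs hs' => Nat.findGreatest_is_greatest hs hs'⟩
  have hrlt : r < m₁ := by
    refine hr.lt_of_ne ?_
    rintro rfl
    exact hba j hj (hij ▸ hra)
  obtain ⟨G, hxG, hu, hw⟩ := h ((v ^ r) i)
  have huxa : u ((v ^ r) i) ∈ a.support :=
    (mem_support_iff_sameCycle ha hra).2 (sameCycle_apply_right.2 (SameCycle.refl _ _))
  have haG : ∀ y ∈ a.support, y ∉ G := fun y hy hyG =>
    hxG (((mem_support_iff_sameCycle ha hy).1 hra).mem_of_mapsTo hu hyG)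
  have hG : ∀ s, r + s ≤ m₁ → (v ^ (r + s)) i ∈ insert ((v ^ r) i) G := by
    intro s
    induction s with
    | zero => intro _; exact .inl rfl
    | succ s ih =>
      intro hs
      rcases apply_eq_or_mem hu hw (ih (by omega)) with h' | h'
      · refine absurd ?_ (hrmax (r + (s + 1)) (by omega) hs)
        rwa [← add_assoc, pow_succ', mul_apply, h']
      · rw [← add_assoc, pow_succ', mul_apply]
        exact .inr h'
  have hjG : j ∈ G := by
    have := hG (m₁ - r) (by omega)
    rw [Nat.add_sub_cancel' hr, ← hij] at this
    refine this.resolve_left ?_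
    rintro rfl
    exact hba _ hj hra
  have hlG : l ∈ G := ((mem_support_iff_sameCycle hb hj).1 hl).mem_of_mapsTo hu hjG
  have hexit : ∀ y ∈ G, ∀ m, (v ^ m) y ∉ G → ∃ s ≤ m, 0 < s ∧ (v ^ s) y = u ((v ^ r) i) := by
    intro y hy m
    induction m with
    | zero => intro h'; exact absurd hy h'
    | succ m ih =>
      intro h'
      by_cases hm : (v ^ m) y ∈ G
      · rw [pow_succ', mul_apply] at h'
        refine ⟨m + 1, le_rfl, by omega, ?_⟩
        rw [pow_succ', mul_apply]
        exact (apply_eq_or_mem hu hw (.inr hm)).resolve_right h'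
      · obtain ⟨s, hs, hs'⟩ := ih hm
        exact ⟨s, by omega, hs'⟩
  obtain ⟨s, hs, hs0, hsj⟩ := hexit j hjG m₂ (hjk ▸ haG k hk)
  obtain ⟨t, ht, ht0, htl⟩ := hexit l hlG m₄ (hli ▸ haG i hi)
  rcases le_total s t with hst | hst
  · have hjl' := pow_sub_apply_eq hst (hsj.trans htl.symm)
    have hne : t - s ≠ 0 := fun h0 => hjl (by simpa [h0] using hjl')
    apply hli' (t - s) (by omega) (by omega)
    rw [pow_apply_of_mem_cycleFactorsFinset hc (hbc hl), ← hjl']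
    exact (hmem j).2 (by simp)
  · have hjl' := pow_sub_apply_eq hst (htl.trans hsj.symm)
    have hne : s - t ≠ 0 := fun h0 => hjl (by simpa [h0] using hjl'.symm)
    apply hjk' (s - t) (by omega) (by omega)
    rw [pow_apply_of_mem_cycleFactorsFinset hc (hbc hj), ← hjl']
    exact (hmem l).2 (by simp)

lemma hasClosedGaps_of_noncrossing
    (hA : ∀ a ∈ u.cycleFactorsFinset, ∃ c ∈ v.cycleFactorsFinset, ObtainedByDeletion a c)
    (hB : ∀ a ∈ u.cycleFactorsFinset, ∀ b ∈ u.cycleFactorsFinset, a ≠ b →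
      ∀ c ∈ v.cycleFactorsFinset, ObtainedByDeletion a c → ObtainedByDeletion b c →
        NoncrossingWrt a b c) : HasClosedGaps u v := by
  have hO : ∀ z, v.SameCycle z (u z) := by
    intro z
    by_cases hz : u z = z
    · rw [hz]
    · obtain ⟨a, ha, hza⟩ := exists_mem_cycleFactorsFinset hz
      obtain ⟨c, hc, hac, -⟩ := hA a ha
      refine (mem_support_iff_sameCycle hc (hac hza)).1 (hac ?_)
      exact (mem_support_iff_sameCycle ha hza).2 (sameCycle_apply_right.2 (SameCycle.refl _ _))
  intro x
  by_cases hx : u x = x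
  · refine ⟨{z | v.SameCycle x z ∧ z ≠ x}, fun h => h.2 rfl,
      fun z hz => ⟨hz.1.trans (hO z), fun h => hz.2 (u.injective (h.trans hx.symm))⟩,
      fun z hz => ?_⟩
    have hz' : v.SameCycle x z := by
      rcases hz with rfl | hz
      · exact SameCycle.refl _ _
      · exact hz.1
    have hO' : v.SameCycle (u⁻¹ (v z)) (v z) := by simpa using hO (u⁻¹ (v z))
    by_cases h : u⁻¹ (v z) = x
    · exact .inl h
    · exact .inr ⟨(sameCycle_apply_right.2 hz').trans hO'.symm, h⟩
  obtain ⟨a, ha, hxa⟩ := exists_mem_cycleFactorsFinset hx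
  obtain ⟨c, hc, hac⟩ := hA a ha
  have hxc := hac.1 hxa
  have huxa : u x ∈ a.support :=
    (mem_support_iff_sameCycle ha hxa).2 (sameCycle_apply_right.2 (SameCycle.refl _ _))
  have hcv := pow_apply_of_mem_cycleFactorsFinset hc hxc
  obtain ⟨m, hm, hmx, hma⟩ := hac.2 x hxa
  rw [apply_of_mem_cycleFactorsFinset ha hxa] at hmx
  obtain ⟨N, hN, hNx, hNmin⟩ := (SameCycle.refl c x).exists_first_pow_eq
  have hmN : m < N := by
    by_contra! hle
    rcases hle.eq_or_lt with rfl | hlt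
    · exact hx (hmx.trans hNx)
    · exact hma N hN hlt (hNx.symm ▸ hxa)
  have hu : ∀ z ∈ {z | ∃ l, 0 < l ∧ l < m ∧ (c ^ l) x = z},
      u z ∈ {z | ∃ l, 0 < l ∧ l < m ∧ (c ^ l) x = z} := by
    rintro z ⟨l, hl, hlm, hlz⟩
    by_cases huz : u z = z
    · exact ⟨l, hl, hlm, hlz.trans huz.symm⟩
    obtain ⟨b, hb, hzb⟩ := exists_mem_cycleFactorsFinset huz
    obtain ⟨c', hc', hbc⟩ := hA b hb
    have hza : z ∉ a.support := hlz ▸ hma l hl hlm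
    have hzc : z ∈ c.support := hlz ▸ pow_apply_mem_support.2 hxc
    obtain rfl : c' = c :=
      (cycle_is_cycleOf (hbc.1 hzb) hc').trans (cycle_is_cycleOf hzc hc).symm
    have huzb : u z ∈ b.support :=
      (mem_support_iff_sameCycle hb hzb).2 (sameCycle_apply_right.2 (SameCycle.refl _ _))
    have huza : u z ∉ a.support := fun h => hza
      ((mem_support_iff_sameCycle ha hxa).2
        (sameCycle_apply_right.1 ((mem_support_iff_sameCycle ha hxa).1 h)))
    have hcs : c'.SameCycle x (u z) := (mem_cycleFactorsFinset_iff.1 hc).1.sameCycle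
      (mem_support.1 hxc) (mem_support.1 (hbc.1 huzb))
    obtain ⟨k, hk, hkz, hkmin⟩ := hcs.exists_first_pow_eq
    have hkN : k < N := by
      by_contra! hle
      rcases hle.eq_or_lt with rfl | hlt
      · exact huza (by rwa [← hkz, hNx])
      · refine hkmin (k - N) (by omega) (by omega) ?_
        rw [← hkz]
        conv_lhs => rw [← hNx]
        rw [← mul_apply, ← pow_add, Nat.sub_add_cancel hle]
    rcases lt_trichotomy k m with hkm | rfl | hkm
    · exact ⟨k, hk, hkm, hkz⟩
    · exact absurd huxa (hmx.trans hkz ▸ huza)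
    refine absurd ?_ (hB a ha b hb (fun h => hza (h ▸ hzb)) c' hc hac hbc)
    refine ⟨x, z, u x, u z, ?_, hxa, huxa, hzb, huzb, ?_⟩
    · rw [← hlz, hmx, hlz, ← hkz, ← hlz]
      exact nodup_pow_apply hNmin hl hlm hkm hkN
    · rw [← hkz, hmx, ← hlz]
      exact obtainedByDeletion_fourCycle hxc hNx hNmin hl hlm hkm hkN
  refine ⟨_, ?_, hu, fun z hz => ?_⟩
  · rintro ⟨l, hl, hlm, hlx⟩
    exact hma l hl hlm (hlx.symm ▸ hxa)
  · obtain ⟨l, hlm, rfl⟩ : ∃ l < m, (c ^ l) x = z := by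
      rcases hz with rfl | ⟨l, -, hlm, hlz⟩
      · exact ⟨0, hm, rfl⟩
      · exact ⟨l, hlm, hlz⟩
    have hv : v ((c ^ l) x) = (c ^ (l + 1)) x := by rw [hcv, hcv, pow_succ', mul_apply]
    rw [hv]
    rcases (Nat.succ_le_of_lt hlm).eq_or_lt with rfl | hlt
    · exact .inl (inv_eq_iff_eq.2 hmx.symm)
    · refine .inr (SameCycle.mem_of_mapsTo (f := u) ?_ hu ⟨l + 1, by omega, hlt, Eq.refl _⟩)
      exact ⟨-1, by simp⟩

end

/-- Characterization of the absolute order on `S_n`: `u ⪯ v` iff every cycle of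
`u` can be obtained from some cycle of `v` by deleting elements, and any two
cycles of `u` obtained from the same cycle `c` of `v` are noncrossing with
respect to `c`. -/
theorem absLe_iff_cycles {n : ℕ} (u v : Equiv.Perm (Fin n)) :
    AbsLe u v ↔
      (∀ a ∈ u.cycleFactorsFinset, ∃ c ∈ v.cycleFactorsFinset,
          ObtainedByDeletion a c) ∧
      (∀ a ∈ u.cycleFactorsFinset, ∀ b ∈ u.cycleFactorsFinset, a ≠ b →
        ∀ c ∈ v.cycleFactorsFinset,
          ObtainedByDeletion a c → ObtainedByDeletion b c →
            NoncrossingWrt a b c) := by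
  rw [absLe_iff_hasClosedGaps]
  exact ⟨fun h => ⟨fun a ha => h.exists_obtainedByDeletion ha,
    fun a ha b hb hab c hc hac hbc => h.noncrossingWrt ha hb hab hc hac.1 hbc.1⟩,
    fun h => hasClosedGaps_of_noncrossing h.1 h.2⟩
end
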